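/- arXiv:1801.00709 — 2 statements merged into one kernel-verified Lean document; each statement's English description precedes it below -/
import Mathlib

section
/- Let n ≥ 2 and suppose the cluster pattern with initial seed (B, (u_1,…,u_n)) is of type C_n. If y and y′ are cluster variables of the pattern with den(y) = den(y′) (denominator vectors taken with respect to the initial cluster (u_1,…,u_n)), then y = y′; that is, different cluster variables have different denominator vectors. -/
open MvPolynomial Matrix

noncomputable section

/-- The ambient field `ℚ(u_1, …, u_n)`. -/
abbrev CAField (n : ℕ) : Type := FractionRing (MvPolynomial (Fin n) ℚ)

/-- The initial cluster variables `u_i`. -/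
def uVar (n : ℕ) (i : Fin n) : CAField n :=
  algebraMap (MvPolynomial (Fin n) ℚ) (CAField n) (X i)

/-- Fomin–Zelevinsky matrix mutation in direction `k`. -/
def mutMat {n : ℕ} (k : Fin n) (B : Matrix (Fin n) (Fin n) ℤ) :
    Matrix (Fin n) (Fin n) ℤ := fun i j =>
  if i = k ∨ j = k then -B i j
  else B i j + (B i k).sign * max (B i k * B k j) 0

/-- Seed mutation in direction `k`: the matrix mutates by `mutMat` and the
`k`-th cluster variable `x_k` is replaced by
`(∏ x_i^{[B_ik]_+} + ∏ x_i^{[-B_ik]_+}) / x_k`. -/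
def mutSeed {n : ℕ} (k : Fin n)
    (s : Matrix (Fin n) (Fin n) ℤ × (Fin n → CAField n)) :
    Matrix (Fin n) (Fin n) ℤ × (Fin n → CAField n) :=
  (mutMat k s.1,
    Function.update s.2 k
      ((∏ i, s.2 i ^ (s.1 i k).toNat + ∏ i, s.2 i ^ (-(s.1 i k)).toNat) / s.2 k))

/-- The seeds of the cluster pattern with initial exchange matrix `B₀` and
initial cluster `(u_1, …, u_n)`: all seeds reachable from the initial seed
by finite sequences of mutations. -/
def IsSeed {n : ℕ} (B₀ : Matrix (Fin n) (Fin n) ℤ)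
    (s : Matrix (Fin n) (Fin n) ℤ × (Fin n → CAField n)) : Prop :=
  Relation.ReflTransGen (fun a b => ∃ k, b = mutSeed k a) (B₀, uVar n) s

/-- `B` is skew-symmetrizable: `D * B` is skew-symmetric for some diagonal `D`
with positive integer diagonal entries. -/
def SkewSymmetrizable {n : ℕ} (B : Matrix (Fin n) (Fin n) ℤ) : Prop :=
  ∃ d : Fin n → ℤ, (∀ i, 0 < d i) ∧
    (Matrix.diagonal d * B)ᵀ = -(Matrix.diagonal d * B)

/-- The Cartan counterpart `A(B)` of `B`. -/
def cartanCounterpart {n : ℕ} (B : Matrix (Fin n) (Fin n) ℤ) :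
    Matrix (Fin n) (Fin n) ℤ := fun i j => if i = j then 2 else -|B i j|

/-- The Cartan matrix of type `C_n` (with rows and columns indexed by
`0, …, n-1`): `2` on the diagonal, `-2` in position `(n-2, n-1)`, and `-1`
in the remaining positions `(i, i±1)`. -/
def cartanC (n : ℕ) : Matrix (Fin n) (Fin n) ℤ := fun i j =>
  if i = j then 2
  else if i.val + 2 = n ∧ j.val + 1 = n then -2
  else if i.val + 1 = j.val ∨ j.val + 1 = i.val then -1 else 0

/-- The cluster pattern with initial matrix `B₀` is of the finite type with
Cartan matrix `Cmat`: some seed of the pattern has exchange matrix whose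
Cartan counterpart equals `Cmat` up to simultaneous permutation of rows and
columns. -/
def PatternOfType {n : ℕ} (Cmat B₀ : Matrix (Fin n) (Fin n) ℤ) : Prop :=
  ∃ s, IsSeed B₀ s ∧ ∃ σ : Equiv.Perm (Fin n),
    ∀ i j, cartanCounterpart s.1 (σ i) (σ j) = Cmat i j

/-- `d` is the denominator vector of `y` with respect to the cluster `z`:
`y = f(z_1, …, z_n) / ∏ z_i^{d_i}` with `f` an integer polynomial not
divisible by any variable. -/
def IsDenomVec {n : ℕ} (z : Fin n → CAField n) (y : CAField n)
    (d : Fin n → ℤ) : Prop :=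
  ∃ f : MvPolynomial (Fin n) ℤ, (∀ i, ¬ X i ∣ f) ∧
    y = MvPolynomial.aeval z f / ∏ i, z i ^ d i

/-- `y` is a cluster variable of the pattern with initial matrix `B₀`. -/
def IsClusterVar {n : ℕ} (B₀ : Matrix (Fin n) (Fin n) ℤ) (y : CAField n) : Prop :=
  ∃ s, IsSeed B₀ s ∧ ∃ j, s.2 j = y

/-- Binary trees with labelled internal nodes. -/
inductive LTree (n : ℕ) : Type
  | leaf : LTree n
  | node (k : Fin n) (l r : LTree n) : LTree n

namespace LTree
variable {n : ℕ}

/-- Number of leaves. -/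
def size : LTree n → ℤ
  | leaf => 1
  | node _ l r => size l + size r

/-- List of labels. -/
def labels : LTree n → List (Fin n)
  | leaf => []
  | node k l r => k :: (labels l ++ labels r)

/-- Label of the root (none for a leaf). -/
def top : LTree n → Option (Fin n)
  | leaf => none
  | node k _ _ => some k

/-- Indicator. -/
def ind (x : Option (Fin n)) (i : Fin n) : ℤ := if x = some i then 1 else 0

/-- Elementary arrow. -/
def ar (x y : Option (Fin n)) (i j : Fin n) : ℤ :=
  ind x i * ind y j - ind x j * ind y i

/-- Oriented triangle. -/
def tri (p a b : Option (Fin n)) : Matrix (Fin n) (Fin n) ℤ :=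
  fun i j => ar p a i j + ar a b i j + ar b p i j

/-- The skew-symmetric matrix of a tree. -/
def mat : LTree n → Matrix (Fin n) (Fin n) ℤ
  | leaf => 0
  | node k l r => tri (some k) (top l) (top r) + (mat l + mat r)

/-- The exchange matrix of a tree. -/
def bmat (t : LTree n) : Matrix (Fin n) (Fin n) ℤ :=
  fun i j => mat t i j * (if t.top = some j then 2 else 1)

/-- Rotation of a tree at a non-root node. -/
inductive Rot (k : Fin n) : LTree n → LTree n → Prop
  | left (p : Fin n) (A B C : LTree n) :
      Rot k (node p (node k A B) C) (node p A (node k B C))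
  | right (p : Fin n) (A B C : LTree n) :
      Rot k (node p A (node k B C)) (node p (node k A B) C)
  | inl (p : Fin n) (l l' r : LTree n) : Rot k l l' → Rot k (node p l r) (node p l' r)
  | inr (p : Fin n) (l r r' : LTree n) : Rot k r r' → Rot k (node p l r) (node p l r')

theorem size_pos (t : LTree n) : 1 ≤ t.size := by
  induction t with
  | leaf => simp [size]
  | node k l r hl hr => simp only [size]; omega

theorem size_eq (t : LTree n) : t.size = t.labels.length + 1 := by
  induction t with
  | leaf => simp [size, labels]
  | node k l r hl hr => simp only [size, labels, List.length_cons, List.length_append]; push_cast; omega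

theorem top_mem {t : LTree n} {k : Fin n} (h : t.top = some k) : k ∈ t.labels := by
  cases t with
  | leaf => simp [top] at h
  | node k l r => simp [top] at h; simp [labels, h]

theorem ar_zero {x y : Option (Fin n)} {i j k : Fin n} (hx : x ≠ some k) (hy : y ≠ some k)
    (h : i = k ∨ j = k) : ar x y i j = 0 := by
  unfold ar
  rcases h with rfl | rfl <;> simp [ind, hx, hy]

theorem tri_zero {x y z : Option (Fin n)} {i j k : Fin n} (hx : x ≠ some k) (hy : y ≠ some k)
    (hz : z ≠ some k) (h : i = k ∨ j = k) : tri x y z i j = 0 := by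
  simp [tri, ar_zero hx hy h, ar_zero hy hz h, ar_zero hz hx h]

theorem mat_zero {t : LTree n} {i j k : Fin n} (hk : k ∉ t.labels) (h : i = k ∨ j = k) :
    mat t i j = 0 := by
  induction t with
  | leaf => simp [mat]
  | node p l r hl hr =>
    simp only [labels, List.mem_cons, List.mem_append, not_or] at hk
    have h1 : top l ≠ some k := fun h => hk.2.1 (top_mem h)
    have h2 : top r ≠ some k := fun h => hk.2.2 (top_mem h)
    have h3 : some p ≠ some k := by simpa using fun h => hk.1 h.symm
    simp [mat, tri_zero h3 h1 h2 h, hl hk.2.1, hr hk.2.2]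

theorem mutMat_add (k : Fin n) (P Q : Matrix (Fin n) (Fin n) ℤ)
    (h : ∀ i j, (i = k ∨ j = k) → Q i j = 0) : mutMat k (P + Q) = mutMat k P + Q := by
  ext i j
  simp only [mutMat, Matrix.add_apply]
  rw [h i k (Or.inr rfl), h k j (Or.inl rfl)]
  by_cases hk : i = k ∨ j = k
  · simp [hk, h i j hk]
  · simp only [hk, if_false, add_zero]; ring

theorem mutMat_mutMat (k : Fin n) (P : Matrix (Fin n) (Fin n) ℤ) :
    mutMat k (mutMat k P) = P := by
  ext i j
  by_cases hk : i = k ∨ j = k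
  · simp [mutMat, hk]
  · simp [mutMat, hk]

theorem ind_self (k : Fin n) : ind (some k) k = 1 := by simp [ind]

theorem ind_ne {x : Option (Fin n)} {k : Fin n} (h : x ≠ some k) : ind x k = 0 := by simp [ind, h]

theorem ind_eq {x : Option (Fin n)} {k : Fin n} (h : x = some k) : ind x k = 1 := by simp [ind, h]

theorem ind_cases (p a b c : Option (Fin n))
    (ha' : ∀ i, p = some i → a ≠ some i) (hb' : ∀ i, p = some i → b ≠ some i)
    (hc' : ∀ i, p = some i → c ≠ some i)
    (hab : ∀ i, a = some i → b ≠ some i) (hac : ∀ i, a = some i → c ≠ some i)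
    (hbc : ∀ i, b = some i → c ≠ some i) (i : Fin n) :
    (ind p i = 1 ∧ ind a i = 0 ∧ ind b i = 0 ∧ ind c i = 0) ∨
    (ind p i = 0 ∧ ind a i = 1 ∧ ind b i = 0 ∧ ind c i = 0) ∨
    (ind p i = 0 ∧ ind a i = 0 ∧ ind b i = 1 ∧ ind c i = 0) ∨
    (ind p i = 0 ∧ ind a i = 0 ∧ ind b i = 0 ∧ ind c i = 1) ∨
    (ind p i = 0 ∧ ind a i = 0 ∧ ind b i = 0 ∧ ind c i = 0) := by
  have := ha' i
  have := hb' i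
  have := hc' i
  have := hab i
  have := hac i
  have := hbc i
  unfold ind
  by_cases h1 : p = some i <;> by_cases h2 : a = some i <;> by_cases h3 : b = some i <;>
    by_cases h4 : c = some i <;> simp_all

theorem tri_left (k : Fin n) (p a b c : Option (Fin n)) (hp : p ≠ some k)
    (ha : a ≠ some k) (hb : b ≠ some k) (hc : c ≠ some k)
    (ha' : ∀ i, p = some i → a ≠ some i) (hb' : ∀ i, p = some i → b ≠ some i)
    (hc' : ∀ i, p = some i → c ≠ some i)
    (hab : ∀ i, a = some i → b ≠ some i) (hac : ∀ i, a = some i → c ≠ some i)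
    (hbc : ∀ i, b = some i → c ≠ some i) :
    mutMat k (tri p (some k) c + tri (some k) a b)
      = tri p a (some k) + tri (some k) b c := by
  have key := ind_cases p a b c ha' hb' hc' hab hac hbc
  ext i j
  simp only [mutMat, Matrix.add_apply, tri, ar]
  by_cases hi : i = k
  · subst hi
    simp only [true_or, if_true, ind_self, ind_ne hp, ind_ne ha, ind_ne hb, ind_ne hc]
    ring
  by_cases hj : j = k
  · subst hj
    simp only [or_true, if_true, ind_self, ind_ne hp, ind_ne ha, ind_ne hb, ind_ne hc]
    ring
  have hi' : some k ≠ some i := by simpa using fun h => hi h.symm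
  have hj' : some k ≠ some j := by simpa using fun h => hj h.symm
  simp only [hi, hj, or_self, if_false, ind_self, ind_ne hp, ind_ne ha, ind_ne hb, ind_ne hc,
    ind_ne hi', ind_ne hj']
  rcases key i with ⟨h1, h2, h3, h4⟩ | ⟨h1, h2, h3, h4⟩ | ⟨h1, h2, h3, h4⟩ | ⟨h1, h2, h3, h4⟩ |
    ⟨h1, h2, h3, h4⟩ <;>
  rcases key j with ⟨g1, g2, g3, g4⟩ | ⟨g1, g2, g3, g4⟩ | ⟨g1, g2, g3, g4⟩ | ⟨g1, g2, g3, g4⟩ |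
    ⟨g1, g2, g3, g4⟩ <;>
  rw [h1, h2, h3, h4, g1, g2, g3, g4] <;> decide

theorem tri_right (k : Fin n) (p a b c : Option (Fin n)) (hp : p ≠ some k)
    (ha : a ≠ some k) (hb : b ≠ some k) (hc : c ≠ some k)
    (ha' : ∀ i, p = some i → a ≠ some i) (hb' : ∀ i, p = some i → b ≠ some i)
    (hc' : ∀ i, p = some i → c ≠ some i)
    (hab : ∀ i, a = some i → b ≠ some i) (hac : ∀ i, a = some i → c ≠ some i)
    (hbc : ∀ i, b = some i → c ≠ some i) :
    mutMat k (tri p a (some k) + tri (some k) b c)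
      = tri p (some k) c + tri (some k) a b := by
  rw [← tri_left k p a b c hp ha hb hc ha' hb' hc' hab hac hbc, mutMat_mutMat]

/-- `mutMat` with doubled root column, at the root. -/
theorem tri_root (k : Fin n) (a b : Option (Fin n)) (ha : a ≠ some k) (hb : b ≠ some k)
    (hab : ∀ i, a = some i → b ≠ some i) (Q : Matrix (Fin n) (Fin n) ℤ)
    (hQ : ∀ i j, (i = k ∨ j = k) → Q i j = 0) :
    mutMat k (fun i j => (tri (some k) a b + Q) i j * (if some k = some j then 2 else 1))
      = fun i j => (tri (some k) b a + Q) i j * (if some k = some j then 2 else 1) := by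
  ext i j
  simp only [mutMat, Matrix.add_apply, tri, ar]
  by_cases hi : i = k
  · subst hi
    simp only [true_or, if_true, ind_self, ind_ne ha, ind_ne hb, hQ _ _ (Or.inl rfl)]
    ring
  by_cases hj : j = k
  · subst hj
    simp only [or_true, if_true, ind_self, ind_ne ha, ind_ne hb, hQ _ _ (Or.inr rfl)]
    ring
  have hi' : some k ≠ some i := by simpa using fun h => hi h.symm
  have hj' : some k ≠ some j := by simpa using fun h => hj h.symm
  rw [hQ i k (Or.inr rfl), hQ k j (Or.inl rfl)]
  simp only [hi, hj, or_self, if_false, if_true, ind_self, ind_ne ha, ind_ne hb,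
    ind_ne hi', ind_ne hj', hj']
  have key : ∀ i : Fin n, (ind a i = 1 ∧ ind b i = 0) ∨ (ind a i = 0 ∧ ind b i = 1) ∨
      (ind a i = 0 ∧ ind b i = 0) := by
    intro i
    have := hab i
    unfold ind
    by_cases h2 : a = some i <;> by_cases h3 : b = some i <;> simp_all
  rcases key i with ⟨h1, h2⟩ | ⟨h1, h2⟩ | ⟨h1, h2⟩ <;>
  rcases key j with ⟨g1, g2⟩ | ⟨g1, g2⟩ | ⟨g1, g2⟩ <;>
  rw [h1, h2, g1, g2] <;> norm_num <;> ring

/-- mutation at a non-doubled index commutes with doubling of a column. -/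
theorem mutMat_double (k : Fin n) (r : Option (Fin n)) (hr : r ≠ some k)
    (P : Matrix (Fin n) (Fin n) ℤ) :
    mutMat k (fun i j => P i j * (if r = some j then 2 else 1))
      = fun i j => mutMat k P i j * (if r = some j then 2 else 1) := by
  ext i j
  simp only [mutMat, hr, if_false, mul_one]
  by_cases h : i = k ∨ j = k
  · simp only [h, if_true]; ring
  · simp only [h, if_false]
    split_ifs
    · have : max (P i k * (P k j * 2)) 0 = max (P i k * P k j) 0 * 2 := by
        rw [← mul_assoc]; omega
      rw [this]; ring
    · simp

theorem Rot.top_eq {k : Fin n} {t t' : LTree n} (h : Rot k t t') : t'.top = t.top := by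
  cases h <;> simp [top]

theorem Rot.size_eq {k : Fin n} {t t' : LTree n} (h : Rot k t t') : t'.size = t.size := by
  induction h <;> simp only [size] <;> omega

theorem Rot.perm {k : Fin n} {t t' : LTree n} (h : Rot k t t') : t'.labels.Perm t.labels := by
  induction h with
  | left p A B C =>
    simp only [labels, List.cons_append, List.append_assoc]
    refine List.Perm.cons _ ?_
    exact List.perm_middle
  | right p A B C =>
    simp only [labels, List.cons_append, List.append_assoc]
    refine List.Perm.cons _ ?_
    exact List.perm_middle.symm
  | inl p l l' r h ih => simp only [labels]; exact (ih.append_right _).cons _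
  | inr p l l' r h ih => simp only [labels]; exact (ih.append_left _).cons _

theorem Rot.ne_top {k : Fin n} {t t' : LTree n} (h : Rot k t t') (hd : t.labels.Nodup) :
    t.top ≠ some k := by
  have hk : ∀ {t t' : LTree n}, Rot k t t' → k ∈ t.labels := by
    intro t t' h
    induction h <;> simp_all [labels]
  cases h with
  | left p A B C => simp_all [top, labels]
  | right p A B C => simp_all [top, labels]
  | inl p l l' r h =>
    have := hk h
    simp [labels] at hd
    simp only [top, ne_eq, Option.some.injEq]; rintro rfl; exact hd.1.1 this
  | inr p l l' r h =>
    have := hk h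
    simp [labels] at hd
    simp only [top, ne_eq, Option.some.injEq]; rintro rfl; exact hd.1.2 this

theorem Rot.mem {k : Fin n} {t t' : LTree n} (h : Rot k t t') : k ∈ t.labels := by
  induction h <;> simp_all [labels]

theorem exists_rot {k : Fin n} {t : LTree n} (h : k ∈ t.labels) (ht : t.top ≠ some k) :
    ∃ t', Rot k t t' := by
  induction t with
  | leaf => simp [labels] at h
  | node p l r hl hr =>
    simp only [labels, List.mem_cons, List.mem_append] at h
    simp only [top, ne_eq, Option.some.injEq] at ht
    rcases h with h | h | h
    · exact absurd h.symm ht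
    · by_cases hlt : l.top = some k
      · cases l with
        | leaf => simp [top] at hlt
        | node q A B =>
          simp only [top, Option.some.injEq] at hlt
          subst hlt
          exact ⟨_, Rot.left p A B r⟩
      · obtain ⟨l', h'⟩ := hl h hlt
        exact ⟨_, Rot.inl p l l' r h'⟩
    · by_cases hlt : r.top = some k
      · cases r with
        | leaf => simp [top] at hlt
        | node q A B =>
          simp only [top, Option.some.injEq] at hlt
          subst hlt
          exact ⟨_, Rot.right p l A B⟩
      · obtain ⟨l', h'⟩ := hr h hlt
        exact ⟨_, Rot.inr p l r l' h'⟩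

theorem top_ne {t : LTree n} {k : Fin n} (h : k ∉ t.labels) : t.top ≠ some k :=
  fun h' => h (top_mem h')

theorem top_disj {s t : LTree n} (h : ∀ i ∈ s.labels, i ∉ t.labels) :
    ∀ i, s.top = some i → t.top ≠ some i :=
  fun i hi => top_ne (h i (top_mem hi))

theorem Rot.mat_eq {k : Fin n} {t t' : LTree n} (h : Rot k t t') (hd : t.labels.Nodup) :
    mat t' = mutMat k (mat t) := by
  induction h with
  | left p A B C =>
    simp only [labels, List.cons_append, List.append_assoc, List.nodup_cons, List.mem_cons,
      List.mem_append, List.nodup_append', not_or, List.disjoint_append_right] at hd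
    obtain ⟨⟨h1, h2, h3, h4⟩, ⟨h5, h6, h7⟩, h8, ⟨h9, h10, h11⟩, h12, h13⟩ := hd
    have e : mat (node p (node k A B) C) =
        (tri (some p) (some k) C.top + tri (some k) A.top B.top) + (mat A + mat B + mat C) := by
      simp only [mat, top]; abel
    rw [e, mutMat_add, tri_left]
    · simp only [mat, top]; abel
    · simpa using h1
    · exact top_ne h5
    · exact top_ne h6
    · exact top_ne h7
    · intro i hi; cases hi; exact top_ne h2
    · intro i hi; cases hi; exact top_ne h3
    · intro i hi; cases hi; exact top_ne h4
    · exact top_disj fun i hi => h12 hi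
    · exact top_disj fun i hi => h13 hi
    · exact top_disj fun i hi => h11 hi
    · intro i j hij
      simp [mat_zero h5 hij, mat_zero h6 hij, mat_zero h7 hij]
  | right p A B C =>
    have hd' := (Rot.right (k := k) p A B C).perm.nodup_iff.2 hd
    simp only [labels, List.cons_append, List.append_assoc, List.nodup_cons, List.mem_cons,
      List.mem_append, List.nodup_append', not_or, List.disjoint_append_right] at hd'
    obtain ⟨⟨h1, h2, h3, h4⟩, ⟨h5, h6, h7⟩, h8, ⟨h9, h10, h11⟩, h12, h13⟩ := hd'
    have e : mat (node p A (node k B C)) =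
        (tri (some p) A.top (some k) + tri (some k) B.top C.top) + (mat A + mat B + mat C) := by
      simp only [mat, top]; abel
    rw [e, mutMat_add, tri_right]
    · simp only [mat, top]; abel
    · simpa using h1
    · exact top_ne h5
    · exact top_ne h6
    · exact top_ne h7
    · intro i hi; cases hi; exact top_ne h2
    · intro i hi; cases hi; exact top_ne h3
    · intro i hi; cases hi; exact top_ne h4
    · exact top_disj fun i hi => h12 hi
    · exact top_disj fun i hi => h13 hi
    · exact top_disj fun i hi => h11 hi
    · intro i j hij
      simp [mat_zero h5 hij, mat_zero h6 hij, mat_zero h7 hij]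
  | inl p l l' r h ih =>
    have hd0 := hd
    simp only [labels, List.nodup_cons, List.mem_append, List.nodup_append', not_or] at hd
    have hk := h.mem
    have hkr : k ∉ r.labels := fun h' => hd.2.2.2 hk h'
    have hpk : some p ≠ some k := by
      simp only [ne_eq, Option.some.injEq]; rintro rfl; exact hd.1.1 hk
    have e : mat (node p l r) = mat l + (tri (some p) l.top r.top + mat r) := by
      simp only [mat]; abel
    rw [e, mutMat_add, ← ih hd.2.1]
    · simp only [mat, h.top_eq]; abel
    · intro i j hij
      simp [mat_zero hkr hij, tri_zero hpk (h.ne_top hd.2.1) (top_ne hkr) hij]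
  | inr p l r r' h ih =>
    have hd0 := hd
    simp only [labels, List.nodup_cons, List.mem_append, List.nodup_append', not_or] at hd
    have hk := h.mem
    have hkl : k ∉ l.labels := fun h' => hd.2.2.2 h' hk
    have hpk : some p ≠ some k := by
      simp only [ne_eq, Option.some.injEq]; rintro rfl; exact hd.1.2 hk
    have e : mat (node p l r) = mat r + (tri (some p) l.top r.top + mat l) := by
      simp only [mat]; abel
    rw [e, mutMat_add, ← ih hd.2.2.1]
    · simp only [mat, h.top_eq]; abel
    · intro i j hij
      simp [mat_zero hkl hij, tri_zero hpk (top_ne hkl) (h.ne_top hd.2.2.1) hij]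

theorem Rot.bmat_eq {k : Fin n} {t t' : LTree n} (h : Rot k t t') (hd : t.labels.Nodup) :
    bmat t' = mutMat k (bmat t) := by
  unfold bmat
  rw [mutMat_double k _ (h.ne_top hd), h.top_eq, h.mat_eq hd]

theorem root_bmat_eq (k : Fin n) (l r : LTree n) (hd : (node k l r).labels.Nodup) :
    bmat (node k r l) = mutMat k (bmat (node k l r)) := by
  simp only [labels, List.nodup_cons, List.mem_append, List.nodup_append', not_or] at hd
  have := tri_root k l.top r.top (top_ne hd.1.1) (top_ne hd.1.2)
    (top_disj fun i hi => hd.2.2.2 hi) (mat l + mat r) (by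
      intro i j hij
      simp [mat_zero hd.1.1 hij, mat_zero hd.1.2 hij])
  have e : mat (node k r l) = tri (some k) r.top l.top + (mat l + mat r) := by
    simp only [mat]; abel
  unfold bmat
  rw [e]
  exact this.symm

/-- A full labelled tree: each label appears exactly once. -/
def Full (t : LTree n) : Prop := t.labels.Nodup ∧ t.labels.length = n

theorem Full.mem {t : LTree n} (h : Full t) (k : Fin n) : k ∈ t.labels := by
  have : t.labels.toFinset = Finset.univ := by
    apply Finset.eq_univ_of_card
    rw [List.toFinset_card_of_nodup h.1, h.2, Fintype.card_fin]
  rw [← List.mem_toFinset, this]; exact Finset.mem_univ _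

theorem Full.size {t : LTree n} (h : Full t) : t.size = n + 1 := by
  rw [size_eq, h.2]

theorem Full.perm {t t' : LTree n} (h : Full t) (hp : t'.labels.Perm t.labels) : Full t' :=
  ⟨hp.nodup_iff.2 h.1, hp.length_eq.trans h.2⟩

theorem perm_root (k : Fin n) (l r : LTree n) :
    (node k r l).labels.Perm (node k l r).labels := by
  simp only [labels]
  exact List.perm_append_comm.cons _

theorem exists_mut {t : LTree n} (h : Full t) (k : Fin n) :
    ∃ t', Full t' ∧ bmat t' = mutMat k (bmat t) := by
  by_cases ht : t.top = some k
  · cases t with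
    | leaf => simp [top] at ht
    | node p l r =>
      simp only [top, Option.some.injEq] at ht
      subst ht
      exact ⟨_, h.perm (perm_root _ _ _), root_bmat_eq _ _ _ h.1⟩
  · obtain ⟨t', h'⟩ := exists_rot (h.mem k) ht
    exact ⟨t', h.perm h'.perm, h'.bmat_eq h.1⟩

end LTree

namespace LTree
variable {n : ℕ}

theorem sign_max (a b : ℤ) : 2 * (a.sign * max (a * b) 0) = a * |b| + |a| * b := by
  rcases lt_trichotomy a 0 with ha | ha | ha
  · rw [Int.sign_eq_neg_one_of_neg ha, abs_of_neg ha]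
    rcases le_total b 0 with hb | hb
    · rw [abs_of_nonpos hb, max_eq_left (by nlinarith)]; ring
    · rw [abs_of_nonneg hb, max_eq_right (by nlinarith)]; ring
  · subst ha; simp
  · rw [Int.sign_eq_one_of_pos ha, abs_of_pos ha]
    rcases le_total b 0 with hb | hb
    · rw [abs_of_nonpos hb, max_eq_right (by nlinarith)]; ring
    · rw [abs_of_nonneg hb, max_eq_left (by nlinarith)]; ring

theorem skew_mut (d : Fin n → ℤ) (hd : ∀ i, 0 < d i) (B : Matrix (Fin n) (Fin n) ℤ)
    (h : ∀ i j, d i * B i j = -(d j * B j i)) (k : Fin n) :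
    ∀ i j, d i * mutMat k B i j = -(d j * mutMat k B j i) := by
  intro i j
  have habs : ∀ i j, d i * |B i j| = d j * |B j i| := by
    intro i j
    have := congrArg abs (h i j)
    rwa [abs_neg, abs_mul, abs_mul, abs_of_pos (hd i), abs_of_pos (hd j)] at this
  unfold mutMat
  by_cases hk : i = k ∨ j = k
  · have hk' : j = k ∨ i = k := hk.symm
    simp only [hk, hk', if_true]; linarith [h i j]
  · have hk' : ¬(j = k ∨ i = k) := fun h => hk h.symm
    simp only [hk, hk', if_false]
    have h1 := sign_max (B i k) (B k j)
    have h2 := sign_max (B j k) (B k i)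
    have h3 := h i k
    have h4 := h j k
    have h5 := habs i k
    have h6 := habs j k
    have h7 := h i j
    have e1 : d i * (2 * ((B i k).sign * max (B i k * B k j) 0))
      = -(d k * B k i) * |B k j| + (d k * |B k i|) * B k j := by
      rw [h1, ← h5, ← h3]; ring
    have e2 : d j * (2 * ((B j k).sign * max (B j k * B k i) 0))
      = -(d k * B k j) * |B k i| + (d k * |B k j|) * B k i := by
      rw [h2, ← h6, ← h4]; ring
    linarith

/-- caterpillar -/
def cat (S : Matrix (Fin n) (Fin n) ℤ) (e : ℕ → Fin n) : ℕ → LTree n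
  | 0 => leaf
  | m + 1 => if 0 < S (e m) (e (m - 1)) then node (e m) (cat S e m) leaf
      else node (e m) leaf (cat S e m)

theorem cat_top (S : Matrix (Fin n) (Fin n) ℤ) (e : ℕ → Fin n) (m : ℕ) :
    (cat S e (m + 1)).top = some (e m) := by
  simp only [cat]; split_ifs <;> rfl

theorem cat_labels (S : Matrix (Fin n) (Fin n) ℤ) (e : ℕ → Fin n) (m : ℕ) :
    (cat S e m).labels = ((List.range m).map e).reverse := by
  induction m with
  | zero => simp [cat, labels]
  | succ m ih =>
    rw [List.range_succ, List.map_append, List.reverse_append]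
    simp only [cat]
    split_ifs <;> simp [labels, ih]

theorem cat_full (S : Matrix (Fin n) (Fin n) ℤ) (e : ℕ → Fin n)
    (he : ∀ i j, i < n → j < n → e i = e j → i = j) : Full (cat S e n) := by
  refine ⟨?_, by simp [cat_labels]⟩
  rw [cat_labels, List.nodup_reverse]
  refine List.Nodup.map_on ?_ List.nodup_range
  intro x hx y hy h
  simp only [List.mem_range] at hx hy
  exact he x y hx hy h

theorem cat_mat (S : Matrix (Fin n) (Fin n) ℤ) (e : ℕ → Fin n)
    (he : ∀ i j, i < n → j < n → e i = e j → i = j)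
    (hs : ∀ i j, (S i j).sign = -(S j i).sign)
    (hne : ∀ i, i + 1 < n → S (e (i + 1)) (e i) ≠ 0)
    (m : ℕ) (hm : m ≤ n) : ∀ i j, i < n → j < n → i < m → j < m →
    mat (cat S e m) (e i) (e j) = if i + 1 = j ∨ j + 1 = i then (S (e i) (e j)).sign else 0 := by
  induction m with
  | zero => intro i j _ _ h; omega
  | succ m ih =>
    intro i j hi hj hi' hj'
    have hind : ∀ a b, a < n → b < n → ind (some (e a)) (e b) = if a = b then 1 else 0 := by
      intro a b ha hb
      unfold ind
      by_cases hab : a = b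
      · simp [hab]
      · have : e a ≠ e b := fun h => hab (he a b ha hb h)
        simp [hab, this]
    have hout : ∀ i j, i < n → j < n → (i = m ∨ j = m) → mat (cat S e m) (e i) (e j) = 0 := by
      intro i j hi hj hij
      apply mat_zero (k := e m)
      · rw [cat_labels]
        simp only [List.mem_reverse, List.mem_map, List.mem_range, not_exists, not_and]
        intro x hx h
        have := he x m (by omega) (by omega) h
        omega
      · rcases hij with rfl | rfl <;> simp
    have hn0 : ∀ i : Fin n, ind none i = 0 := by intro i; simp [ind]
    have hmat : mat (cat S e (m + 1)) (e i) (e j) =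
        (if 0 < S (e m) (e (m - 1)) then 1 else -1) * ar (some (e m)) (cat S e m).top (e i) (e j)
          + mat (cat S e m) (e i) (e j) := by
      simp only [cat]
      split_ifs
      · simp [mat, top, tri, ar, hn0]
      · simp [mat, top, tri, ar, hn0]; ring
    rw [hmat]
    cases m with
    | zero =>
      have : i = 0 := by omega
      have : j = 0 := by omega
      subst i j
      simp [cat, top, ar, hn0, mat]
    | succ m =>
      rw [cat_top]
      unfold ar
      rw [hind _ _ (by omega) hi, hind _ _ (by omega) hj, hind _ _ (by omega) hi,
        hind _ _ (by omega) hj]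
      have h0 := hne m (by omega)
      have hs0 := hs (e (m + 1)) (e m)
      simp only [Nat.add_sub_cancel]
      by_cases h1 : i = m + 1
      · rw [hout i j hi hj (Or.inl h1)]
        by_cases h2 : j = m
        · subst h1 h2
          rcases lt_or_gt_of_ne h0 with h | h
          · have : ¬ (0 < S (e (j + 1)) (e j)) := by omega
            simp [this, Int.sign_eq_neg_one_of_neg h]
          · simp [h, Int.sign_eq_one_of_pos h]
        · have a1 : ¬ (m = j) := fun h => h2 h.symm
          have a2 : ¬ (m = i) := by omega
          have a3 : ¬ (i + 1 = j ∨ j + 1 = i) := by omega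
          simp [a1, a2, a3]
      · by_cases h2 : j = m + 1
        · rw [hout i j hi hj (Or.inr h2)]
          by_cases h3 : i = m
          · subst h3 h2
            rcases lt_or_gt_of_ne h0 with h | h
            · have h' : ¬ (0 < S (e (i + 1)) (e i)) := by omega
              rw [Int.sign_eq_neg_one_of_neg h] at hs0
              simp [h']; omega
            · rw [Int.sign_eq_one_of_pos h] at hs0
              simp [h]; omega
          · have a1 : ¬ (m = i) := fun h => h3 h.symm
            have a2 : ¬ (m + 1 = i) := by omega
            have a3 : ¬ (i + 1 = j ∨ j + 1 = i) := by omega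
            simp [a1, a2, a3]
        · have a1 : ¬ (m + 1 = i) := fun h => h1 h.symm
          have a2 : ¬ (m + 1 = j) := fun h => h2 h.symm
          rw [ih (by omega) i j hi hj (by omega) (by omega)]
          simp [a1, a2]

theorem exists_cat (hn : 2 ≤ n) (S : Matrix (Fin n) (Fin n) ℤ) (d : Fin n → ℤ) (hd : ∀ i, 0 < d i)
    (hS : ∀ i j, d i * S i j = -(d j * S j i)) (σ : Equiv.Perm (Fin n))
    (hσ : ∀ i j, cartanCounterpart S (σ i) (σ j) = cartanC n i j) :
    ∃ t, Full t ∧ bmat t = S := by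
  let e : ℕ → Fin n := fun i => σ ⟨i % n, Nat.mod_lt _ (by omega)⟩
  have he1 : ∀ i (hi : i < n), e i = σ ⟨i, hi⟩ := by
    intro i hi; simp only [e]; congr; exact Nat.mod_eq_of_lt hi
  have he : ∀ i j, i < n → j < n → e i = e j → i = j := by
    intro i j hi hj h
    rw [he1 i hi, he1 j hj] at h
    simpa using σ.injective h
  have hs : ∀ i j, (S i j).sign = -(S j i).sign := by
    intro i j
    have := congrArg Int.sign (hS i j)
    rwa [Int.sign_neg, Int.sign_mul, Int.sign_mul, Int.sign_eq_one_of_pos (hd i),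
      Int.sign_eq_one_of_pos (hd j), one_mul, one_mul] at this
  have habs : ∀ i j, i < n → j < n → i ≠ j → |S (e i) (e j)| =
      if i + 2 = n ∧ j + 1 = n then 2 else if i + 1 = j ∨ j + 1 = i then 1 else 0 := by
    intro i j hi hj hij
    have h := hσ ⟨i, hi⟩ ⟨j, hj⟩
    rw [he1 i hi, he1 j hj]
    unfold cartanCounterpart cartanC at h
    have h1 : ¬ (σ ⟨i, hi⟩ = σ ⟨j, hj⟩) := fun h => hij (by simpa using σ.injective h)
    have h2 : ¬ ((⟨i, hi⟩ : Fin n) = ⟨j, hj⟩) := fun h => hij (by simpa using h)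
    rw [if_neg h1, if_neg h2] at h
    simp only at h
    split_ifs at h ⊢ <;> omega
  have hdiag : ∀ i, S i i = 0 := by
    intro i
    have h1 := hS i i
    have h2 := hd i
    have : d i * S i i = 0 := by omega
    rcases mul_eq_zero.1 this with h | h
    · omega
    · exact h
  have hne : ∀ i, i + 1 < n → S (e (i + 1)) (e i) ≠ 0 := by
    intro i hi h
    have := habs (i + 1) i hi (by omega) (by omega)
    rw [h] at this
    split_ifs at this <;> simp at this <;> omega
  refine ⟨cat S e n, cat_full S e he, ?_⟩
  obtain ⟨m, rfl⟩ : ∃ m, n = m + 1 := ⟨n - 1, by omega⟩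
  have hsurj : ∀ a : Fin (m + 1), ∃ i, i < m + 1 ∧ e i = a := by
    intro a
    refine ⟨σ.symm a, (σ.symm a).2, ?_⟩
    rw [he1 _ (σ.symm a).2]; simp
  ext a b
  obtain ⟨i, hi, rfl⟩ := hsurj a
  obtain ⟨j, hj, rfl⟩ := hsurj b
  unfold bmat
  rw [cat_mat S e he hs hne (m + 1) le_rfl i j hi hj hi hj, cat_top]
  have hem : (some (e m) = some (e j)) ↔ m = j := by
    rw [Option.some.injEq]
    exact ⟨he m j (by omega) hj, fun h => congrArg e h⟩
  simp only [hem]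
  by_cases hij : i = j
  · subst hij; simp [hdiag]
  have h1 := habs i j hi hj hij
  conv_rhs => rw [← Int.sign_mul_abs (S (e i) (e j)), h1]
  by_cases h2 : i + 1 = j ∨ j + 1 = i
  · simp only [h2, if_true]
    congr 1
    split_ifs <;> first | rfl | omega
  · have : ¬ (i + 2 = m + 1 ∧ j + 1 = m + 1) := by omega
    rw [if_neg h2, if_neg h2, if_neg this]; simp

theorem exists_init (hn : 2 ≤ n) (B : Matrix (Fin n) (Fin n) ℤ) (hB : SkewSymmetrizable B)
    (htype : PatternOfType (cartanC n) B) : ∃ t, Full t ∧ bmat t = B := by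
  obtain ⟨d, hd, hB⟩ := hB
  have hB' : ∀ i j, d i * B i j = -(d j * B j i) := by
    intro i j
    have := congrFun (congrFun hB j) i
    simpa [Matrix.diagonal_mul] using this
  obtain ⟨s, hs, σ, hσ⟩ := htype
  have hskew : ∀ i j, d i * s.1 i j = -(d j * s.1 j i) := by
    unfold IsSeed at hs
    clear hσ
    induction hs with
    | refl => exact hB'
    | tail _ h ih =>
      obtain ⟨k, rfl⟩ := h
      exact skew_mut d hd _ ih k
  have hex : ∃ t, Full t ∧ bmat t = s.1 := exists_cat hn s.1 d hd hskew σ hσ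
  clear hσ hskew
  unfold IsSeed at hs
  induction hs with
  | refl => exact hex
  | tail _ h ih =>
    obtain ⟨k, rfl⟩ := h
    obtain ⟨t, ht, h⟩ := hex
    obtain ⟨t', ht', h'⟩ := exists_mut ht k
    refine ih ⟨t', ht', ?_⟩
    rw [h', h]
    simp only [mutSeed, mutMat_mutMat]

end LTree

namespace LTree
variable {n : ℕ}

/-- evaluation point -/
def opt (i : Fin n) : Fin n → ℚ := fun j => if j = i then 0 else 1

/-- embedding of polynomials -/
abbrev emb (n : ℕ) (P : MvPolynomial (Fin n) ℚ) : CAField n :=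
  algebraMap (MvPolynomial (Fin n) ℚ) (CAField n) P

/-- `x` has order `e` along `u_i = 0`, with positive leading part. -/
def Ord (i : Fin n) (x : CAField n) (e : ℤ) : Prop :=
  ∃ P Q : MvPolynomial (Fin n) ℚ, 0 < eval (opt i) P ∧ 0 < eval (opt i) Q ∧
    x * emb n Q = uVar n i ^ e * emb n P

theorem emb_inj : Function.Injective (emb n) :=
  IsFractionRing.injective (MvPolynomial (Fin n) ℚ) (CAField n)

theorem emb_ne {P : MvPolynomial (Fin n) ℚ} (h : P ≠ 0) : emb n P ≠ 0 := by
  intro h'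
  apply h
  apply emb_inj
  rw [h']; simp [emb]

theorem ne_of_eval {i : Fin n} {P : MvPolynomial (Fin n) ℚ} (h : 0 < eval (opt i) P) : P ≠ 0 := by
  rintro rfl; simp at h

theorem u_ne (i : Fin n) : uVar n i ≠ 0 := emb_ne (X_ne_zero i)

theorem Ord.ne {i : Fin n} {x : CAField n} {e : ℤ} (h : Ord i x e) : x ≠ 0 := by
  obtain ⟨P, Q, hP, hQ, h⟩ := h
  rintro rfl
  rw [zero_mul] at h
  exact mul_ne_zero (zpow_ne_zero _ (u_ne i)) (emb_ne (ne_of_eval hP)) h.symm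

theorem Ord.one (i : Fin n) : Ord i 1 0 := ⟨1, 1, by simp, by simp, by simp⟩

theorem Ord.u (i j : Fin n) : Ord i (uVar n j) (if i = j then 1 else 0) := by
  by_cases h : i = j
  · subst h
    exact ⟨1, 1, by simp, by simp, by simp⟩
  · refine ⟨X j, 1, ?_, by simp, by simp [h, uVar]⟩
    have : ¬ j = i := fun h' => h h'.symm
    simp [opt, this]

theorem Ord.mul {i : Fin n} {x y : CAField n} {e f : ℤ} (hx : Ord i x e) (hy : Ord i y f) :
    Ord i (x * y) (e + f) := by
  obtain ⟨P, Q, hP, hQ, h⟩ := hx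
  obtain ⟨P', Q', hP', hQ', h'⟩ := hy
  refine ⟨P * P', Q * Q', by simp; positivity, by simp; positivity, ?_⟩
  rw [zpow_add₀ (u_ne i)]
  simp only [emb, map_mul] at *
  linear_combination (y * (algebraMap _ (CAField n)) Q') * h + (uVar n i ^ e * (algebraMap _ (CAField n)) P) * h'

theorem Ord.div {i : Fin n} {x y : CAField n} {e f : ℤ} (hx : Ord i x e) (hy : Ord i y f) :
    Ord i (x / y) (e - f) := by
  have hy0 := hy.ne
  obtain ⟨P, Q, hP, hQ, h⟩ := hx
  obtain ⟨P', Q', hP', hQ', h'⟩ := hy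
  refine ⟨P * Q', Q * P', by simp; positivity, by simp; positivity, ?_⟩
  rw [zpow_sub₀ (u_ne i)]
  have h2 : uVar n i ^ f ≠ 0 := zpow_ne_zero _ (u_ne i)
  simp only [emb, map_mul] at *
  field_simp
  linear_combination (uVar n i ^ f * (algebraMap _ (CAField n)) P') * h - (uVar n i ^ e * (algebraMap _ (CAField n)) P) * h'

theorem Ord.add_le {i : Fin n} {x y : CAField n} {e f : ℤ} (hx : Ord i x e) (hy : Ord i y f)
    (hef : e ≤ f) : Ord i (x + y) e := by
  obtain ⟨P, Q, hP, hQ, h⟩ := hx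
  obtain ⟨P', Q', hP', hQ', h'⟩ := hy
  obtain ⟨m, rfl⟩ : ∃ m : ℕ, f = e + m := ⟨(f - e).toNat, by omega⟩
  refine ⟨P * Q' + X i ^ m * P' * Q, Q * Q', ?_, by simp; positivity, ?_⟩
  · have : 0 ≤ opt i i := by simp [opt]
    simp; positivity
  · rw [zpow_add₀ (u_ne i), zpow_natCast] at h'
    simp only [emb, map_mul, map_add, map_pow] at *
    have hu : (algebraMap (MvPolynomial (Fin n) ℚ) (CAField n)) (X i) = uVar n i := rfl
    rw [hu]
    linear_combination (algebraMap _ (CAField n) Q') * h + (algebraMap _ (CAField n) Q) * h'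

theorem Ord.add {i : Fin n} {x y : CAField n} {e f : ℤ} (hx : Ord i x e) (hy : Ord i y f) :
    Ord i (x + y) (min e f) := by
  rcases le_total e f with h | h
  · rw [min_eq_left h]; exact hx.add_le hy h
  · rw [min_eq_right h, add_comm]; exact hy.add_le hx h

theorem not_dvd_of_eval {i : Fin n} {P : MvPolynomial (Fin n) ℚ} (h : 0 < eval (opt i) P) :
    ¬ X i ∣ P := by
  rintro ⟨R, rfl⟩
  simp [opt] at h

theorem not_dvd_map {i : Fin n} {f : MvPolynomial (Fin n) ℤ} (h : ¬ X i ∣ f) :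
    ¬ X i ∣ MvPolynomial.map (Int.castRingHom ℚ) f := by
  intro h'
  apply h
  rw [X_dvd_iff_modMonomial_eq_zero] at *
  ext m
  have h2 := congrArg (coeff m) h'
  by_cases hm : Finsupp.single i 1 ≤ m
  · rw [coeff_modMonomial_of_le _ hm]; simp
  · rw [coeff_modMonomial_of_not_le _ hm] at h2 ⊢
    rw [coeff_map] at h2
    simpa using h2

theorem X_not_dvd_prod {i : Fin n} (e : Fin n → ℕ) :
    ¬ (X i : MvPolynomial (Fin n) ℚ) ∣ ∏ j ∈ Finset.univ.erase i, X j ^ e j := by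
  apply not_dvd_of_eval
  rw [map_prod]
  apply Finset.prod_pos
  intro j hj
  have : j ≠ i := (Finset.mem_erase.1 hj).1
  simp [opt, this]

theorem den_unique {i : Fin n} {y : CAField n} {d : Fin n → ℤ} {e : ℤ}
    (hd : IsDenomVec (uVar n) y d) (h : Ord i y e) : e = - d i := by
  obtain ⟨f, hf, hy⟩ := hd
  obtain ⟨P, Q, hP, hQ, h⟩ := h
  have hf1 := not_dvd_map (hf i)
  set g := MvPolynomial.map (Int.castRingHom ℚ) f with hg
  have hfg : aeval (uVar n) f = emb n g := by
    have h1 : (aeval (uVar n) : MvPolynomial (Fin n) ℤ →ₐ[ℤ] CAField n).toRingHom =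
      (algebraMap (MvPolynomial (Fin n) ℚ) (CAField n)).comp (MvPolynomial.map (Int.castRingHom ℚ)) := by
      apply MvPolynomial.ringHom_ext
      · intro r; simp
      · intro j; simp [uVar]
    exact congrArg (fun φ => φ f) h1
  -- positive and negative parts
  have hprime : Prime (X i : MvPolynomial (Fin n) ℚ) := X_prime
  have hsplit : ∏ j, uVar n j ^ d j = uVar n i ^ d i * ((emb n (∏ j ∈ Finset.univ.erase i, X j ^ (d j).toNat)) /
      emb n (∏ j ∈ Finset.univ.erase i, X j ^ (-d j).toNat)) := by
    rw [← Finset.mul_prod_erase Finset.univ _ (Finset.mem_univ i)]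
    congr 1
    simp only [emb, map_prod, map_pow]
    rw [← Finset.prod_div_distrib]
    apply Finset.prod_congr rfl
    intro j _
    have hu : (algebraMap (MvPolynomial (Fin n) ℚ) (CAField n)) (X j) = uVar n j := rfl
    rw [hu, ← zpow_natCast, ← zpow_natCast, ← zpow_sub₀ (u_ne j)]
    congr 1; omega
  set R := ∏ j ∈ Finset.univ.erase i, (X j : MvPolynomial (Fin n) ℚ) ^ (d j).toNat with hR
  set S := ∏ j ∈ Finset.univ.erase i, (X j : MvPolynomial (Fin n) ℚ) ^ (-d j).toNat with hS
  have hR1 : ¬ X i ∣ R := X_not_dvd_prod _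
  have hS1 : ¬ X i ∣ S := X_not_dvd_prod _
  have hR0 : emb n R ≠ 0 := emb_ne (by rintro h; rw [h] at hR1; exact hR1 (dvd_zero _))
  have hS0 : emb n S ≠ 0 := emb_ne (by rintro h; rw [h] at hS1; exact hS1 (dvd_zero _))
  have hu := u_ne i
  have hud : uVar n i ^ d i ≠ 0 := zpow_ne_zero _ hu
  have key : emb n (g * S * Q) = uVar n i ^ (e + d i) * emb n (P * R) := by
    rw [hy, hfg, hsplit] at h
    rw [zpow_add₀ hu]
    simp only [emb, map_mul] at *
    field_simp at h
    linear_combination h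
  have hgSQ : ¬ X i ∣ g * S * Q :=
    hprime.not_dvd_mul (hprime.not_dvd_mul hf1 hS1) (not_dvd_of_eval hQ)
  have hPR : ¬ X i ∣ P * R := hprime.not_dvd_mul (not_dvd_of_eval hP) hR1
  rcases lt_trichotomy (e + d i) 0 with h0 | h0 | h0
  · exfalso
    obtain ⟨m, hm⟩ : ∃ m : ℕ, -(e + d i) = m + 1 := ⟨(-(e + d i) - 1).toNat, by omega⟩
    have k2 : X i ^ (m + 1) * (g * S * Q) = P * R := by
      apply emb_inj
      have hmul : ∀ a b, emb n (a * b) = emb n a * emb n b := fun a b => map_mul _ a b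
      rw [hmul, key, ← mul_assoc]
      have : emb n (X i ^ (m + 1)) = uVar n i ^ (-(e + d i)) := by
        have h9 : emb n (X i ^ (m + 1)) = uVar n i ^ (m + 1) := map_pow _ _ _
        rw [h9, hm, ← zpow_natCast]; push_cast; rfl
      rw [this, ← zpow_add₀ hu]; simp
    exact hPR (k2 ▸ Dvd.dvd.mul_right (dvd_pow_self _ (by omega)) _)
  · omega
  · exfalso
    obtain ⟨m, hm⟩ : ∃ m : ℕ, (e + d i) = m + 1 := ⟨((e + d i) - 1).toNat, by omega⟩
    have k2 : (g * S * Q) = X i ^ (m + 1) * (P * R) := by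
      apply emb_inj
      have hmul : ∀ a b, emb n (a * b) = emb n a * emb n b := fun a b => map_mul _ a b
      rw [hmul _ (P * R), key]
      have : emb n (X i ^ (m + 1)) = uVar n i ^ (e + d i) := by
        have h9 : emb n (X i ^ (m + 1)) = uVar n i ^ (m + 1) := map_pow _ _ _
        rw [h9, hm, ← zpow_natCast]; push_cast; rfl
      rw [this]
    exact hgSQ (k2 ▸ Dvd.dvd.mul_right (dvd_pow_self _ (by omega)) _)

end LTree

namespace LTree
variable {n : ℕ}

theorem top_node (k : Fin n) (l r : LTree n) : (node k l r).top = some k := rfl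

/-- All nodes, with the intervals they span, satisfy `Φ`. -/
def Fits (Φ : Fin n → ℤ → ℤ → Prop) : ℤ → LTree n → Prop
  | _, leaf => True
  | a, node k l r => Φ k a (a + (l.size + r.size)) ∧ Fits Φ a l ∧ Fits Φ (a + l.size) r

theorem Fits.imp {Φ Ψ : Fin n → ℤ → ℤ → Prop} {t : LTree n} : ∀ {a : ℤ}, Fits Φ a t →
    (∀ k p q, k ∈ t.labels → a ≤ p → p < q → q ≤ a + t.size → Φ k p q → Ψ k p q) → Fits Ψ a t := by
  induction t with
  | leaf => intro a _ _; trivial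
  | node k l r hl hr =>
    intro a h himp
    have h1 := size_pos l
    have h2 := size_pos r
    refine ⟨himp _ _ _ (by simp [labels]) le_rfl (by omega) (by simp [size]) h.1, hl h.2.1 ?_,
      hr h.2.2 ?_⟩
    · intro j p q hj ha hpq hq
      exact himp j p q (by simp [labels, hj]) ha hpq (by simp only [size]; omega)
    · intro j p q hj ha hpq hq
      exact himp j p q (by simp [labels, hj]) (by omega) hpq (by simp only [size]; omega)

theorem Fits.get {Φ : Fin n → ℤ → ℤ → Prop} {t : LTree n} {k : Fin n} : ∀ {a : ℤ}, Fits Φ a t →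
    k ∈ t.labels → ∃ p q, a ≤ p ∧ p + 2 ≤ q ∧ q ≤ a + t.size ∧ Φ k p q := by
  induction t with
  | leaf => intro a _ h; simp [labels] at h
  | node j l r hl hr =>
    intro a h hk
    have h1 := size_pos l
    have h2 := size_pos r
    simp only [labels, List.mem_cons, List.mem_append] at hk
    rcases hk with rfl | hk | hk
    · exact ⟨_, _, le_rfl, by omega, by simp [size], h.1⟩
    · obtain ⟨p, q, h3, h4, h5, h6⟩ := hl h.2.1 hk
      exact ⟨p, q, h3, h4, by simp only [size]; omega, h6⟩
    · obtain ⟨p, q, h3, h4, h5, h6⟩ := hr h.2.2 hk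
      exact ⟨p, q, by omega, h4, by simp only [size]; omega, h6⟩

theorem Fits.shift {Φ Ψ : Fin n → ℤ → ℤ → Prop} {t : LTree n} (b : ℤ) : ∀ {a : ℤ}, Fits Φ a t →
    (∀ k p q, Φ k p q → Ψ k (p + b) (q + b)) → Fits Ψ (a + b) t := by
  induction t with
  | leaf => intro a _ _; trivial
  | node k l r hl hr =>
    intro a h himp
    refine ⟨?_, hl h.2.1 himp, ?_⟩
    · have := himp _ _ _ h.1
      convert this using 1; ring
    · have := hr h.2.2 himp
      convert this using 1; ring

/-- The interface: lambda lengths and their crossing numbers. -/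
structure Model (n : ℕ) (lam : ℤ → ℤ → CAField n) (c : Fin n → ℤ → ℤ → ℤ) : Prop where
  lam_per : ∀ p q : ℤ, lam (p + ((n : ℤ) + 1)) (q + ((n : ℤ) + 1)) = lam p q
  c_per : ∀ (i : Fin n) (p q : ℤ), c i (p + ((n : ℤ) + 1)) (q + ((n : ℤ) + 1)) = c i p q
  lam_unit : ∀ p : ℤ, lam p (p + 1) = 1
  c_unit : ∀ (i : Fin n) (p : ℤ), c i p (p + 1) = 0
  lam_ptol : ∀ a b d e : ℤ, lam a d * lam b e = lam a b * lam d e + lam b d * lam a e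
  c_ptol : ∀ (i : Fin n) (a b d e : ℤ), a < b → b < d → d < e → e ≤ a + ((n : ℤ) + 1) →
    c i a d + c i b e = max (c i a b + c i d e) (c i b d + c i a e)
  lam_diam : ∀ a m : ℤ, lam a (a + ((n : ℤ) + 1)) * lam m (m + ((n : ℤ) + 1))
    = lam a m ^ 2 + lam m (a + ((n : ℤ) + 1)) ^ 2
  c_diam : ∀ (i : Fin n) (a m : ℤ), c i a (a + ((n : ℤ) + 1)) + c i m (m + ((n : ℤ) + 1))
    = max (2 * c i a m) (2 * c i m (a + ((n : ℤ) + 1)))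

/-- Value of an edge. -/
def xo (x : Fin n → CAField n) : Option (Fin n) → CAField n
  | none => 1
  | some k => x k

/-- An edge value is the lambda length of the arc. -/
def EdgeOk (lam : ℤ → ℤ → CAField n) (c : Fin n → ℤ → ℤ → ℤ) (y : CAField n) (p q : ℤ) : Prop :=
  y = lam p q ∧ ∀ i, Ord i y (-(c i p q))

/-- node predicate -/
def NodeOk (lam : ℤ → ℤ → CAField n) (c : Fin n → ℤ → ℤ → ℤ) (x : Fin n → CAField n)
    (k : Fin n) (p q : ℤ) : Prop := EdgeOk lam c (x k) p q

variable {lam : ℤ → ℤ → CAField n} {c : Fin n → ℤ → ℤ → ℤ}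

theorem Fits.edge (hM : Model n lam c) {x : Fin n → CAField n} {a : ℤ} {t : LTree n}
    (h : Fits (NodeOk lam c x) a t) : EdgeOk lam c (xo x t.top) a (a + t.size) := by
  cases t with
  | leaf =>
    refine ⟨by simp [xo, top, size, hM.lam_unit], fun i => ?_⟩
    simp only [xo, top, size, hM.c_unit, neg_zero]
    exact Ord.one i
  | node k l r => exact h.1

theorem Fits.congr {x x' : Fin n → CAField n} {a : ℤ} {t : LTree n} {k : Fin n}
    (h : Fits (NodeOk lam c x) a t) (hx : ∀ j, j ≠ k → x' j = x j) (hk : k ∉ t.labels) :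
    Fits (NodeOk lam c x') a t := by
  refine h.imp ?_
  intro j p q hj _ _ _ h
  have : j ≠ k := by rintro rfl; exact hk hj
  unfold NodeOk at *
  rwa [hx j this]

/-- local data for a flip -/
theorem Rot.flip (hM : Model n lam c) {k : Fin n} {t t' : LTree n} (h : Rot k t t') :
    ∀ {a : ℤ}, t.labels.Nodup → ∀ {x : Fin n → CAField n}, Fits (NodeOk lam c x) a t →
    ∃ (p α β γ : Option (Fin n)) (i1 i2 i3 i4 : ℤ), i1 < i2 ∧ i2 < i3 ∧ i3 < i4 ∧ a ≤ i1 ∧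
      i4 ≤ a + t.size ∧
      EdgeOk lam c (xo x p) i1 i4 ∧ EdgeOk lam c (xo x α) i1 i2 ∧ EdgeOk lam c (xo x β) i2 i3 ∧
      EdgeOk lam c (xo x γ) i3 i4 ∧
      ((∀ i, p = some i → α ≠ some i) ∧ (∀ i, p = some i → β ≠ some i) ∧
       (∀ i, p = some i → γ ≠ some i) ∧ (∀ i, α = some i → β ≠ some i) ∧
       (∀ i, α = some i → γ ≠ some i) ∧ (∀ i, β = some i → γ ≠ some i)) ∧
      ((EdgeOk lam c (x k) i1 i3 ∧ (∀ i, mat t i k = ind p i + ind β i - ind α i - ind γ i) ∧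
        ∀ x', (∀ j, j ≠ k → x' j = x j) → EdgeOk lam c (x' k) i2 i4 → Fits (NodeOk lam c x') a t') ∨
       (EdgeOk lam c (x k) i2 i4 ∧ (∀ i, mat t i k = -(ind p i + ind β i - ind α i - ind γ i)) ∧
        ∀ x', (∀ j, j ≠ k → x' j = x j) → EdgeOk lam c (x' k) i1 i3 →
          Fits (NodeOk lam c x') a t')) := by
  induction h with
  | left p A B C =>
    intro a hd x hx
    simp only [labels, List.cons_append, List.append_assoc, List.nodup_cons, List.mem_cons,
      List.mem_append, List.nodup_append', not_or, List.disjoint_append_right] at hd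
    obtain ⟨⟨h1, h2, h3, h4⟩, ⟨h5, h6, h7⟩, h8, ⟨h9, h10, h11⟩, h12, h13⟩ := hd
    have s1 := size_pos A
    have s2 := size_pos B
    have s3 := size_pos C
    have hA := hx.2.1.2.1
    have hB := hx.2.1.2.2
    have hC := hx.2.2
    have eA := hA.edge hM
    have eB := hB.edge hM
    have eC := hC.edge hM
    simp only [size] at hC eC
    refine ⟨some p, A.top, B.top, C.top, a, a + A.size, a + (A.size + B.size),
      a + (A.size + B.size + C.size), by omega, by omega, by omega, le_rfl,
      by simp only [size]; omega, hx.1, eA, ?_, ?_, ⟨?_, ?_, ?_, ?_, ?_, ?_⟩, Or.inl ⟨hx.2.1.1, ?_, ?_⟩⟩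
    · convert eB using 1; ring
    · convert eC using 1; ring
    · intro i hi; cases hi; exact top_ne h2
    · intro i hi; cases hi; exact top_ne h3
    · intro i hi; cases hi; exact top_ne h4
    · exact top_disj fun i hi => h12 hi
    · exact top_disj fun i hi => h13 hi
    · exact top_disj fun i hi => h11 hi
    · intro i
      have hp : some p ≠ some k := by simpa using h1
      simp only [mat, top_node, Matrix.add_apply, mat_zero h5 (Or.inr rfl), mat_zero h6 (Or.inr rfl),
        mat_zero h7 (Or.inr rfl), tri, ar, ind_self, ind_ne hp, ind_ne (top_ne h5),
        ind_ne (top_ne h6), ind_ne (top_ne h7)]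
      ring
    · intro x' hx' hk
      refine ⟨?_, hA.congr hx' h5, ?_, ?_, ?_⟩
      · have := hx.1
        unfold NodeOk at *
        rw [hx' p h1]
        convert this using 1; simp only [size]; ring
      · unfold NodeOk
        convert hk using 1; ring
      · exact hB.congr hx' h6
      · have := hC.congr hx' h7
        convert this using 1; ring
  | right p A B C =>
    intro a hd x hx
    have hd' := (Rot.right (k := k) p A B C).perm.nodup_iff.2 hd
    simp only [labels, List.cons_append, List.append_assoc, List.nodup_cons, List.mem_cons,
      List.mem_append, List.nodup_append', not_or, List.disjoint_append_right] at hd'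
    obtain ⟨⟨h1, h2, h3, h4⟩, ⟨h5, h6, h7⟩, h8, ⟨h9, h10, h11⟩, h12, h13⟩ := hd'
    have s1 := size_pos A
    have s2 := size_pos B
    have s3 := size_pos C
    have hA := hx.2.1
    have hB := hx.2.2.2.1
    have hC := hx.2.2.2.2
    have eA := hA.edge hM
    have eB := hB.edge hM
    have eC := hC.edge hM
    have hp0 := hx.1
    simp only [size] at hp0
    refine ⟨some p, A.top, B.top, C.top, a, a + A.size, a + A.size + B.size,
      a + (A.size + (B.size + C.size)), by omega, by omega, by omega, le_rfl,
      by simp only [size]; omega, hp0, eA, eB, ?_, ⟨?_, ?_, ?_, ?_, ?_, ?_⟩, Or.inr ⟨?_, ?_, ?_⟩⟩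
    · convert eC using 1; ring
    · intro i hi; cases hi; exact top_ne h2
    · intro i hi; cases hi; exact top_ne h3
    · intro i hi; cases hi; exact top_ne h4
    · exact top_disj fun i hi => h12 hi
    · exact top_disj fun i hi => h13 hi
    · exact top_disj fun i hi => h11 hi
    · have := hx.2.2.1
      unfold NodeOk at this
      convert this using 1; ring
    · intro i
      have hp : some p ≠ some k := by simpa using h1
      simp only [mat, top_node, Matrix.add_apply, mat_zero h5 (Or.inr rfl), mat_zero h6 (Or.inr rfl),
        mat_zero h7 (Or.inr rfl), tri, ar, ind_self, ind_ne hp, ind_ne (top_ne h5),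
        ind_ne (top_ne h6), ind_ne (top_ne h7)]
      ring
    · intro x' hx' hk
      refine ⟨?_, ⟨?_, hA.congr hx' h5, hB.congr hx' h6⟩, ?_⟩
      · unfold NodeOk at *
        rw [hx' p h1]
        convert hp0 using 1; simp only [size]; ring
      · unfold NodeOk
        convert hk using 1; ring
      · have := hC.congr hx' h7
        convert this using 1; simp only [size]; ring
  | inl p l l' r h ih =>
    intro a hd x hx
    simp only [labels, List.nodup_cons, List.mem_append, List.nodup_append', not_or] at hd
    have hk := h.mem
    have hkr : k ∉ r.labels := fun h' => hd.2.2.2 hk h'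
    have hpk0 : p ≠ k := by rintro rfl; exact hd.1.1 hk
    have hpk : some p ≠ some k := by simpa using hpk0
    have s3 := size_pos r
    obtain ⟨p', α, β, γ, i1, i2, i3, i4, q1, q2, q3, q4, q5, q6, q7, q8, q9, q10, q11⟩ :=
      ih hd.2.1 hx.2.1
    have hcol : ∀ i, mat (node p l r) i k = mat l i k := by
      intro i
      simp [mat, mat_zero hkr (Or.inr rfl),
        tri_zero hpk (h.ne_top hd.2.1) (top_ne hkr) (Or.inr rfl)]
    have hfit : ∀ x', (∀ j, j ≠ k → x' j = x j) → Fits (NodeOk lam c x') a l' →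
        Fits (NodeOk lam c x') a (node p l' r) := by
      intro x' hx' hf
      refine ⟨?_, hf, ?_⟩
      · have := hx.1
        unfold NodeOk at *
        rw [hx' p hpk0, h.size_eq]; exact this
      · rw [h.size_eq]; exact hx.2.2.congr hx' hkr
    refine ⟨p', α, β, γ, i1, i2, i3, i4, q1, q2, q3, q4, by simp only [size]; omega, q6, q7, q8, q9,
      q10, ?_⟩
    rcases q11 with ⟨r1, r2, r3⟩ | ⟨r1, r2, r3⟩
    · exact Or.inl ⟨r1, fun i => (hcol i).trans (r2 i), fun x' hx' hk => hfit x' hx' (r3 x' hx' hk)⟩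
    · exact Or.inr ⟨r1, fun i => (hcol i).trans (r2 i), fun x' hx' hk => hfit x' hx' (r3 x' hx' hk)⟩
  | inr p l r r' h ih =>
    intro a hd x hx
    simp only [labels, List.nodup_cons, List.mem_append, List.nodup_append', not_or] at hd
    have hk := h.mem
    have hkl : k ∉ l.labels := fun h' => hd.2.2.2 h' hk
    have hpk0 : p ≠ k := by rintro rfl; exact hd.1.2 hk
    have hpk : some p ≠ some k := by simpa using hpk0
    have s3 := size_pos l
    obtain ⟨p', α, β, γ, i1, i2, i3, i4, q1, q2, q3, q4, q5, q6, q7, q8, q9, q10, q11⟩ :=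
      ih hd.2.2.1 hx.2.2
    have hcol : ∀ i, mat (node p l r) i k = mat r i k := by
      intro i
      simp [mat, mat_zero hkl (Or.inr rfl),
        tri_zero hpk (top_ne hkl) (h.ne_top hd.2.2.1) (Or.inr rfl)]
    have hfit : ∀ x', (∀ j, j ≠ k → x' j = x j) → Fits (NodeOk lam c x') (a + l.size) r' →
        Fits (NodeOk lam c x') a (node p l r') := by
      intro x' hx' hf
      refine ⟨?_, hx.2.1.congr hx' hkl, hf⟩
      have := hx.1
      unfold NodeOk at *
      rw [hx' p hpk0, h.size_eq]; exact this
    refine ⟨p', α, β, γ, i1, i2, i3, i4, q1, q2, q3, by omega, by simp only [size]; omega, q6, q7,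
      q8, q9, q10, ?_⟩
    rcases q11 with ⟨r1, r2, r3⟩ | ⟨r1, r2, r3⟩
    · exact Or.inl ⟨r1, fun i => (hcol i).trans (r2 i), fun x' hx' hk => hfit x' hx' (r3 x' hx' hk)⟩
    · exact Or.inr ⟨r1, fun i => (hcol i).trans (r2 i), fun x' hx' hk => hfit x' hx' (r3 x' hx' hk)⟩

theorem prod_ind (x : Fin n → CAField n) (p : Option (Fin n)) :
    ∏ i, x i ^ (ind p i).toNat = xo x p := by
  cases p with
  | none => simp [ind, xo]
  | some k =>
    simp only [xo]
    rw [Finset.prod_eq_single k]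
    · simp [ind]
    · intro b _ hb
      have : some k ≠ some b := by simpa using fun h => hb h.symm
      simp [ind_ne this]
    · simp

theorem prod_four (x : Fin n → CAField n) (p a b c : Option (Fin n))
    (h : (∀ i, p = some i → a ≠ some i) ∧ (∀ i, p = some i → b ≠ some i) ∧
       (∀ i, p = some i → c ≠ some i) ∧ (∀ i, a = some i → b ≠ some i) ∧
       (∀ i, a = some i → c ≠ some i) ∧ (∀ i, b = some i → c ≠ some i)) :
    ∏ i, x i ^ (ind p i + ind b i - ind a i - ind c i).toNat = xo x p * xo x b ∧
    ∏ i, x i ^ (-(ind p i + ind b i - ind a i - ind c i)).toNat = xo x a * xo x c := by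
  obtain ⟨h1, h2, h3, h4, h5, h6⟩ := h
  have key := ind_cases p a b c h1 h2 h3 h4 h5 h6
  rw [← prod_ind x p, ← prod_ind x a, ← prod_ind x b, ← prod_ind x c, ← Finset.prod_mul_distrib,
    ← Finset.prod_mul_distrib]
  constructor <;> refine Finset.prod_congr rfl fun i _ => ?_ <;>
  rcases key i with ⟨h1, h2, h3, h4⟩ | ⟨h1, h2, h3, h4⟩ | ⟨h1, h2, h3, h4⟩ | ⟨h1, h2, h3, h4⟩ |
    ⟨h1, h2, h3, h4⟩ <;> rw [h1, h2, h3, h4] <;> simp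

theorem prod_two (x : Fin n → CAField n) (a b : Option (Fin n))
    (hab : ∀ i, a = some i → b ≠ some i) :
    ∏ i, x i ^ ((ind b i - ind a i) * 2).toNat = xo x b ^ 2 ∧
    ∏ i, x i ^ (-((ind b i - ind a i) * 2)).toNat = xo x a ^ 2 := by
  have key : ∀ i : Fin n, (ind a i = 1 ∧ ind b i = 0) ∨ (ind a i = 0 ∧ ind b i = 1) ∨
      (ind a i = 0 ∧ ind b i = 0) := by
    intro i
    have := hab i
    unfold ind
    by_cases h2 : a = some i <;> by_cases h3 : b = some i <;> simp_all
  rw [← prod_ind x a, ← prod_ind x b, ← Finset.prod_pow, ← Finset.prod_pow]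
  constructor <;> refine Finset.prod_congr rfl fun i _ => ?_ <;>
  rcases key i with ⟨h1, h2⟩ | ⟨h1, h2⟩ | ⟨h1, h2⟩ <;> rw [h1, h2] <;> simp

/-- Good seeds. -/
def Good (lam : ℤ → ℤ → CAField n) (c : Fin n → ℤ → ℤ → ℤ)
    (s : Matrix (Fin n) (Fin n) ℤ × (Fin n → CAField n)) : Prop :=
  ∃ a t, Full t ∧ bmat t = s.1 ∧ Fits (NodeOk lam c s.2) a t

theorem edge_flip (hM : Model n lam c) {P A B C K : CAField n} {i1 i2 i3 i4 : ℤ}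
    (h12 : i1 < i2) (h23 : i2 < i3) (h34 : i3 < i4) (h41 : i4 ≤ i1 + (n + 1))
    (hP : EdgeOk lam c P i1 i4) (hA : EdgeOk lam c A i1 i2) (hB : EdgeOk lam c B i2 i3)
    (hC : EdgeOk lam c C i3 i4) :
    (EdgeOk lam c K i1 i3 → EdgeOk lam c ((P * B + A * C) / K) i2 i4) ∧
    (EdgeOk lam c K i2 i4 → EdgeOk lam c ((P * B + A * C) / K) i1 i3) := by
  have hl := hM.lam_ptol i1 i2 i3 i4
  have hc := fun i => hM.c_ptol i i1 i2 i3 i4 h12 h23 h34 h41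
  constructor
  · intro hK
    refine ⟨?_, fun i => ?_⟩
    · by_cases h0 : n = 0
      · subst h0
        have : i4 ≤ i1 + 1 := by simpa using h41
        omega
      have hK0 : K ≠ 0 := (hK.2 ⟨0, by omega⟩).ne
      rw [div_eq_iff hK0, hP.1, hA.1, hB.1, hC.1, hK.1]; linear_combination -hl
    · have := (((hP.2 i).mul (hB.2 i)).add ((hA.2 i).mul (hC.2 i))).div (hK.2 i)
      have e := hc i
      convert this using 1; omega
  · intro hK
    refine ⟨?_, fun i => ?_⟩
    · by_cases h0 : n = 0
      · subst h0
        have : i4 ≤ i1 + 1 := by simpa using h41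
        omega
      have hK0 : K ≠ 0 := (hK.2 ⟨0, by omega⟩).ne
      rw [div_eq_iff hK0, hP.1, hA.1, hB.1, hC.1, hK.1]; linear_combination -hl
    · have := (((hP.2 i).mul (hB.2 i)).add ((hA.2 i).mul (hC.2 i))).div (hK.2 i)
      have e := hc i
      convert this using 1; omega

theorem Good.mut (hM : Model n lam c) {s : Matrix (Fin n) (Fin n) ℤ × (Fin n → CAField n)}
    (h : Good lam c s) (k : Fin n) : Good lam c (mutSeed k s) := by
  obtain ⟨a, t, ht, hb, hf⟩ := h
  have hoff : ∀ j, j ≠ k → (mutSeed k s).2 j = s.2 j := by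
    intro j hj; simp [mutSeed, hj]
  have hon : (mutSeed k s).2 k = (∏ i, s.2 i ^ (bmat t i k).toNat +
      ∏ i, s.2 i ^ (-(bmat t i k)).toNat) / s.2 k := by
    simp [mutSeed, hb]
  by_cases htop : t.top = some k
  · cases t with
    | leaf => simp [top] at htop
    | node p l r =>
      simp only [top, Option.some.injEq] at htop
      subst htop
      have hsz := ht.size
      simp only [size] at hsz
      have hd := ht.1
      simp only [labels, List.nodup_cons, List.mem_append, List.nodup_append', not_or] at hd
      have hcol : ∀ i, bmat (node p l r) i p = (ind r.top i - ind l.top i) * 2 := by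
        intro i
        simp only [bmat, mat, top_node, Matrix.add_apply, mat_zero hd.1.1 (Or.inr rfl),
          mat_zero hd.1.2 (Or.inr rfl), tri, ar, ind_self, ind_ne (top_ne hd.1.1),
          ind_ne (top_ne hd.1.2), if_true]
        ring
      have hdis := top_disj (s := l) (t := r) fun i hi => hd.2.2.2 hi
      simp only [hcol] at hon
      rw [(prod_two s.2 _ _ hdis).1, (prod_two s.2 _ _ hdis).2] at hon
      have el := hf.2.1.edge hM
      have er := hf.2.2.edge hM
      have hp := hf.1
      unfold NodeOk at hp
      rw [hsz] at hp
      have hr2 : a + l.size + r.size = a + (n + 1) := by omega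
      rw [hr2] at er
      refine ⟨a + l.size, node p r l, ht.perm (perm_root _ _ _), ?_, ?_, ?_, ?_⟩
      · rw [root_bmat_eq _ _ _ ht.1, hb]; rfl
      · have hrl : r.size + l.size = n + 1 := by omega
        unfold NodeOk
        rw [hon, hrl]
        refine ⟨?_, fun i => ?_⟩
        · have hK0 : s.2 p ≠ 0 := (hp.2 p).ne
          rw [div_eq_iff hK0, el.1, er.1, hp.1]
          linear_combination -(hM.lam_diam a (a + l.size))
        · have e := hM.c_diam i a (a + l.size)
          rw [pow_two, pow_two]
          have := (((er.2 i).mul (er.2 i)).add ((el.2 i).mul (el.2 i))).div (hp.2 i)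
          convert this using 1; omega
      · exact hf.2.2.congr hoff hd.1.2
      · have := (hf.2.1.congr hoff hd.1.1).shift (Ψ := NodeOk lam c (mutSeed p s).2) (n + 1) (by
          intro k p q h
          unfold NodeOk EdgeOk at *
          simpa [hM.lam_per, hM.c_per] using h)
        convert this using 1
  · obtain ⟨t', h'⟩ := exists_rot (ht.mem k) htop
    have hcol : ∀ i, bmat t i k = mat t i k := by
      intro i; simp [bmat, htop]
    simp only [hcol] at hon
    obtain ⟨p, α, β, γ, i1, i2, i3, i4, q1, q2, q3, q4, q5, q6, q7, q8, q9, q10, q11⟩ :=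
      h'.flip hM ht.1 hf
    rw [ht.size] at q5
    refine ⟨a, t', ht.perm h'.perm, ?_, ?_⟩
    · rw [h'.bmat_eq ht.1, hb]; rfl
    · have hfl := edge_flip hM (K := s.2 k) q1 q2 q3 (by omega) q6 q7 q8 q9
      have hpr := prod_four s.2 p α β γ q10
      rcases q11 with ⟨r1, r2, r3⟩ | ⟨r1, r2, r3⟩
      · refine r3 _ hoff ?_
        simp only [r2] at hon
        rw [hon, hpr.1, hpr.2]
        exact hfl.1 r1
      · refine r3 _ hoff ?_
        simp only [r2, neg_neg] at hon
        rw [hon, hpr.1, hpr.2, add_comm]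
        exact hfl.2 r1

theorem Good.all (hM : Model n lam c) {B : Matrix (Fin n) (Fin n) ℤ}
    (h : Good lam c (B, uVar n)) {s : Matrix (Fin n) (Fin n) ℤ × (Fin n → CAField n)}
    (hs : IsSeed B s) : Good lam c s := by
  unfold IsSeed at hs
  induction hs with
  | refl => exact h
  | tail _ h ih =>
    obtain ⟨k, rfl⟩ := h
    exact ih.mut hM k

end LTree

namespace LTree
variable {n : ℕ}

/-- two by two determinant -/
def dt {F : Type*} [Field F] (P Q : F × F) : F := P.1 * Q.2 - P.2 * Q.1

theorem exists_w {x : Fin n → CAField n} (hx : ∀ k, x k ≠ 0) (t : LTree n) :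
    ∀ (a : ℤ) (P Q : CAField n × CAField n), dt P Q = xo x t.top →
    ∃ w : ℤ → CAField n × CAField n, w a = P ∧ w (a + t.size) = Q ∧
      Fits (fun k p q => dt (w p) (w q) = x k) a t ∧
      ∀ p, a ≤ p → p < a + t.size → dt (w p) (w (p + 1)) = 1 := by
  induction t with
  | leaf =>
    intro a P Q h
    refine ⟨fun p => if p = a then P else Q, by simp, by simp [size], trivial, ?_⟩
    intro p h1 h2
    have : p = a := by simp only [size] at h2; omega
    subst this
    simpa [xo, top] using h
  | node k l r hl hr =>
    intro a P Q h
    have s1 := size_pos l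
    have s2 := size_pos r
    have hk := hx k
    have hkk : dt P Q = x k := h
    obtain ⟨R, h1, h2⟩ : ∃ R, dt P R = xo x l.top ∧ dt R Q = xo x r.top := by
      refine ⟨((xo x r.top * P.1 + xo x l.top * Q.1) / x k,
        (xo x r.top * P.2 + xo x l.top * Q.2) / x k), ?_, ?_⟩
      · unfold dt at hkk ⊢
        field_simp
        linear_combination xo x l.top * hkk
      · unfold dt at hkk ⊢
        field_simp
        linear_combination xo x r.top * hkk
    obtain ⟨w1, a1, a2, a3, a4⟩ := hl a P R h1
    obtain ⟨w2, b1, b2, b3, b4⟩ := hr (a + l.size) R Q h2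
    have e1 : ∀ p, p ≤ a + l.size → (if p ≤ a + l.size then w1 p else w2 p) = w1 p := by
      intro p hp; rw [if_pos hp]
    have e2 : ∀ p, a + l.size ≤ p → (if p ≤ a + l.size then w1 p else w2 p) = w2 p := by
      intro p hp
      split_ifs with h
      · have : p = a + l.size := by omega
        subst this; rw [a2, b1]
      · rfl
    refine ⟨fun p => if p ≤ a + l.size then w1 p else w2 p, ?_, ?_, ⟨?_, ?_, ?_⟩, ?_⟩
    · show (if _ then _ else _) = _
      rw [e1 _ (by omega), a1]
    · show (if _ then _ else _) = _
      have hs : (node k l r).size = l.size + r.size := rfl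
      rw [e2 _ (by omega), hs, ← add_assoc, b2]
    · show dt (if _ then _ else _) (if _ then _ else _) = _
      rw [e1 _ (by omega), e2 _ (by omega), ← add_assoc, b2, a1, hkk]
    · refine a3.imp ?_
      intro j p q _ h1 h2 h3 h4
      show dt (if _ then _ else _) (if _ then _ else _) = _
      rw [e1 _ (by omega), e1 _ (by omega), h4]
    · refine b3.imp ?_
      intro j p q _ h1 h2 h3 h4
      show dt (if _ then _ else _) (if _ then _ else _) = _
      rw [e2 _ (by omega), e2 _ (by omega), h4]
    · intro p h1 h2
      show dt (if _ then _ else _) (if _ then _ else _) = _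
      simp only [size] at h2
      by_cases h3 : p < a + l.size
      · rw [e1 _ (by omega), e1 _ (by omega), a4 p h1 h3]
      · rw [e2 _ (by omega), e2 _ (by omega), b4 p (by omega) (by omega)]

/-- the half-turn monodromy -/
def mono {F : Type*} [Field F] (c : F) (hc : c ≠ 0) : Equiv.Perm (F × F) where
  toFun v := (-v.2 / c, c * v.1)
  invFun v := (v.2 / c, -c * v.1)
  left_inv v := by ext <;> simp <;> field_simp
  right_inv v := by ext <;> simp <;> field_simp

theorem dt_mono {F : Type*} [Field F] (c : F) (hc : c ≠ 0) (P Q : F × F) :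
    dt (mono c hc P) (mono c hc Q) = dt P Q := by
  simp only [dt, mono, Equiv.coe_fn_mk]
  field_simp; ring

theorem dt_mono_zpow {F : Type*} [Field F] (c : F) (hc : c ≠ 0) (k : ℤ) : ∀ (P Q : F × F),
    dt ((mono c hc ^ k) P) ((mono c hc ^ k) Q) = dt P Q := by
  induction k using Int.induction_on with
  | zero => intro P Q; simp
  | succ i ih => intro P Q; rw [_root_.zpow_add_one, Equiv.Perm.mul_apply, Equiv.Perm.mul_apply, ih, dt_mono]
  | pred i ih =>
    intro P Q
    have e : ∀ P, mono c hc ((mono c hc)⁻¹ P) = P := fun P => (mono c hc).apply_symm_apply P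
    rw [_root_.zpow_sub_one, Equiv.Perm.mul_apply, Equiv.Perm.mul_apply, ih, ← dt_mono c hc,
      e, e]

theorem exists_lam {x : Fin n → CAField n} (hx : ∀ k, x k ≠ 0) (t : LTree n) (ht : t.size = n + 1)
    (hn : 1 ≤ n) :
    ∃ lam : ℤ → ℤ → CAField n,
      (∀ p q : ℤ, lam (p + ((n : ℤ) + 1)) (q + ((n : ℤ) + 1)) = lam p q) ∧
      (∀ p : ℤ, lam p (p + 1) = 1) ∧
      (∀ a b d e : ℤ, lam a d * lam b e = lam a b * lam d e + lam b d * lam a e) ∧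
      (∀ a m : ℤ, lam a (a + ((n : ℤ) + 1)) * lam m (m + ((n : ℤ) + 1))
        = lam a m ^ 2 + lam m (a + ((n : ℤ) + 1)) ^ 2) ∧
      Fits (fun k p q => x k = lam p q) 0 t := by
  obtain ⟨ρ, hρ, hρ0⟩ : ∃ ρ, ρ = xo x t.top ∧ ρ ≠ 0 := by
    refine ⟨_, rfl, ?_⟩
    cases t with
    | leaf => simp [xo, top]
    | node k l r => exact hx k
  obtain ⟨w, h1, h2, h3, h4⟩ := exists_w hx t 0 (1, 0) (0, ρ) (by simp [dt, hρ])
  rw [ht] at h2 h4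
  simp only [zero_add] at h2 h4
  set N : ℤ := (n : ℤ) + 1 with hN
  have hN0 : 0 < N := by omega
  set M := mono ρ hρ0 with hM
  let v : ℤ → CAField n × CAField n := fun p => (M ^ (p / N)) (w (p % N))
  have hv : ∀ p k, v (p + N * k) = (M ^ k) (v p) := by
    intro p k
    show (M ^ ((p + N * k) / N)) (w ((p + N * k) % N)) = (M ^ k) ((M ^ (p / N)) (w (p % N)))
    rw [Int.add_mul_emod_self_left, Int.add_mul_ediv_left _ _ (by omega), add_comm, _root_.zpow_add,
      Equiv.Perm.mul_apply]
  have hv1 : ∀ p, v (p + N) = M (v p) := by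
    intro p; have := hv p 1; simpa using this
  have hvw : ∀ p, 0 ≤ p → p ≤ N → v p = w p := by
    intro p hp hp'
    rcases hp'.lt_or_eq with h | rfl
    · show (M ^ (p / N)) (w (p % N)) = _
      rw [Int.ediv_eq_zero_of_lt hp h, Int.emod_eq_of_lt hp h]; simp
    · have := hv1 0
      rw [zero_add] at this
      rw [this, h2]
      have : v 0 = w 0 := by
        show (M ^ (0 / N)) (w (0 % N)) = _
        simp
      rw [this, h1]
      simp [hM, mono]
  have hu : ∀ p, dt (v p) (v (p + 1)) = 1 := by
    intro p
    have e : p = p % N + N * (p / N) := (Int.emod_add_mul_ediv p N).symm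
    have b1 := Int.emod_nonneg p (show N ≠ 0 by omega)
    have b2 := Int.emod_lt_of_pos p hN0
    generalize p % N = r at *
    generalize p / N = k at *
    subst e
    have : r + N * k + 1 = (r + 1) + N * k := by ring
    rw [this, hv, hv, dt_mono_zpow, hvw _ b1 (by omega), hvw _ (by omega) (by omega), h4 _ b1 b2]
  refine ⟨fun p q => dt (v p) (v q), ?_, hu, ?_, ?_, ?_⟩
  · intro p q
    simp only [hv1]
    exact dt_mono ρ hρ0 _ _
  · intro a b d e
    simp only [dt]; ring
  · intro a m
    simp only [hv1, hM]
    simp only [dt, mono, Equiv.coe_fn_mk]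
    field_simp; ring
  · refine h3.imp ?_
    intro k p q _ b1 b2 b3 h
    rw [ht] at b3
    show x k = dt (v p) (v q)
    rw [hvw _ b1 (by omega), hvw _ (by omega) (by omega), h]

end LTree

namespace LTree
variable {n : ℕ}

/-- base profile of the height function -/
def gg (N r s p : ℤ) : ℤ :=
  if r = 0 ∧ s = N then (if 0 < p then -1 else 0)
  else (if p ≤ s - N then 1 else 0) - (if r ≤ p ∧ p ≤ s then 1 else 0)
    - (if r < p ∧ p < s then 1 else 0)

/-- height function (antiperiodic) -/
def hh (N r s p : ℤ) : ℤ := if (p / N) % 2 = 0 then gg N r s (p % N) else - gg N r s (p % N)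

/-- parity correction -/
def aa (N r s p : ℤ) : ℤ :=
  if r = 0 ∧ s = N then (|hh N r s p| + 1) % 2 else |hh N r s p| % 2

/-- crossing number -/
def cc (N r s p q : ℤ) : ℤ := (|hh N r s p - hh N r s q| - aa N r s p - aa N r s q) / 2

variable {N r s : ℤ}

theorem hh_base {p : ℤ} (h0 : 0 ≤ p) (h1 : p < N) : hh N r s p = gg N r s p := by
  unfold hh
  rw [Int.ediv_eq_zero_of_lt h0 h1, Int.emod_eq_of_lt h0 h1]; simp

theorem hh_shift (hN : 0 < N) (p : ℤ) : hh N r s (p + N) = - hh N r s p := by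
  unfold hh
  rw [Int.add_emod_right, Int.add_ediv_of_dvd_right (dvd_refl N), Int.ediv_self (by omega)]
  split_ifs <;> omega

theorem aa_shift (hN : 0 < N) (p : ℤ) : aa N r s (p + N) = aa N r s p := by
  unfold aa; rw [hh_shift hN, abs_neg]

theorem cc_shift (hN : 0 < N) (p q : ℤ) : cc N r s (p + N) (q + N) = cc N r s p q := by
  unfold cc
  rw [aa_shift hN, aa_shift hN, hh_shift hN, hh_shift hN]
  have : -hh N r s p - -hh N r s q = -(hh N r s p - hh N r s q) := by ring
  rw [this, abs_neg]

theorem two_cc (p q : ℤ) :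
    2 * cc N r s p q = |hh N r s p - hh N r s q| - aa N r s p - aa N r s q := by
  unfold cc aa
  simp only [abs_eq_max_neg]
  split_ifs <;> omega

theorem shift_k {P : ℤ → Prop} (h1 : ∀ k, P k ↔ P (k + 1)) (k : ℤ) : P 0 ↔ P k := by
  induction k using Int.induction_on with
  | zero => rfl
  | succ i ih => exact ih.trans (h1 _)
  | pred i ih => rw [ih, h1 (-(i : ℤ) - 1)]; simp

theorem cc_unit0 (hN : 3 ≤ N) (hr : 0 ≤ r) (hs : r + 2 ≤ s) (hsN : s ≤ N) {p : ℤ}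
    (h0 : 0 ≤ p) (h1 : p < N) : cc N r s p (p + 1) = 0 := by
  have h2 := two_cc (N := N) (r := r) (s := s) p (p + 1)
  suffices h : |hh N r s p - hh N r s (p + 1)| - aa N r s p - aa N r s (p + 1) = 0 by omega
  clear h2
  unfold aa
  rw [hh_base h0 h1]
  by_cases hp : p + 1 < N
  · rw [hh_base (by omega) hp]
    unfold gg
    simp only [abs_eq_max_neg]
    split_ifs <;> omega
  · have : p + 1 = 0 + N := by omega
    rw [this, hh_shift (by omega), hh_base le_rfl (by omega)]
    unfold gg
    simp only [abs_eq_max_neg]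
    split_ifs <;> omega

theorem norm_exists (hN : 0 < N) (p : ℤ) : ∃ p0 k, 0 ≤ p0 ∧ p0 < N ∧ p = p0 + N * k :=
  ⟨p % N, p / N, Int.emod_nonneg p (by omega), Int.emod_lt_of_pos p hN,
    (Int.emod_add_mul_ediv p N).symm⟩

theorem cc_unit (hN : 3 ≤ N) (hr : 0 ≤ r) (hs : r + 2 ≤ s) (hsN : s ≤ N) (p : ℤ) :
    cc N r s p (p + 1) = 0 := by
  obtain ⟨p, k, h0, h1, rfl⟩ := norm_exists (show 0 < N by omega) p
  have := shift_k (P := fun k => cc N r s (p + N * k) (p + N * k + 1) = 0) (by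
    intro k
    have e1 : p + N * (k + 1) = p + N * k + N := by ring
    have e2 : p + N * k + N + 1 = p + N * k + 1 + N := by ring
    rw [e1, e2, cc_shift (by omega)]) k
  rw [← this]
  simpa using cc_unit0 hN hr hs hsN h0 h1

theorem four_pt {a b d e : ℤ} (h1 : ¬ (a < b ∧ a < e ∧ d < b ∧ d < e))
    (h2 : ¬ (b < a ∧ b < d ∧ e < a ∧ e < d)) :
    |a - d| + |b - e| = max (|a - b| + |d - e|) (|b - d| + |a - e|) := by
  simp only [abs_eq_max_neg]
  omega

theorem hh_lev (hN : 3 ≤ N) (hr : 0 ≤ r) (hs : r + 2 ≤ s) (hsN : s ≤ N) :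
    ∃ l1 u1 l2 u2 : ℤ, 0 ≤ l1 ∧ u1 ≤ N ∧ (u1 = N → 1 ≤ l1) ∧ 0 ≤ l2 ∧ u2 < N ∧ ∀ p, 0 ≤ p → p < 2 * N →
      (-2 ≤ hh N r s p ∧ hh N r s p ≤ 2) ∧
      (hh N r s p ≤ -1 ↔ l1 ≤ p ∧ p ≤ u1) ∧ (hh N r s p ≤ -2 ↔ l2 ≤ p ∧ p ≤ u2) ∧
      (1 ≤ hh N r s p ↔ (l1 + N ≤ p ∧ p ≤ u1 + N) ∨ p ≤ u1 - N) ∧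
      (2 ≤ hh N r s p ↔ l2 + N ≤ p ∧ p ≤ u2 + N) := by
  have key : ∀ p, 0 ≤ p → p < 2 * N → (p < N ∧ hh N r s p = gg N r s p) ∨
      (N ≤ p ∧ hh N r s p = - gg N r s (p - N)) := by
    intro p h0 h1
    by_cases h : p < N
    · exact Or.inl ⟨h, hh_base h0 h⟩
    · refine Or.inr ⟨by omega, ?_⟩
      have := hh_shift (N := N) (r := r) (s := s) (by omega) (p - N)
      rw [sub_add_cancel] at this
      rw [this, hh_base (by omega) (by omega)]
  by_cases hrt : r = 0 ∧ s = N
  · refine ⟨1, N - 1, N, 0, by omega, by omega, by omega, by omega, by omega, ?_⟩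
    intro p h0 h1
    rcases key p h0 h1 with ⟨h2, h3⟩ | ⟨h2, h3⟩ <;> rw [h3] <;> unfold gg <;> rw [if_pos hrt] <;>
      split_ifs <;> omega
  · refine ⟨r, s, r + 1, s - 1, by omega, by omega, by omega, by omega, by omega, ?_⟩
    intro p h0 h1
    rcases key p h0 h1 with ⟨h2, h3⟩ | ⟨h2, h3⟩ <;> rw [h3] <;> unfold gg <;> rw [if_neg hrt] <;>
      split_ifs <;> omega

theorem sep_thr {x y z w : ℤ} (h : x < y ∧ x < w ∧ z < y ∧ z < w) (hx : -2 ≤ x) (hz : -2 ≤ z)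
    (hy : y ≤ 2) (hw : w ≤ 2) :
    (x ≤ -2 ∧ z ≤ -2 ∧ ¬ y ≤ -2 ∧ ¬ w ≤ -2) ∨ (x ≤ -1 ∧ z ≤ -1 ∧ ¬ y ≤ -1 ∧ ¬ w ≤ -1) ∨
    (¬ 1 ≤ x ∧ ¬ 1 ≤ z ∧ 1 ≤ y ∧ 1 ≤ w) ∨ (¬ 2 ≤ x ∧ ¬ 2 ≤ z ∧ 2 ≤ y ∧ 2 ≤ w) := by
  omega

theorem cc_ptol0 (hN : 3 ≤ N) (hr : 0 ≤ r) (hs : r + 2 ≤ s) (hsN : s ≤ N) {a b d e : ℤ}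
    (h0 : 0 ≤ a) (h1 : a < N) (hab : a < b) (hbd : b < d) (hde : d < e) (hea : e ≤ a + N) :
    cc N r s a d + cc N r s b e = max (cc N r s a b + cc N r s d e) (cc N r s b d + cc N r s a e) := by
  have t1 := two_cc (N := N) (r := r) (s := s) a d
  have t2 := two_cc (N := N) (r := r) (s := s) b e
  have t3 := two_cc (N := N) (r := r) (s := s) a b
  have t4 := two_cc (N := N) (r := r) (s := s) d e
  have t5 := two_cc (N := N) (r := r) (s := s) b d
  have t6 := two_cc (N := N) (r := r) (s := s) a e
  have := four_pt (a := hh N r s a) (b := hh N r s b) (d := hh N r s d) (e := hh N r s e) ?_ ?_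
  · omega
  all_goals
    clear t1 t2 t3 t4 t5 t6
    obtain ⟨l1, u1, l2, u2, g1, g2, g3, g4, g5, H⟩ := hh_lev hN hr hs hsN
    obtain ⟨a1, a2, a3, a4, a5⟩ := H a (by omega) (by omega)
    obtain ⟨b1, b2, b3, b4, b5⟩ := H b (by omega) (by omega)
    obtain ⟨d1, d2, d3, d4, d5⟩ := H d (by omega) (by omega)
    obtain ⟨e1, e2, e3, e4, e5⟩ := H e (by omega) (by omega)
    intro hsep
    rcases sep_thr hsep (by omega) (by omega) (by omega) (by omega) with h | h | h | h
  · rw [a3, b3, d3, e3] at h; omega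
  · rw [a2, b2, d2, e2] at h; omega
  · rw [a4, b4, d4, e4] at h; omega
  · rw [a5, b5, d5, e5] at h; omega
  · rw [a3, b3, d3, e3] at h; omega
  · rw [a2, b2, d2, e2] at h; omega
  · rw [a4, b4, d4, e4] at h; omega
  · rw [a5, b5, d5, e5] at h; omega

theorem cc_shift_k (hN : 0 < N) (p q k : ℤ) : cc N r s (p + N * k) (q + N * k) = cc N r s p q := by
  have := shift_k (P := fun k => cc N r s (p + N * k) (q + N * k) = cc N r s p q) (by
    intro k
    have e1 : ∀ p, p + N * (k + 1) = p + N * k + N := by intro p; ring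
    rw [e1, e1, cc_shift hN]) k
  rw [← this]; simp

theorem cc_ptol (hN : 3 ≤ N) (hr : 0 ≤ r) (hs : r + 2 ≤ s) (hsN : s ≤ N) (a b d e : ℤ)
    (hab : a < b) (hbd : b < d) (hde : d < e) (hea : e ≤ a + N) :
    cc N r s a d + cc N r s b e = max (cc N r s a b + cc N r s d e) (cc N r s b d + cc N r s a e) := by
  obtain ⟨a, k, h0, h1, rfl⟩ := norm_exists (show 0 < N by omega) a
  obtain ⟨b, rfl⟩ : ∃ b', b = b' + N * k := ⟨b - N * k, by ring⟩
  obtain ⟨d, rfl⟩ : ∃ b', d = b' + N * k := ⟨d - N * k, by ring⟩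
  obtain ⟨e, rfl⟩ : ∃ b', e = b' + N * k := ⟨e - N * k, by ring⟩
  simp only [cc_shift_k (show 0 < N by omega)]
  exact cc_ptol0 hN hr hs hsN h0 h1 (by omega) (by omega) (by omega) (by omega)

theorem cc_diam (hN : 0 < N) (a m : ℤ) : cc N r s a (a + N) + cc N r s m (m + N) =
    max (2 * cc N r s a m) (2 * cc N r s m (a + N)) := by
  have t1 := two_cc (N := N) (r := r) (s := s) a (a + N)
  have t2 := two_cc (N := N) (r := r) (s := s) m (m + N)
  have t3 := two_cc (N := N) (r := r) (s := s) a m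
  have t4 := two_cc (N := N) (r := r) (s := s) m (a + N)
  rw [aa_shift hN, hh_shift hN] at t1 t2 t4
  simp only [abs_eq_max_neg] at t1 t2 t3 t4
  omega

/-- crossing number of arcs in a polygon -/
def bc (p q r s : ℤ) : ℤ := (if r < p ∧ p < s ∧ s < q then 1 else 0) +
  (if p < r ∧ r < q ∧ q < s then 1 else 0) - (if p = r ∧ q = s then 1 else 0)

/-- point inside an interval -/
def pc (p r s : ℤ) : ℤ := if r < p ∧ p < s then 1 else 0

theorem pt_root {p : ℤ} (h0 : 0 ≤ p) (h1 : p < N) (hrt : r = 0 ∧ s = N) :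
    (p = 0 ∧ hh N r s p = 0 ∧ aa N r s p = 1) ∨ (0 < p ∧ hh N r s p = -1 ∧ aa N r s p = 0) := by
  unfold aa
  rw [hh_base h0 h1, if_pos hrt]
  unfold gg
  rw [if_pos hrt]
  split_ifs with h
  · right; simp [h]
  · left; simp; omega

theorem pt_non {p : ℤ} (h0 : 0 ≤ p) (h1 : p < N) (hr : 0 ≤ r) (hs : r + 2 ≤ s) (hsN : s ≤ N)
    (hrt : ¬ (r = 0 ∧ s = N)) :
    (r < p ∧ p < s ∧ hh N r s p = -2 ∧ aa N r s p = 0) ∨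
    ((p = r ∨ p = s) ∧ hh N r s p = -1 ∧ aa N r s p = 1) ∨
    (p = 0 ∧ s = N ∧ hh N r s p = 1 ∧ aa N r s p = 1) ∨
    ((p < r ∧ (s < N ∨ 0 < p) ∨ s < p) ∧ hh N r s p = 0 ∧ aa N r s p = 0) := by
  have hg : (r < p ∧ p < s ∧ gg N r s p = -2) ∨ ((p = r ∨ p = s) ∧ gg N r s p = -1) ∨
    (p = 0 ∧ s = N ∧ gg N r s p = 1) ∨
    ((p < r ∧ (s < N ∨ 0 < p) ∨ s < p) ∧ gg N r s p = 0) := by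
    unfold gg
    rw [if_neg hrt]
    split_ifs <;> omega
  unfold aa
  rw [hh_base h0 h1, if_neg hrt]
  rcases hg with ⟨h1, h2, h⟩ | ⟨h1, h⟩ | ⟨h1, h2, h⟩ | ⟨h1, h⟩ <;> rw [h] <;> simp [*]

theorem cc_base (hN : 3 ≤ N) (hr : 0 ≤ r) (hs : r + 2 ≤ s) (hsN : s ≤ N) {p q : ℤ}
    (h0 : 0 ≤ p) (h1 : p < q) (h2 : q ≤ N) : cc N r s p q = bc p q r s := by
  have t := two_cc (N := N) (r := r) (s := s) p q
  suffices h : |hh N r s p - hh N r s q| - aa N r s p - aa N r s q = 2 * bc p q r s by omega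
  clear t
  by_cases hrt : r = 0 ∧ s = N
  · have hp := pt_root h0 (by omega) hrt
    by_cases hq : q < N
    · have hq' := pt_root (by omega) hq hrt
      have hb : bc p q r s = 0 := by
        unfold bc; split_ifs <;> omega
      rw [hb]
      rcases hp with ⟨_, e1, e2⟩ | ⟨_, e1, e2⟩ <;> rcases hq' with ⟨_, e3, e4⟩ | ⟨_, e3, e4⟩ <;>
        rw [e1, e2, e3, e4] <;> first | rfl | omega
    · have : q = 0 + N := by omega
      subst this
      rw [aa_shift (by omega), hh_shift (by omega)]
      have hq' := pt_root (N := N) le_rfl (by omega) hrt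
      rcases hp with ⟨_, e1, e2⟩ | ⟨_, e1, e2⟩ <;> rcases hq' with ⟨_, e3, e4⟩ | ⟨_, e3, e4⟩ <;>
        rw [e1, e2, e3, e4] <;> simp [bc] <;> (try split_ifs) <;> omega
  · have hp := pt_non h0 (by omega) hr hs hsN hrt
    by_cases hq : q < N
    · have hq' := pt_non (by omega) hq hr hs hsN hrt
      rcases hp with ⟨h1, h2, e1, e2⟩ | ⟨h1, e1, e2⟩ | ⟨h1, h2, e1, e2⟩ | ⟨h1, e1, e2⟩ <;>
      rcases hq' with ⟨h3, h4, e3, e4⟩ | ⟨h3, e3, e4⟩ | ⟨h3, h4, e3, e4⟩ | ⟨h3, e3, e4⟩ <;>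
        rw [e1, e2, e3, e4] <;> clear e1 e2 e3 e4 <;> unfold bc <;>
        simp only [abs_eq_max_neg] <;> split_ifs <;> omega
    · have : q = 0 + N := by omega
      subst this
      rw [aa_shift (by omega), hh_shift (by omega)]
      have hq' := pt_non (N := N) le_rfl (by omega) hr hs hsN hrt
      rcases hp with ⟨h1, h2, e1, e2⟩ | ⟨h1, e1, e2⟩ | ⟨h1, h2, e1, e2⟩ | ⟨h1, e1, e2⟩ <;>
      rcases hq' with ⟨h3, h4, e3, e4⟩ | ⟨h3, e3, e4⟩ | ⟨h3, h4, e3, e4⟩ | ⟨h3, e3, e4⟩ <;>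
        rw [e1, e2, e3, e4] <;> clear e1 e2 e3 e4 <;> unfold bc <;>
        simp only [abs_eq_max_neg] <;> split_ifs <;> omega

theorem cc_cross (hr : 0 ≤ r) (hs : r + 2 ≤ s) (hsN : s ≤ N) {p m : ℤ}
    (h0 : 0 < m) (h1 : m ≤ p) (h2 : p < N) :
    cc N r s p (m + N) = if r = 0 ∧ s = N then 1 else pc p r s + pc m r s := by
  have t := two_cc (N := N) (r := r) (s := s) p (m + N)
  rw [aa_shift (by omega), hh_shift (by omega)] at t
  by_cases hrt : r = 0 ∧ s = N
  · rw [if_pos hrt]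
    have hp := pt_root (p := p) (by omega) (by omega) hrt
    have hq' := pt_root (p := m) (by omega) (by omega) hrt
    rcases hp with ⟨_, e1, e2⟩ | ⟨_, e1, e2⟩ <;> rcases hq' with ⟨_, e3, e4⟩ | ⟨_, e3, e4⟩ <;>
      rw [e1, e2, e3, e4] at t <;> simp only [abs_eq_max_neg] at t <;> omega
  · rw [if_neg hrt]
    have hp := pt_non (p := p) (by omega) (by omega) hr hs hsN hrt
    have hq' := pt_non (p := m) (by omega) (by omega) hr hs hsN hrt
    rcases hp with ⟨h1, h2, e1, e2⟩ | ⟨h1, e1, e2⟩ | ⟨h1, h2, e1, e2⟩ | ⟨h1, e1, e2⟩ <;>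
    rcases hq' with ⟨h3, h4, e3, e4⟩ | ⟨h3, e3, e4⟩ | ⟨h3, h4, e3, e4⟩ | ⟨h3, e3, e4⟩ <;>
      rw [e1, e2, e3, e4] at t <;> clear e1 e2 e3 e4 <;> unfold pc <;>
      simp only [abs_eq_max_neg] at t <;> split_ifs <;> omega

end LTree

namespace LTree
variable {n : ℕ}

theorem Fits.all {ι : Type*} {Φ : ι → Fin n → ℤ → ℤ → Prop} {t : LTree n} : ∀ {a : ℤ},
    (∀ i, Fits (Φ i) a t) → Fits (fun k p q => ∀ i, Φ i k p q) a t := by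
  induction t with
  | leaf => intro a _; trivial
  | node k l r hl hr =>
    intro a h
    exact ⟨fun i => (h i).1, hl fun i => (h i).2.1, hr fun i => (h i).2.2⟩

theorem Fits.triv {Φ : Fin n → ℤ → ℤ → Prop} {t : LTree n} : ∀ {a : ℤ},
    (∀ k p q, k ∈ t.labels → a ≤ p → p + 2 ≤ q → q ≤ a + t.size → Φ k p q) → Fits Φ a t := by
  induction t with
  | leaf => intro a _; trivial
  | node k l r hl hr =>
    intro a h
    have s1 := size_pos l
    have s2 := size_pos r
    simp only [size] at h
    refine ⟨h _ _ _ (by simp [labels]) le_rfl (by omega) le_rfl, hl ?_, hr ?_⟩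
    · intro j p q hj h1 h2 h3
      exact h _ _ _ (by simp [labels, hj]) h1 h2 (by omega)
    · intro j p q hj h1 h2 h3
      exact h _ _ _ (by simp [labels, hj]) (by omega) h2 (by omega)

/-- relation between the position of label `i` and other nodes -/
def PosRel (i : Fin n) (r s : ℤ) (k : Fin n) (p q : ℤ) : Prop :=
  (k = i → p = r ∧ q = s) ∧ (k ≠ i → bc p q r s = 0)

theorem exists_pos (i : Fin n) (t : LTree n) : ∀ a : ℤ, t.labels.Nodup → i ∈ t.labels →
    ∃ r s, a ≤ r ∧ r + 2 ≤ s ∧ s ≤ a + t.size ∧ Fits (PosRel i r s) a t := by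
  induction t with
  | leaf => intro a _ h; simp [labels] at h
  | node k l r hl hr =>
    intro a hd hi
    have s1 := size_pos l
    have s2 := size_pos r
    simp only [labels, List.nodup_cons, List.mem_append, List.nodup_append', not_or] at hd
    simp only [labels, List.mem_cons, List.mem_append] at hi
    by_cases hik : i = k
    · subst hik
      refine ⟨a, a + (l.size + r.size), le_rfl, by omega, by simp [size], ?_, ?_, ?_⟩
      · exact ⟨fun _ => ⟨rfl, rfl⟩, fun h => absurd rfl h⟩
      · refine Fits.triv ?_
        intro j p q hj h1 h2 h3
        refine ⟨?_, fun _ => ?_⟩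
        · rintro rfl; exact absurd hj hd.1.1
        · unfold bc; split_ifs <;> omega
      · refine Fits.triv ?_
        intro j p q hj h1 h2 h3
        refine ⟨?_, fun _ => ?_⟩
        · rintro rfl; exact absurd hj hd.1.2
        · unfold bc; split_ifs <;> omega
    · by_cases hil : i ∈ l.labels
      · obtain ⟨r', s', h1, h2, h3, h4⟩ := hl a hd.2.1 hil
        refine ⟨r', s', h1, h2, by simp only [size]; omega, ⟨?_, fun _ => ?_⟩, h4, ?_⟩
        · rintro rfl; exact absurd rfl hik
        · unfold bc; split_ifs <;> omega
        · refine Fits.triv ?_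
          intro j p q hj h1 h2 h3
          refine ⟨?_, fun _ => ?_⟩
          · rintro rfl; exact absurd hj (hd.2.2.2 hil)
          · unfold bc; split_ifs <;> omega
      · have hir : i ∈ r.labels := by tauto
        obtain ⟨r', s', h1, h2, h3, h4⟩ := hr (a + l.size) hd.2.2.1 hir
        refine ⟨r', s', by omega, h2, by simp only [size]; omega, ⟨?_, fun _ => ?_⟩, ?_, h4⟩
        · rintro rfl; exact absurd rfl hik
        · unfold bc; split_ifs <;> omega
        · refine Fits.triv ?_
          intro j p q hj h1 h2 h3
          refine ⟨?_, fun _ => ?_⟩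
          · rintro rfl; exact absurd hj hil
          · unfold bc; split_ifs <;> omega

theorem exists_model (hn : 2 ≤ n) {t : LTree n} (ht : Full t) :
    ∃ (lam : ℤ → ℤ → CAField n) (R S : Fin n → ℤ),
      Model n lam (fun i => cc (n + 1) (R i) (S i)) ∧
      (∀ i, 0 ≤ R i ∧ R i + 2 ≤ S i ∧ S i ≤ n + 1) ∧
      Fits (fun k p q => p = R k ∧ q = S k) 0 t ∧
      Fits (NodeOk lam (fun i => cc (n + 1) (R i) (S i)) (uVar n)) 0 t := by
  obtain ⟨lam, l1, l2, l3, l4, l5⟩ := exists_lam (x := uVar n) u_ne t ht.size (by omega)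
  have := fun i => exists_pos i t 0 ht.1 (ht.mem i)
  choose R S h1 h2 h3 h4 using this
  simp only [ht.size, zero_add] at h3
  have hN : 3 ≤ (n : ℤ) + 1 := by omega
  refine ⟨lam, R, S, ⟨l1, ?_, l2, ?_, l3, ?_, l4, ?_⟩, fun i => ⟨h1 i, h2 i, h3 i⟩, ?_, ?_⟩
  · intro i p q; exact cc_shift (by omega) p q
  · intro i p; exact cc_unit hN (h1 i) (h2 i) (h3 i) p
  · intro i a b d e hab hbd hde hea
    exact cc_ptol hN (h1 i) (h2 i) (h3 i) a b d e hab hbd hde hea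
  · intro i a m; exact cc_diam (by omega) a m
  · refine (Fits.all h4).imp ?_
    intro k p q _ _ _ _ h
    exact (h k).1 rfl
  · refine (Fits.all (Φ := fun (b : Bool) k p q => if b then uVar n k = lam p q else
      ∀ i, PosRel i (R i) (S i) k p q) (a := 0) (t := t) ?_).imp ?_
    · intro b
      cases b
      · simpa using Fits.all h4
      · simpa using l5
    · intro k p q hk hp hpq hq h
      rw [ht.size] at hq
      have e1 := h true
      have e2 := h false
      simp only [if_true, Bool.false_eq_true, if_false] at e1 e2
      refine ⟨e1, fun i => ?_⟩
      have := Ord.u i k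
      convert this using 1
      show - cc (n + 1) (R i) (S i) p q = _
      rw [cc_base hN (h1 i) (h2 i) (h3 i) hp hpq (by omega)]
      by_cases hik : i = k
      · subst hik
        obtain ⟨rfl, rfl⟩ := (e2 i).1 rfl
        simp [bc]
      · rw [(e2 i).2 (fun h => hik h.symm), if_neg hik]; simp

theorem pc_edge {p m p' m' : ℤ} {t : LTree n} {a : ℤ}
    (h : Fits (fun _ r s => pc p r s + pc m r s = pc p' r s + pc m' r s) a t) :
    pc p a (a + t.size) + pc m a (a + t.size) = pc p' a (a + t.size) + pc m' a (a + t.size) := by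
  cases t with
  | leaf => simp only [size]; unfold pc; split_ifs <;> omega
  | node k l r => exact h.1

/-- indicator of a point -/
def dl (p z : ℤ) : ℤ := if p = z then 1 else 0

theorem pc_split {p a b c : ℤ} (h1 : a < b) (h2 : b < c) :
    pc p a c = pc p a b + dl p b + pc p b c := by
  unfold pc dl; split_ifs <;> omega

theorem pc_inj {p m p' m' : ℤ} {t : LTree n} : ∀ {a : ℤ},
    Fits (fun _ r s => pc p r s + pc m r s = pc p' r s + pc m' r s) a t →
    ∀ z, a < z → z < a + t.size → dl p z + dl m z = dl p' z + dl m' z := by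
  induction t with
  | leaf => intro a _ z h1 h2; simp only [size] at h2; omega
  | node k l r hl hr =>
    intro a h z h1 h2
    simp only [size] at h2
    have s1 := size_pos l
    have s2 := size_pos r
    rcases lt_trichotomy z (a + l.size) with hz | hz | hz
    · exact hl h.2.1 z h1 hz
    · have e1 := pc_edge h.2.1
      have e2 := pc_edge h.2.2
      have e3 := h.1
      have hs : ∀ p, pc p a (a + (l.size + r.size)) = _ := fun p =>
        pc_split (p := p) (show a < a + l.size by omega)
          (show a + l.size < a + (l.size + r.size) by omega)
      simp only [hs] at e3
      rw [add_assoc] at e2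
      subst hz
      linarith
    · exact hr h.2.2 z hz (by omega)

theorem pc_inj1 {p p' : ℤ} {t : LTree n} {a : ℤ}
    (h : Fits (fun _ r s => pc p r s = pc p' r s) a t) :
    ∀ z, a < z → z < a + t.size → dl p z = dl p' z := by
  intro z h1 h2
  have := pc_inj (p := p) (m := p) (p' := p') (m' := p') (t := t) (a := a) (h.imp (by
    intro k p q _ _ _ _ h; rw [h])) z h1 h2
  omega

theorem bc_edge0 {p q : ℤ} {t : LTree n} {a : ℤ} (hpq : p + 2 ≤ q)
    (h : Fits (fun _ r s => bc p q r s = 0) a t) : bc p q a (a + t.size) = 0 := by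
  cases t with
  | leaf => simp only [size]; unfold bc; split_ifs <;> omega
  | node k l r => exact h.1

theorem bc_ne {p q : ℤ} (hpq : p + 2 ≤ q) {t : LTree n} : ∀ {a : ℤ}, a ≤ p → q ≤ a + t.size →
    ¬ Fits (fun _ r s => bc p q r s = 0) a t := by
  induction t with
  | leaf => intro a h1 h2; simp only [size] at h2; omega
  | node k l r hl hr =>
    intro a h1 h2 h
    simp only [size] at h2
    have s1 := size_pos l
    have s2 := size_pos r
    by_cases c1 : q ≤ a + l.size
    · exact hl h1 c1 h.2.1
    by_cases c2 : a + l.size ≤ p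
    · exact hr c2 (by omega) h.2.2
    have e1 := bc_edge0 hpq h.2.1
    have e2 := bc_edge0 hpq h.2.2
    have e3 := h.1
    rw [add_assoc] at e2
    unfold bc at e1 e2 e3
    split_ifs at e1 e2 e3 <;> omega

theorem bc_edge {p q p' q' : ℤ} {t : LTree n} {a : ℤ} (hpq : p + 2 ≤ q) (hpq' : p' + 2 ≤ q')
    (h : Fits (fun _ r s => bc p q r s = bc p' q' r s) a t) :
    bc p q a (a + t.size) = bc p' q' a (a + t.size) := by
  cases t with
  | leaf => simp only [size]; unfold bc; split_ifs <;> omega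
  | node k l r => exact h.1

/-- straddling versus left -/
theorem straddle_left {a m e p q p' q' : ℤ} (h1 : a ≤ p) (h2 : p < m) (h3 : m < q) (h4 : q ≤ e)
    (h5 : a ≤ p') (h6 : p' < q') (h7 : q' ≤ m)
    (e1 : bc p q a m = bc p' q' a m) (e2 : bc p q m e = bc p' q' m e)
    (e3 : bc p q a e = bc p' q' a e) : False := by
  have f1 : bc p' q' a m ≤ 0 := by unfold bc; split_ifs <;> omega
  have f2 : bc p' q' m e = 0 := by unfold bc; split_ifs <;> omega
  have f3 : bc p' q' a e = 0 := by unfold bc; split_ifs <;> omega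
  rw [← e1] at f1
  rw [← e2] at f2
  rw [← e3] at f3
  clear e1 e2 e3
  unfold bc at f1 f2 f3
  split_ifs at f1 f2 f3 <;> omega

theorem straddle_right {a m e p q p' q' : ℤ} (h1 : a ≤ p) (h2 : p < m) (h3 : m < q) (h4 : q ≤ e)
    (h5 : m ≤ p') (h6 : p' < q') (h7 : q' ≤ e)
    (e1 : bc p q a m = bc p' q' a m) (e2 : bc p q m e = bc p' q' m e)
    (e3 : bc p q a e = bc p' q' a e) : False := by
  have f1 : bc p' q' a m = 0 := by unfold bc; split_ifs <;> omega
  have f2 : bc p' q' m e ≤ 0 := by unfold bc; split_ifs <;> omega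
  have f3 : bc p' q' a e = 0 := by unfold bc; split_ifs <;> omega
  rw [← e1] at f1
  rw [← e2] at f2
  rw [← e3] at f3
  clear e1 e2 e3
  unfold bc at f1 f2 f3
  split_ifs at f1 f2 f3 <;> omega

theorem bc_inj {p q p' q' : ℤ} (hpq : p + 2 ≤ q) (hpq' : p' + 2 ≤ q') {t : LTree n} : ∀ {a : ℤ},
    a ≤ p → q ≤ a + t.size → a ≤ p' → q' ≤ a + t.size →
    Fits (fun _ r s => bc p q r s = bc p' q' r s) a t → p = p' ∧ q = q' := by
  induction t with
  | leaf => intro a h1 h2; simp only [size] at h2; omega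
  | node k l r hl hr =>
    intro a h1 h2 h3 h4 h
    simp only [size] at h2 h4
    have s1 := size_pos l
    have s2 := size_pos r
    have e1 := bc_edge hpq hpq' h.2.1
    have e2 := bc_edge hpq hpq' h.2.2
    have e3 := h.1
    rw [add_assoc] at e2
    by_cases c1 : q ≤ a + l.size
    · by_cases d1 : q' ≤ a + l.size
      · exact hl h1 c1 h3 d1 h.2.1
      · exfalso
        by_cases d2 : a + l.size ≤ p'
        · refine bc_ne hpq h1 c1 (h.2.1.imp ?_)
          intro k r s _ g1 g2 g3 g4
          have : bc p' q' r s = 0 := by unfold bc; split_ifs <;> omega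
          rw [g4, this]
        · exact straddle_left h3 (not_le.1 d2) (not_le.1 d1) h4 h1 (by omega) c1 e1.symm e2.symm
            e3.symm
    · by_cases c2 : a + l.size ≤ p
      · by_cases d2 : a + l.size ≤ p'
        · exact hr c2 (by omega) d2 (by omega) h.2.2
        · exfalso
          by_cases d1 : q' ≤ a + l.size
          · refine bc_ne hpq' h3 d1 (h.2.1.imp ?_)
            intro k r s _ g1 g2 g3 g4
            have : bc p q r s = 0 := by unfold bc; split_ifs <;> omega
            rw [← g4, this]
          · exact straddle_right h3 (not_le.1 d2) (not_le.1 d1) h4 c2 (by omega) h2 e1.symm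
              e2.symm e3.symm
      · by_cases d1 : q' ≤ a + l.size
        · exact (straddle_left h1 (not_le.1 c2) (not_le.1 c1) h2 h3 (by omega) d1 e1 e2 e3).elim
        by_cases d2 : a + l.size ≤ p'
        · exact (straddle_right h1 (not_le.1 c2) (not_le.1 c1) h2 d2 (by omega) h4 e1 e2 e3).elim
        constructor
        · have := pc_inj1 (p := p) (p' := p') (h.2.1.imp (by
            intro k r s _ g1 g2 g3 g4
            have i1 : bc p q r s = pc p r s := by unfold bc pc; split_ifs <;> omega
            have i2 : bc p' q' r s = pc p' r s := by unfold bc pc; split_ifs <;> omega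
            show pc p r s = pc p' r s
            rw [← i1, ← i2, g4]))
          have j1 := this p
          have j2 := this p'
          unfold dl at j1 j2
          split_ifs at j1 j2 <;> omega
        · have := pc_inj1 (p := q) (p' := q') (h.2.2.imp (by
            intro k r s _ g1 g2 g3 g4
            have i1 : bc p q r s = pc q r s := by unfold bc pc; split_ifs <;> omega
            have i2 : bc p' q' r s = pc q' r s := by unfold bc pc; split_ifs <;> omega
            show pc q r s = pc q' r s
            rw [← i1, ← i2, g4]))
          have j1 := this q
          have j2 := this q'
          unfold dl at j1 j2
          split_ifs at j1 j2 <;> omega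

theorem dl_self (p : ℤ) : dl p p = 1 := by simp [dl]

theorem dl_nonneg (p z : ℤ) : 0 ≤ dl p z := by unfold dl; split_ifs <;> omega

theorem dl_pos {p z : ℤ} (h : 0 < dl p z) : p = z := by
  unfold dl at h; split_ifs at h <;> omega

theorem dl_pair {p m p' m' : ℤ} (h1 : m ≤ p) (h2 : m' ≤ p')
    (i1 : dl p p + dl m p = dl p' p + dl m' p) (i2 : dl p p' + dl m p' = dl p' p' + dl m' p')
    (i3 : dl p m + dl m m = dl p' m + dl m' m) : p = p' ∧ m = m' := by
  have le1 : p ≤ p' := by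
    by_contra h
    have e1 : ¬ 0 < dl p' p := fun h' => by have := dl_pos h'; omega
    have e2 : ¬ 0 < dl m' p := fun h' => by have := dl_pos h'; omega
    have := dl_nonneg m p
    rw [dl_self] at i1
    omega
  have le2 : p' ≤ p := by
    by_contra h
    have e1 : ¬ 0 < dl p p' := fun h' => by have := dl_pos h'; omega
    have e2 : ¬ 0 < dl m p' := fun h' => by have := dl_pos h'; omega
    have := dl_nonneg m' p'
    rw [dl_self] at i2
    omega
  have hp : p = p' := le_antisymm le1 le2
  subst hp
  rw [dl_self] at i3
  exact ⟨rfl, (dl_pos (show 0 < dl m' m by omega)).symm⟩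

theorem lam_shift_k {lam : ℤ → ℤ → CAField n} {N : ℤ}
    (h : ∀ p q : ℤ, lam (p + N) (q + N) = lam p q) (p q k : ℤ) :
    lam (p + N * k) (q + N * k) = lam p q := by
  have := shift_k (P := fun k => lam (p + N * k) (q + N * k) = lam p q) (by
    intro k
    have e1 : ∀ p, p + N * (k + 1) = p + N * k + N := by intro p; ring
    rw [e1, e1, h]) k
  rw [← this]; simp

theorem final {n : ℕ}
    (hn : 2 ≤ n) (B : Matrix (Fin n) (Fin n) ℤ) (hB : SkewSymmetrizable B)
    (htype : PatternOfType (cartanC n) B) (y y' : CAField n)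
    (hy : IsClusterVar B y) (hy' : IsClusterVar B y') (d : Fin n → ℤ)
    (hd : IsDenomVec (uVar n) y d) (hd' : IsDenomVec (uVar n) y' d) :
    y = y' := by
  obtain ⟨t, ht, hbt⟩ := exists_init hn B hB htype
  obtain ⟨lam, R, S, hM, hRS, hpos, hok⟩ := exists_model hn ht
  have hgood : Good lam (fun i => cc (n + 1) (R i) (S i)) (B, uVar n) := ⟨0, t, ht, hbt, hok⟩
  have hN : 3 ≤ (n : ℤ) + 1 := by omega
  have norm : ∀ y, IsClusterVar B y → IsDenomVec (uVar n) y d → ∃ p q : ℤ, 0 ≤ p ∧ p < n + 1 ∧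
      p + 2 ≤ q ∧ q ≤ p + (n + 1) ∧ y = lam p q ∧ ∀ i, cc (n + 1) (R i) (S i) p q = d i := by
    rintro y ⟨s, hs, j, rfl⟩ hd
    obtain ⟨a, t', ht', -, hf⟩ := hgood.all hM hs
    obtain ⟨p, q, h1, h2, h3, h4⟩ := hf.get (ht'.mem j)
    rw [ht'.size] at h3
    obtain ⟨p, k, g0, g1, rfl⟩ := norm_exists (show 0 < (n : ℤ) + 1 by omega) p
    obtain ⟨q, rfl⟩ : ∃ b', q = b' + ((n : ℤ) + 1) * k := ⟨q - (n + 1) * k, by ring⟩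
    refine ⟨p, q, g0, g1, by omega, ?_, ?_, ?_⟩
    · linarith
    · rw [h4.1, lam_shift_k hM.lam_per]
    · intro i
      have := den_unique hd (h4.2 i)
      simp only [cc_shift_k (show 0 < (n : ℤ) + 1 by omega)] at this
      omega
  obtain ⟨p, q, a1, a2, a3, a4, a5, a6⟩ := norm y hy hd
  obtain ⟨p', q', b1, b2, b3, b4, b5, b6⟩ := norm y' hy' hd'
  obtain ⟨ρ, hρ0, hρN⟩ : ∃ ρ : Fin n, R ρ = 0 ∧ S ρ = n + 1 := by
    have hsz := ht.size
    cases t with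
    | leaf => simp only [size] at hsz; omega
    | node k l r =>
      have := hpos.1
      simp only [size] at hsz
      refine ⟨k, this.1.symm, ?_⟩
      rw [← this.2, hsz]; ring
  have hbase : ∀ p q : ℤ, 0 ≤ p → p + 2 ≤ q → q ≤ n + 1 → ∀ i,
      cc (n + 1) (R i) (S i) p q = bc p q (R i) (S i) := by
    intro p q h1 h2 h3 i
    exact cc_base hN (hRS i).1 (hRS i).2.1 (hRS i).2.2 h1 (by omega) h3
  have hcross : ∀ p q : ℤ, p < n + 1 → q ≤ p + (n + 1) → (n : ℤ) + 1 < q → ∀ i,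
      cc (n + 1) (R i) (S i) p q = if R i = 0 ∧ S i = n + 1 then 1 else
        pc p (R i) (S i) + pc (q - (n + 1)) (R i) (S i) := by
    intro p q h1 h2 h3 i
    have := cc_cross (N := n + 1) (p := p) (m := q - (n + 1)) (hRS i).1 (hRS i).2.1 (hRS i).2.2
      (by omega) (by omega) h1
    rwa [sub_add_cancel] at this
  have hbc : ∀ p q : ℤ, 0 ≤ p → q ≤ n + 1 → bc p q 0 (n + 1) ≤ 0 := by
    intro p q h1 h2
    unfold bc; split_ifs <;> omega
  have key : p = p' ∧ q = q' := by
    by_cases hq : q ≤ n + 1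
    · by_cases hq' : q' ≤ n + 1
      · refine bc_inj a3 b3 (t := t) (a := 0) a1 (by rw [ht.size]; omega) b1
          (by rw [ht.size]; omega) (hpos.imp ?_)
        rintro k r s _ _ _ _ ⟨rfl, rfl⟩
        rw [← hbase p q a1 a3 hq, ← hbase p' q' b1 b3 hq', a6, b6]
      · exfalso
        have e1 := hbase p q a1 a3 hq ρ
        have e2 := hcross p' q' b2 b4 (not_le.1 hq') ρ
        rw [if_pos ⟨hρ0, hρN⟩, b6] at e2
        rw [a6, hρ0, hρN] at e1
        have := hbc p q a1 hq
        omega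
    · by_cases hq' : q' ≤ n + 1
      · exfalso
        have e1 := hbase p' q' b1 b3 hq' ρ
        have e2 := hcross p q a2 a4 (not_le.1 hq) ρ
        rw [if_pos ⟨hρ0, hρN⟩, a6] at e2
        rw [b6, hρ0, hρN] at e1
        have := hbc p' q' b1 hq'
        omega
      · have hfit : Fits (fun _ r s => pc p r s + pc (q - (n + 1)) r s =
            pc p' r s + pc (q' - (n + 1)) r s) 0 t := by
          refine hpos.imp ?_
          rintro k r s _ _ _ _ ⟨rfl, rfl⟩
          by_cases hk : R k = 0 ∧ S k = n + 1
          · rw [hk.1, hk.2]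
            have : ∀ z : ℤ, 0 < z → z < n + 1 → pc z 0 (n + 1) = 1 := by
              intro z h1 h2
              unfold pc; rw [if_pos ⟨h1, h2⟩]
            rw [this, this, this, this] <;> omega
          · have e1 := hcross p q a2 a4 (not_le.1 hq) k
            have e2 := hcross p' q' b2 b4 (not_le.1 hq') k
            rw [if_neg hk] at e1 e2
            rw [← e1, ← e2, a6, b6]
        have := pc_inj hfit
        rw [ht.size] at this
        have i1 := this p (by omega) (by omega)
        have i2 := this p' (by omega) (by omega)
        have i3 := this (q - (n + 1)) (by omega) (by omega)
        have := dl_pair (by omega) (by omega) i1 i2 i3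
        omega
  rw [a5, b5, key.1, key.2]

end LTree

/-- In a cluster pattern of type `C_n` (`n ≥ 2`), different cluster variables
have different denominator vectors with respect to the initial cluster. -/
theorem different_cluster_variables_different_denominators_type_C {n : ℕ}
    (hn : 2 ≤ n) (B : Matrix (Fin n) (Fin n) ℤ) (hB : SkewSymmetrizable B)
    (htype : PatternOfType (cartanC n) B) (y y' : CAField n)
    (hy : IsClusterVar B y) (hy' : IsClusterVar B y') (d : Fin n → ℤ)
    (hd : IsDenomVec (uVar n) y d) (hd' : IsDenomVec (uVar n) y' d) :
    y = y' := by
  exact LTree.final hn B hB htype y y' hy hy' d hd hd'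
end
end

section
/- Let n ≥ 2 and suppose the cluster pattern with initial seed (B, (u_1,…,u_n)) is of type C_n. Then every cluster variable y of the pattern with y ∉ {u_1,…,u_n} has denominator vector den(y) = (d_1,…,d_n) with all components d_i ≥ 0. -/
open MvPolynomial Matrix

noncomputable section

set_option linter.unusedSimpArgs false
set_option linter.unusedVariables false

/-- Binary trees with labelled internal nodes. -/
inductive BT (n : ℕ) : Type
  | leaf : BT n
  | node : BT n → Fin n → BT n → BT n

namespace BT

variable {n : ℕ}

def labels : BT n → List (Fin n)
  | leaf => []
  | node l k r => l.labels ++ k :: r.labels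

/-- number of leaves -/
def size : BT n → ℕ
  | leaf => 1
  | node l _ r => l.size + r.size

/-- indicator vector of the root label (zero for a leaf) -/
def ind : BT n → Fin n → ℕ
  | leaf, _ => 0
  | node _ k _, i => if i = k then 1 else 0

def ee (k i : Fin n) : ℤ := if i = k then 1 else 0

/-- the skew form of a tree -/
def form : BT n → Fin n → Fin n → ℤ
  | leaf, _, _ => 0
  | node l k r, i, j => l.form i j + r.form i j
      + ((l.ind i : ℤ) * ee k j - (l.ind j : ℤ) * ee k i)
      + (ee k i * (r.ind j : ℤ) - ee k j * (r.ind i : ℤ))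
      + ((r.ind i : ℤ) * (l.ind j : ℤ) - (r.ind j : ℤ) * (l.ind i : ℤ))

def RootIs : BT n → Fin n → Prop
  | leaf, _ => False
  | node _ k _, m => k = m

/-- rotation of the tree at the (non-root) node `k` -/
inductive Rot (k : Fin n) : BT n → BT n → Prop
  | up (l r s : BT n) (t : Fin n) : Rot k (node (node l k r) t s) (node l t (node r k s))
  | dn (l r s : BT n) (t : Fin n) : Rot k (node l t (node r k s)) (node (node l k r) t s)
  | cl (L L' R : BT n) (t : Fin n) : Rot k L L' → Rot k (node L t R) (node L' t R)
  | cr (L R R' : BT n) (t : Fin n) : Rot k R R' → Rot k (node L t R) (node L t R')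

lemma size_pos (T : BT n) : 0 < T.size := by
  induction T with
  | leaf => simp [size]
  | node l k r _ _ => simp only [size]; omega

lemma form_antisymm (T : BT n) (i j : Fin n) : T.form i j = - T.form j i := by
  induction T with
  | leaf => simp [form]
  | node l k r hl hr => simp only [form]; rw [hl, hr]; ring

lemma ind_node (l r : BT n) (k i : Fin n) :
    (node l k r).ind i = if i = k then 1 else 0 := rfl

lemma ind_notin {T : BT n} {k : Fin n} (h : k ∉ T.labels) : T.ind k = 0 := by
  cases T with
  | leaf => rfl
  | node l m r =>
    simp only [labels, List.mem_append, List.mem_cons, not_or] at h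
    simp [ind, h.2.1]

lemma ind_cases (T : BT n) (i : Fin n) : T.ind i = 0 ∨ T.ind i = 1 := by
  cases T with
  | leaf => simp [ind]
  | node l m r => simp only [ind]; split_ifs <;> simp

lemma ind_mem {T : BT n} {i : Fin n} (h : T.ind i ≠ 0) : i ∈ T.labels := by
  by_contra hc
  exact h (ind_notin hc)

lemma form_notin {T : BT n} {k : Fin n} (h : k ∉ T.labels) (i : Fin n) : T.form i k = 0 := by
  induction T with
  | leaf => rfl
  | node l m r hl hr =>
    simp only [labels, List.mem_append, List.mem_cons, not_or] at h
    simp [form, hl h.1, hr h.2.2, ind_notin h.1, ind_notin h.2.2, ee, h.2.1]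

lemma form_notin' {T : BT n} {k : Fin n} (h : k ∉ T.labels) (i : Fin n) : T.form k i = 0 := by
  rw [form_antisymm, form_notin h, neg_zero]

lemma Rot.ind_eq {k : Fin n} {T T' : BT n} (h : Rot k T T') : T'.ind = T.ind := by
  cases h <;> rfl

lemma Rot.rootIs {k m : Fin n} {T T' : BT n} (h : Rot k T T') (hm : T.RootIs m) :
    T'.RootIs m := by
  cases h <;> exact hm

lemma Rot.size_eq {k : Fin n} {T T' : BT n} (h : Rot k T T') : T'.size = T.size := by
  induction h with
  | up => simp only [size]; omega
  | dn => simp only [size]; omega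
  | cl L L' R t _ ih => simp only [size]; omega
  | cr L L' R t _ ih => simp only [size]; omega

lemma Rot.labels_eq {k : Fin n} {T T' : BT n} (h : Rot k T T') :
    T'.labels.Perm T.labels := by
  induction h with
  | up l r s t =>
    rw [List.perm_iff_count]; intro a
    simp only [labels, List.count_append, List.count_cons]; omega
  | dn l r s t =>
    rw [List.perm_iff_count]; intro a
    simp only [labels, List.count_append, List.count_cons]; omega
  | cl L L' R t _ ih => simp only [labels]; exact ih.append_right _
  | cr L L' R t _ ih => simp only [labels]; exact (ih.cons _).append_left _

lemma Rot.mem {k : Fin n} {T T' : BT n} (h : Rot k T T') : k ∈ T.labels := by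
  induction h with
  | up => simp [labels]
  | dn => simp [labels]
  | cl L L' R t _ ih => simp [labels, ih]
  | cr L L' R t _ ih => simp [labels, ih]

lemma Rot.not_ind {k : Fin n} {T T' : BT n} (h : Rot k T T') (hd : T.labels.Nodup) :
    T.ind k = 0 := by
  cases h with
  | up l r s t =>
    simp only [labels, List.nodup_append, List.nodup_cons, List.mem_append, List.mem_cons] at hd
    simp only [ind]; rw [if_neg]; intro h
    exact hd.2.2 k (by simp) t (by simp) h
  | dn l r s t =>
    simp only [labels, List.nodup_append, List.nodup_cons, List.mem_append, List.mem_cons] at hd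
    simp only [ind]; rw [if_neg]; intro h; subst h
    exact hd.2.1.1 (by simp)
  | cl L L' R t h =>
    have := h.mem
    simp only [labels, List.nodup_append, List.mem_cons] at hd
    simp only [ind]; rw [if_neg]; intro h
    exact hd.2.2 k this t (by simp) h
  | cr L L' R t h =>
    have := h.mem
    simp only [labels, List.nodup_append, List.nodup_cons, List.mem_cons] at hd
    simp only [ind]; rw [if_neg]; intro h; subst h
    exact hd.2.1.1 this

lemma exists_rot {T : BT n} {k : Fin n} (h : k ∈ T.labels) :
    T.RootIs k ∨ ∃ T', Rot k T T' := by
  induction T with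
  | leaf => simp [labels] at h
  | node l t r hl hr =>
    simp only [labels, List.mem_append, List.mem_cons] at h
    rcases h with h | h | h
    · right
      rcases hl h with h' | ⟨T', h'⟩
      · cases l with
        | leaf => exact h'.elim
        | node a b c => cases h'; exact ⟨_, Rot.up _ _ _ _⟩
      · exact ⟨_, Rot.cl _ _ _ _ h'⟩
    · left; exact h.symm
    · right
      rcases hr h with h' | ⟨T', h'⟩
      · cases r with
        | leaf => exact h'.elim
        | node a b c => cases h'; exact ⟨_, Rot.dn _ _ _ _⟩
      · exact ⟨_, Rot.cr _ _ _ _ h'⟩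

end BT

/-- Abstract lambda lengths on the universal cover of the `2N`-gon with central symmetry. -/
structure Lam (K : Type) [Field K] (N : ℕ) where
  f : ℕ → ℕ → K
  one : ∀ a, f a (a + 1) = 1
  pl : ∀ a b c d, f a c * f b d = f a b * f c d + f b c * f a d
  per : ∀ a b, f (a + N) (b + N) = f a b
  sw : ∀ a b, f a (b + N) = f b (a + N)

namespace BT

variable {n : ℕ}

/-- `x` is given by the values of `f` at the arcs of the tree `T` placed at `p`. -/
def Rlz {K : Type} (f : ℕ → ℕ → K) (x : Fin n → K) : BT n → ℕ → Prop
  | leaf, _ => True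
  | node l k r, p => x k = f p (p + (l.size + r.size)) ∧ Rlz f x l p ∧ Rlz f x r (p + l.size)

def val {K : Type} [Field K] (x : Fin n → K) : BT n → K
  | leaf => 1
  | node _ k _ => x k

lemma prod_ind {K : Type} [Field K] (x : Fin n → K) (T : BT n) :
    ∏ i, x i ^ T.ind i = T.val x := by
  cases T with
  | leaf => simp [ind, val]
  | node l k r => simp [ind, val, Finset.prod_ite_eq', pow_ite]

lemma prod_ite {K : Type} [Field K] (x : Fin n → K) (t : Fin n) :
    ∏ i, x i ^ (if i = t then 1 else 0) = x t := by
  simp [pow_ite]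

lemma Rlz.val_eq {K : Type} [Field K] {N : ℕ} {Λ : Lam K N} {x : Fin n → K} {T : BT n} {p : ℕ}
    (h : Rlz Λ.f x T p) : T.val x = Λ.f p (p + T.size) := by
  cases T with
  | leaf => simp [val, size, Λ.one]
  | node l k r => exact h.1

lemma Rlz.update {K : Type} {f : ℕ → ℕ → K} {x : Fin n → K} {T : BT n} {p : ℕ}
    (h : Rlz f x T p) {k : Fin n} (hk : k ∉ T.labels) (y : K) :
    Rlz f (Function.update x k y) T p := by
  induction T generalizing p with
  | leaf => trivial
  | node l m r hl hr =>
    simp only [labels, List.mem_append, List.mem_cons, not_or] at hk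
    refine ⟨?_, hl h.2.1 hk.1, hr h.2.2 hk.2.2⟩
    rw [Function.update_of_ne (Ne.symm hk.2.1)]; exact h.1

lemma Rlz.shift {K : Type} [Field K] {N : ℕ} {Λ : Lam K N} {x : Fin n → K} {T : BT n} {p : ℕ}
    (h : Rlz Λ.f x T p) : Rlz Λ.f x T (p + N) := by
  induction T generalizing p with
  | leaf => trivial
  | node l m r hl hr =>
    refine ⟨?_, hl h.2.1, ?_⟩
    · rw [h.1, ← Λ.per]; congr 1; omega
    · have := hr h.2.2
      rwa [show p + l.size + N = p + N + l.size by omega] at this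

def Tri (a b : ℕ) : Prop := (a = 0 ∧ b = 0) ∨ (a = 1 ∧ b = 0) ∨ (a = 0 ∧ b = 1)

lemma rot_main {k : Fin n} {T T' : BT n} (h : Rot k T T') (hd : T.labels.Nodup) :
    ∃ P Q : Fin n → ℕ, (∀ i, Tri (P i) (Q i)) ∧ P k = 0 ∧ Q k = 0 ∧
      (∀ i, T.form i k = (P i : ℤ) - Q i) ∧
      (∀ i j, T'.form i j = if i = k ∨ j = k then - T.form i j else
        T.form i j + ((P i : ℤ) * Q j - Q i * P j)) ∧
      ∀ (K : Type) [Field K] (N : ℕ) (Λ : Lam K N) (p : ℕ) (x : Fin n → K),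
        Rlz Λ.f x T p → x k ≠ 0 →
        Rlz Λ.f (Function.update x k ((∏ i, x i ^ P i + ∏ i, x i ^ Q i) / x k)) T' p := by
  induction h with
  | up l r s t =>
    simp only [labels] at hd
    have hd' := hd
    rw [List.nodup_iff_count_le_one] at hd
    simp only [List.count_append, List.count_cons] at hd
    have hl : ∀ i, i ∈ l.labels ↔ 0 < l.labels.count i := fun i => List.count_pos_iff.symm
    have hr : ∀ i, i ∈ r.labels ↔ 0 < r.labels.count i := fun i => List.count_pos_iff.symm
    have hs : ∀ i, i ∈ s.labels ↔ 0 < s.labels.count i := fun i => List.count_pos_iff.symm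
    have hk := hd k
    simp only [beq_self_eq_true, if_true] at hk
    have hkl : k ∉ l.labels := by rw [hl]; omega
    have hkr : k ∉ r.labels := by rw [hr]; omega
    have hks : k ∉ s.labels := by rw [hs]; omega
    have hkt : k ≠ t := by
      rintro rfl
      simp only [beq_self_eq_true, if_true] at hk; omega
    have hT := hd t
    simp only [beq_self_eq_true, if_true] at hT
    have htl : t ∉ l.labels := by rw [hl]; omega
    have htr : t ∉ r.labels := by rw [hr]; omega
    have hts : t ∉ s.labels := by rw [hs]; omega
    refine ⟨fun i => l.ind i + s.ind i, fun i => r.ind i + (if i = t then 1 else 0), ?_, ?_, ?_,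
      ?_, ?_, ?_⟩
    · intro i
      have h1 := hd i
      have a1 := mt (ind_notin (T := l) (k := i)) 
      have a2 := mt (ind_notin (T := r) (k := i))
      have a3 := mt (ind_notin (T := s) (k := i)) 
      rw [not_not] at a1 a2 a3
      rw [hl] at a1; rw [hr] at a2; rw [hs] at a3
      have b1 := ind_cases l i
      have b2 := ind_cases r i
      have b3 := ind_cases s i
      by_cases hit : i = t
      · subst hit
        simp only [Tri, ind_notin htl, ind_notin htr, ind_notin hts]; simp
      · simp only [Tri, hit, if_false]
        omega
    · simp [ind_notin hkl, ind_notin hks]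
    · simp [ind_notin hkr, hkt]
    · intro i
      simp only [form, form_notin hkl, form_notin hkr, form_notin hks, ind_notin hkl,
        ind_notin hkr, ind_notin hks, ee, hkt, ind_node]
      by_cases hit : i = t <;> by_cases hik : i = k <;> simp [hit, hik, hkt, hkt.symm, ind_notin hkl,
        ind_notin hkr, ind_notin hks]
      all_goals try ring
    · intro i j
      simp only [form, ind_node, ee]
      by_cases hik : i = k
      · subst hik
        simp only [form_notin' hkl, form_notin' hkr, form_notin' hks, ind_notin hkl,
          ind_notin hkr, ind_notin hks, hkt]
        push_cast
        simp only [true_or, if_true]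
        simp; ring
      · by_cases hjk : j = k
        · subst hjk
          simp only [form_notin hkl, form_notin hkr, form_notin hks, ind_notin hkl,
            ind_notin hkr, ind_notin hks, hkt]
          push_cast
          simp only [or_true, if_true]
          simp; ring
        · simp only [hik, hjk, false_or, if_false]
          push_cast
          ring
    · intro K _ N Λ p x hx hxk
      obtain ⟨h1, ⟨h2, h3, h4⟩, h5⟩ := hx
      have e : (∏ i, x i ^ (l.ind i + s.ind i) + ∏ i, x i ^ (r.ind i + (if i = t then 1 else 0)))
          = l.val x * s.val x + r.val x * x t := by
        simp only [pow_add, Finset.prod_mul_distrib, prod_ind, prod_ite]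
      rw [e, h3.val_eq, h4.val_eq, h5.val_eq, h1]
      refine ⟨?_, h3.update hkl _, ?_, h4.update hkr _, ?_⟩
      · rw [Function.update_of_ne hkt.symm, h1]; simp only [size]; congr 1; omega
      · rw [Function.update_self, div_eq_iff hxk, h2]
        have := Λ.pl p (p + l.size) (p + (l.size + r.size)) (p + (l.size + r.size) + s.size)
        simp only [size, add_assoc] at this ⊢
        rw [← this]; ring
      · have := h5.update hks ((Λ.f p (p + l.size) * Λ.f (p + (node l k r).size) (p + (node l k r).size + s.size) +
          Λ.f (p + l.size) (p + l.size + r.size) * Λ.f p (p + ((node l k r).size + s.size))) / x k)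
        rwa [show p + l.size + r.size = p + (node l k r).size by simp only [size]; omega] at *
  | dn l r s t =>
    simp only [labels] at hd
    have hd' := hd
    rw [List.nodup_iff_count_le_one] at hd
    simp only [List.count_append, List.count_cons] at hd
    have hl : ∀ i, i ∈ l.labels ↔ 0 < l.labels.count i := fun i => List.count_pos_iff.symm
    have hr : ∀ i, i ∈ r.labels ↔ 0 < r.labels.count i := fun i => List.count_pos_iff.symm
    have hs : ∀ i, i ∈ s.labels ↔ 0 < s.labels.count i := fun i => List.count_pos_iff.symm
    have hk := hd k
    simp only [beq_self_eq_true, if_true] at hk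
    have hkl : k ∉ l.labels := by rw [hl]; omega
    have hkr : k ∉ r.labels := by rw [hr]; omega
    have hks : k ∉ s.labels := by rw [hs]; omega
    have hkt : k ≠ t := by
      rintro rfl
      simp only [beq_self_eq_true, if_true] at hk; omega
    have hT := hd t
    simp only [beq_self_eq_true, if_true] at hT
    have htl : t ∉ l.labels := by rw [hl]; omega
    have htr : t ∉ r.labels := by rw [hr]; omega
    have hts : t ∉ s.labels := by rw [hs]; omega
    refine ⟨fun i => r.ind i + (if i = t then 1 else 0), fun i => l.ind i + s.ind i, ?_, ?_, ?_,
      ?_, ?_, ?_⟩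
    · intro i
      have h1 := hd i
      have a1 := mt (ind_notin (T := l) (k := i)) 
      have a2 := mt (ind_notin (T := r) (k := i))
      have a3 := mt (ind_notin (T := s) (k := i)) 
      rw [not_not] at a1 a2 a3
      rw [hl] at a1; rw [hr] at a2; rw [hs] at a3
      have b1 := ind_cases l i
      have b2 := ind_cases r i
      have b3 := ind_cases s i
      by_cases hit : i = t
      · subst hit
        simp only [Tri, ind_notin htl, ind_notin htr, ind_notin hts]; simp
      · simp only [Tri, hit, if_false]
        omega
    · simp [ind_notin hkr, hkt]
    · simp [ind_notin hkl, ind_notin hks]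
    · intro i
      simp only [form, form_notin hkl, form_notin hkr, form_notin hks, ind_notin hkl,
        ind_notin hkr, ind_notin hks, ee, hkt, ind_node]
      by_cases hit : i = t <;> by_cases hik : i = k <;> simp [hit, hik, hkt, hkt.symm, ind_notin hkl,
        ind_notin hkr, ind_notin hks]
      all_goals try ring
    · intro i j
      simp only [form, ind_node, ee]
      by_cases hik : i = k
      · subst hik
        simp only [form_notin' hkl, form_notin' hkr, form_notin' hks, ind_notin hkl,
          ind_notin hkr, ind_notin hks, hkt]
        push_cast
        simp only [true_or, if_true]
        simp; ring
      · by_cases hjk : j = k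
        · subst hjk
          simp only [form_notin hkl, form_notin hkr, form_notin hks, ind_notin hkl,
            ind_notin hkr, ind_notin hks, hkt]
          push_cast
          simp only [or_true, if_true]
          simp; ring
        · simp only [hik, hjk, false_or, if_false]
          push_cast
          ring
    · intro K _ N Λ p x hx hxk
      obtain ⟨h1, h5, ⟨h2, h3, h4⟩⟩ := hx
      have e : (∏ i, x i ^ (r.ind i + (if i = t then 1 else 0)) + ∏ i, x i ^ (l.ind i + s.ind i))
          = r.val x * x t + l.val x * s.val x := by
        simp only [pow_add, Finset.prod_mul_distrib, prod_ind, prod_ite]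
      rw [e, h3.val_eq, h4.val_eq, h5.val_eq, h1]
      refine ⟨?_, ⟨?_, h5.update hkl _, h3.update hkr _⟩, ?_⟩
      · rw [Function.update_of_ne hkt.symm, h1]; simp only [size]; congr 1; omega
      · rw [Function.update_self, div_eq_iff hxk, h2]
        have := Λ.pl p (p + l.size) (p + (l.size + r.size)) (p + (l.size + r.size) + s.size)
        simp only [size, add_assoc] at this ⊢
        rw [this]; ring
      · have := h4.update hks ((Λ.f (p + l.size) (p + l.size + r.size) * Λ.f p (p + (l.size + (node r k s).size)) +
          Λ.f p (p + l.size) * Λ.f (p + l.size + r.size) (p + l.size + r.size + s.size)) / x k)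
        rwa [show p + l.size + r.size = p + (node l k r).size by simp only [size]; omega] at *
  | cl L L' R t hrot ih =>
    have hd' := hd
    simp only [labels, List.nodup_append, List.nodup_cons, List.mem_cons] at hd
    obtain ⟨P, Q, h1, h2, h3, h4, h5, h6⟩ := ih hd.1
    have hm := hrot.mem
    have hkt : k ≠ t := hd.2.2 k hm t (Or.inl rfl)
    have hkR : k ∉ R.labels := fun hh => hd.2.2 k hm k (Or.inr hh) rfl
    have hkL := hrot.not_ind hd.1
    refine ⟨P, Q, h1, h2, h3, ?_, ?_, ?_⟩
    · intro i
      simp [form, h4, form_notin hkR, ind_notin hkR, hkL, ee, hkt]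
    · intro i j
      simp only [form, h5, hrot.ind_eq]
      by_cases hik : i = k
      · subst hik
        simp [form_notin' hkR, ind_notin hkR, hkL, ee, hkt]
      · by_cases hjk : j = k
        · subst hjk
          simp [form_notin hkR, ind_notin hkR, hkL, ee, hkt]
        · simp only [hik, hjk, false_or, if_false]
          ring
    · intro K _ N Λ p x hx hxk
      obtain ⟨g1, g2, g3⟩ := hx
      refine ⟨?_, h6 K N Λ p x g2 hxk, ?_⟩
      · rw [Function.update_of_ne hkt.symm, g1, hrot.size_eq]
      · rw [hrot.size_eq]; exact g3.update hkR _
  | cr L R R' t hrot ih =>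
    have hd' := hd
    simp only [labels, List.nodup_append, List.nodup_cons, List.mem_cons] at hd
    obtain ⟨P, Q, h1, h2, h3, h4, h5, h6⟩ := ih hd.2.1.2
    have hm := hrot.mem
    have hkt : k ≠ t := by rintro rfl; exact hd.2.1.1 hm
    have hkR : k ∉ L.labels := fun hh => hd.2.2 k hh k (Or.inr hm) rfl
    have hkL := hrot.not_ind hd.2.1.2
    refine ⟨P, Q, h1, h2, h3, ?_, ?_, ?_⟩
    · intro i
      simp [form, h4, form_notin hkR, ind_notin hkR, hkL, ee, hkt]
    · intro i j
      simp only [form, h5, hrot.ind_eq]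
      by_cases hik : i = k
      · subst hik
        simp [form_notin' hkR, ind_notin hkR, hkL, ee, hkt]
      · by_cases hjk : j = k
        · subst hjk
          simp [form_notin hkR, ind_notin hkR, hkL, ee, hkt]
        · simp only [hik, hjk, false_or, if_false]
          ring
    · intro K _ N Λ p x hx hxk
      obtain ⟨g1, g2, g3⟩ := hx
      refine ⟨?_, g2.update hkR _, h6 K N Λ _ x g3 hxk⟩
      rw [Function.update_of_ne hkt.symm, g1, hrot.size_eq]

end BT

namespace BT

variable {n : ℕ}

def cc (k j : Fin n) : ℤ := if j = k then 2 else 1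

/-- the tree `T` with root label `k` encodes the exchange matrix `B`. -/
def Good (k : Fin n) (T : BT n) (B : Matrix (Fin n) (Fin n) ℤ) : Prop :=
  T.RootIs k ∧ T.labels.Nodup ∧ (∀ i, i ∈ T.labels) ∧ ∀ i j, B i j = T.form i j * cc k j

lemma tri_mut {a b a' b' : ℕ} (h : Tri a b) (h' : Tri a' b') {c c' : ℤ} (hc : c = 1 ∨ c = 2)
    (hc' : c' = 1 ∨ c' = 2) :
    (((a : ℤ) - b) * c).sign * max (((a : ℤ) - b) * c * (-((a' : ℤ) - b') * c')) 0
      = c * c' * (a * b' - b * a') := by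
  rcases h with ⟨rfl, rfl⟩ | ⟨rfl, rfl⟩ | ⟨rfl, rfl⟩ <;>
  rcases h' with ⟨rfl, rfl⟩ | ⟨rfl, rfl⟩ | ⟨rfl, rfl⟩ <;>
  rcases hc with rfl | rfl <;> rcases hc' with rfl | rfl <;> decide

lemma tri_nat {a b : ℕ} (h : Tri a b) (c : ℕ) : (((a : ℤ) - b) * c).toNat = a * c ∧
    (-(((a : ℤ) - b) * c)).toNat = b * c := by
  rcases h with ⟨rfl, rfl⟩ | ⟨rfl, rfl⟩ | ⟨rfl, rfl⟩ <;> simp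

lemma cc_cases (k j : Fin n) : cc k j = 1 ∨ cc k j = 2 := by
  unfold cc; split_ifs <;> simp

lemma node_tri {l r : BT n} {k : Fin n} (hd : (node l k r).labels.Nodup) (i : Fin n) :
    Tri (l.ind i) (r.ind i) := by
  simp only [labels, List.nodup_append, List.nodup_cons, List.mem_cons] at hd
  rcases ind_cases l i with h1 | h1 <;> rcases ind_cases r i with h2 | h2
  · left; exact ⟨h1, h2⟩
  · right; right; exact ⟨h1, h2⟩
  · right; left; exact ⟨h1, h2⟩
  · exfalso
    exact hd.2.2 i (ind_mem (by omega)) i (Or.inr (ind_mem (by omega))) rfl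

lemma step {k : Fin n} {T : BT n} {B : Matrix (Fin n) (Fin n) ℤ} (h : Good k T B) (m : Fin n) :
    ∃ T', Good k T' (mutMat m B) ∧ T'.size = T.size ∧
      ∀ (Λ : Lam (CAField n) T.size) (p : ℕ) (x : Fin n → CAField n),
        Rlz Λ.f x T p → x m ≠ 0 → ∃ p', Rlz Λ.f (mutSeed m (B, x)).2 T' p' := by
  obtain ⟨h1, h2, h3, h4⟩ := h
  rcases exists_rot (h3 m) with hm | ⟨T', hT'⟩
  · cases T with
    | leaf => exact h1.elim
    | node l t r =>
      have hkt : t = k := h1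
      have hkm : t = m := hm
      subst hkt; subst hkm
      have hd := h2
      have htri := node_tri h2
      simp only [labels, List.nodup_append, List.nodup_cons, List.mem_cons] at hd
      have htl : t ∉ l.labels := fun hh => hd.2.2 t hh t (Or.inl rfl) rfl
      have htr : t ∉ r.labels := hd.2.1.1
      have hcol : ∀ i, (node l t r).form i t = (l.ind i : ℤ) - r.ind i := by
        intro i
        simp [form, form_notin htl, form_notin htr, ind_notin htl, ind_notin htr, ee]
        ring
      refine ⟨node r t l, ⟨rfl, ?_, ?_, ?_⟩, ?_, ?_⟩
      · simp only [labels] at h2 ⊢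
        refine (List.Perm.nodup_iff ?_).1 h2
        rw [List.perm_iff_count]; intro a
        simp only [List.count_append, List.count_cons]; omega
      · intro i
        have := h3 i
        simp only [labels, List.mem_append, List.mem_cons] at this ⊢
        tauto
      · intro i j
        have hnew : (node r t l).form i j = l.form i j + r.form i j
            - ((l.ind i : ℤ) * ee t j - (l.ind j : ℤ) * ee t i)
            - (ee t i * (r.ind j : ℤ) - ee t j * (r.ind i : ℤ))
            - ((r.ind i : ℤ) * (l.ind j : ℤ) - (r.ind j : ℤ) * (l.ind i : ℤ)) := by
          simp only [form]; ring
        simp only [mutMat, h4]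
        rw [hnew]
        by_cases hit : i = t
        · subst hit
          simp only [true_or, if_true, form, form_notin' htl, form_notin' htr, ind_notin htl,
            ind_notin htr]
          push_cast; ring
        · by_cases hjt : j = t
          · subst hjt
            simp only [or_true, if_true, form, form_notin htl, form_notin htr, ind_notin htl,
              ind_notin htr]
            push_cast; ring
          · simp only [hit, hjt, or_self, if_false]
            rw [form_antisymm _ t j, hcol, hcol,
              tri_mut (htri i) (htri j) (cc_cases _ _) (cc_cases _ _)]
            simp only [cc, hjt, if_true, if_false, form, ee, hit]
            ring
      · simp only [size]; omega
      · intro Λ p x hx hxm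
        refine ⟨p + l.size, ?_⟩
        obtain ⟨g1, g2, g3⟩ := hx
        have e1 : ∀ i, (B i t).toNat = l.ind i * 2 := by
          intro i
          rw [h4, hcol]
          have := (tri_nat (htri i) 2).1
          simpa [cc] using this
        have e2 : ∀ i, (-(B i t)).toNat = r.ind i * 2 := by
          intro i
          rw [h4, hcol]
          have := (tri_nat (htri i) 2).2
          simpa [cc] using this
        simp only [mutSeed, e1, e2, pow_mul, Finset.prod_pow, prod_ind]
        rw [g2.val_eq, g3.val_eq]
        refine ⟨?_, g3.update htr _, ?_⟩
        · rw [Function.update_self, div_eq_iff hxm, g1]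
          have a1 := Λ.pl p (p + l.size) (p + (l.size + r.size)) (p + l.size + (l.size + r.size))
          have a2 := Λ.per p (p + l.size)
          have a3 := Λ.sw p (p + l.size)
          simp only [size] at a2 a3
          rw [a2, a3] at a1
          rw [show p + l.size + (r.size + l.size) = p + l.size + (l.size + r.size) by omega]
          rw [mul_comm, a1]
          rw [show p + l.size + r.size = p + (l.size + r.size) by omega]
          ring
        · have := (Rlz.shift g2).update htl ((Λ.f p (p + l.size) ^ 2 +
            Λ.f (p + l.size) (p + l.size + r.size) ^ 2) / x t)
          simp only [size] at this
          rw [show p + l.size + r.size = p + (l.size + r.size) by omega] at *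
          exact this
  · have hmk : m ≠ k := by
      rintro rfl
      have := hT'.not_ind h2
      cases T with
      | leaf => exact h1.elim
      | node l t r =>
        have hkt : t = m := h1
        simp [ind, hkt] at this
    obtain ⟨P, Q, q1, q2, q3, q4, q5, q6⟩ := rot_main hT' h2
    refine ⟨T', ⟨hT'.rootIs h1, hT'.labels_eq.nodup_iff.2 h2,
      fun i => hT'.labels_eq.mem_iff.2 (h3 i), ?_⟩, hT'.size_eq, ?_⟩
    · intro i j
      simp only [mutMat, h4, q5]
      by_cases hh : i = m ∨ j = m
      · simp only [hh, if_true]; ring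
      · simp only [hh, if_false]
        rw [form_antisymm _ m j, q4, q4,
          tri_mut (q1 i) (q1 j) (cc_cases _ _) (cc_cases _ _)]
        simp only [cc, hmk, if_false]
        ring
    · intro Λ p x hx hxm
      refine ⟨p, ?_⟩
      have e1 : ∀ i, (B i m).toNat = P i := by
        intro i
        rw [h4, q4]
        have := (tri_nat (q1 i) 1).1
        simpa [cc, hmk] using this
      have e2 : ∀ i, (-(B i m)).toNat = Q i := by
        intro i
        rw [h4, q4]
        have := (tri_nat (q1 i) 1).2
        simpa [cc, hmk] using this
      simp only [mutSeed, e1, e2]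
      exact q6 _ _ Λ p x hx hxm

/-! existence of the lambda lengths -/

def dt {K : Type} [Field K] (u v : K × K) : K := u.1 * v.2 - u.2 * v.1

lemma exists_w {K : Type} [Field K] (x : Fin n → K) (hx : ∀ i, x i ≠ 0) (T : BT n) (p : ℕ)
    (v v' : K × K) (hv : dt v v' = T.val x) :
    ∃ w : ℕ → K × K, w p = v ∧ w (p + T.size) = v' ∧
      (∀ j, p ≤ j → j < p + T.size → dt (w j) (w (j + 1)) = 1) ∧
      Rlz (fun a b => dt (w a) (w b)) x T p ∧
      ∀ w' : ℕ → K × K, (∀ j, p ≤ j → j ≤ p + T.size → w' j = w j) →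
        Rlz (fun a b => dt (w' a) (w' b)) x T p := by
  induction T generalizing p v v' with
  | leaf =>
    refine ⟨fun j => if j = p then v else v', by simp, by simp [size], ?_, trivial,
      fun _ _ => trivial⟩
    intro j h1 h2
    simp only [size] at h2
    have : j = p := by omega
    subst this
    simpa [val] using hv
  | node l k r hl hr =>
    have hk := hx k
    simp only [val] at hv
    have hv' : v.1 * v'.2 - v.2 * v'.1 = x k := hv
    set a := l.val x
    set b := r.val x
    let u : K × K := ((b * v.1 + a * v'.1) / x k, (b * v.2 + a * v'.2) / x k)
    have hu1 : dt v u = a := by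
      simp only [dt, u]
      field_simp
      rw [← hv']; ring
    have hu2 : dt u v' = b := by
      simp only [dt, u]
      field_simp
      rw [← hv']; ring
    obtain ⟨w1, a1, a2, a3, a4, a5⟩ := hl p v u hu1
    obtain ⟨w2, b1, b2, b3, b4, b5⟩ := hr (p + l.size) u v' hu2
    have sl := l.size_pos
    have sr := r.size_pos
    let w : ℕ → K × K := fun j => if j ≤ p + l.size then w1 j else w2 j
    have c1 : ∀ j, j ≤ p + l.size → w j = w1 j := fun j hj => by simp [w, hj]
    have c2 : ∀ j, p + l.size ≤ j → w j = w2 j := by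
      intro j hj
      rcases eq_or_lt_of_le hj with h | h
      · subst h; rw [c1 _ le_rfl, a2, b1]
      · simp [w, not_le.2 h]
    have c3 : w p = v := by rw [c1 _ (by omega), a1]
    have c4 : w (p + (l.size + r.size)) = v' := by
      rw [c2 _ (by omega), ← b2]; congr 1; omega
    have key : ∀ w' : ℕ → K × K, (∀ j, p ≤ j → j ≤ p + (node l k r).size → w' j = w j) →
        Rlz (fun a b => dt (w' a) (w' b)) x (node l k r) p := by
      intro w' hw'
      simp only [size] at hw'
      refine ⟨?_, a5 w' ?_, b5 w' ?_⟩
      · show x k = dt (w' p) (w' (p + (l.size + r.size)))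
        rw [hw' _ le_rfl (by omega), hw' _ (by omega) le_rfl, c3, c4, hv]
      · intro j h1 h2
        rw [hw' j h1 (by omega), c1 j h2]
      · intro j h1 h2
        rw [hw' j (by omega) (by omega), c2 j h1]
    refine ⟨w, c3, by simpa only [size] using c4, ?_, key w (fun _ _ _ => rfl), key⟩
    intro j h1 h2
    simp only [size] at h2
    by_cases hj : j < p + l.size
    · rw [c1 j (by omega), c1 (j+1) (by omega)]; exact a3 j h1 hj
    · rw [c2 j (by omega), c2 (j+1) (by omega)]; exact b3 j (by omega) (by omega)

lemma exists_lam {K : Type} [Field K] (x : Fin n → K) (hx : ∀ i, x i ≠ 0) (T : BT n)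
    (k : Fin n) (hT : T.RootIs k) : ∃ Λ : Lam K T.size, Rlz Λ.f x T 0 := by
  have hk := hx k
  have hval : T.val x = x k := by
    cases T with
    | leaf => exact hT.elim
    | node l t r => have : t = k := hT; simp [val, this]
  obtain ⟨w, a1, a2, a3, -, a5⟩ := exists_w x hx T 0 (1, 0) (0, x k) (by simp [dt, hval])
  set N := T.size with hN
  have hN0 : 0 < N := T.size_pos
  simp only [zero_add] at a2 a3 a5
  let M : K × K → K × K := fun u => (-(u.2 / x k), x k * u.1)
  have M2 : ∀ u, M (M u) = -u := by
    intro u; ext <;> simp [M] <;> field_simp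
  have Md : ∀ u v, dt (M u) (M v) = dt u v := by
    intro u v; simp only [M, dt]; field_simp; ring
  have Mdi : ∀ (m : ℕ) u v, dt (M^[m] u) (M^[m] v) = dt u v := by
    intro m
    induction m with
    | zero => intro u v; rfl
    | succ m ih => intro u v; rw [Function.iterate_succ_apply, Function.iterate_succ_apply, ih, Md]
  let W : ℕ → K × K := fun a => M^[a / N] (w (a % N))
  have W0 : ∀ a, a ≤ N → W a = w a := by
    intro a ha
    rcases eq_or_lt_of_le ha with h | h
    · subst h
      simp only [W, Nat.div_self hN0, Nat.mod_self, Function.iterate_one, a1, a2, M]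
      simp
    · simp [W, Nat.div_eq_of_lt h, Nat.mod_eq_of_lt h]
  have WN : ∀ a, W (a + N) = M (W a) := by
    intro a
    simp only [W, Nat.add_div_right _ hN0, Nat.add_mod_right, Function.iterate_succ_apply']
  refine ⟨⟨fun a b => dt (W a) (W b), ?_, ?_, ?_, ?_⟩, ?_⟩
  · intro a
    induction a using Nat.strong_induction_on with
    | _ a ih =>
      by_cases h : a < N
      · rw [W0 a h.le, W0 (a+1) h]; exact a3 a (Nat.zero_le _) h
      · obtain ⟨c, rfl⟩ := Nat.exists_eq_add_of_le (not_lt.1 h)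
        have := ih c (by omega)
        rw [show N + c + 1 = (c + 1) + N by omega, show N + c = c + N by omega, WN, WN, Md]
        exact this
  · intro a b c d
    simp only [dt]; ring
  · intro a b
    simp only [WN, Md]
  · intro a b
    simp only [WN]
    rw [← Md, M2]
    simp only [dt, Prod.fst_neg, Prod.snd_neg]; ring
  · exact a5 W (fun j _ h => W0 j h)

end BT

/-! specialization of rational functions at a rational point -/

def Spec {n : ℕ} (z : Fin n → ℚ) (y : CAField n) (r : ℚ) : Prop :=
  ∃ p q : MvPolynomial (Fin n) ℚ, eval z q ≠ 0 ∧
    y * algebraMap (MvPolynomial (Fin n) ℚ) (CAField n) q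
      = algebraMap (MvPolynomial (Fin n) ℚ) (CAField n) p ∧ eval z p = r * eval z q

namespace Spec

variable {n : ℕ} {z : Fin n → ℚ}

lemma alg (p : MvPolynomial (Fin n) ℚ) :
    Spec z (algebraMap (MvPolynomial (Fin n) ℚ) (CAField n) p) (eval z p) :=
  ⟨p, 1, by simp, by simp, by simp⟩

lemma one : Spec z (1 : CAField n) 1 := ⟨1, 1, by simp, by simp, by simp⟩

lemma add {y y' : CAField n} {r r' : ℚ} (h : Spec z y r) (h' : Spec z y' r') :
    Spec z (y + y') (r + r') := by
  obtain ⟨p, q, h1, h2, h3⟩ := h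
  obtain ⟨p', q', h1', h2', h3'⟩ := h'
  refine ⟨p * q' + p' * q, q * q', by simp [h1, h1'], ?_, ?_⟩
  · simp only [map_add, map_mul, ← h2, ← h2']; ring
  · simp only [map_add, map_mul, h3, h3']; ring

lemma mul {y y' : CAField n} {r r' : ℚ} (h : Spec z y r) (h' : Spec z y' r') :
    Spec z (y * y') (r * r') := by
  obtain ⟨p, q, h1, h2, h3⟩ := h
  obtain ⟨p', q', h1', h2', h3'⟩ := h'
  refine ⟨p * p', q * q', by simp [h1, h1'], ?_, ?_⟩
  · simp only [map_mul, ← h2, ← h2']; ring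
  · simp only [map_mul, h3, h3']; ring

lemma ne_zero {y : CAField n} {r : ℚ} (h : Spec z y r) (hr : r ≠ 0) : y ≠ 0 := by
  obtain ⟨p, q, h1, h2, h3⟩ := h
  rintro rfl
  rw [zero_mul] at h2
  have : p = 0 := by
    have := (map_eq_zero_iff _ (IsFractionRing.injective (MvPolynomial (Fin n) ℚ)
      (CAField n))).1 h2.symm
    exact this
  subst this
  rw [map_zero] at h3
  exact mul_ne_zero hr h1 h3.symm

lemma inv {y : CAField n} {r : ℚ} (h : Spec z y r) (hr : r ≠ 0) : Spec z y⁻¹ r⁻¹ := by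
  have hy := h.ne_zero hr
  obtain ⟨p, q, h1, h2, h3⟩ := h
  refine ⟨q, p, by rw [h3]; exact mul_ne_zero hr h1, ?_, ?_⟩
  · rw [← h2]; field_simp
  · rw [h3]; field_simp

lemma uniq {y : CAField n} {r r' : ℚ} (h : Spec z y r) (h' : Spec z y r') : r = r' := by
  obtain ⟨p, q, h1, h2, h3⟩ := h
  obtain ⟨p', q', h1', h2', h3'⟩ := h'
  have : p * q' = p' * q := by
    apply IsFractionRing.injective (MvPolynomial (Fin n) ℚ) (CAField n)
    simp only [map_mul, ← h2, ← h2']; ring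
  have h5 := congrArg (eval z) this
  simp only [map_mul, h3, h3'] at h5
  have h6 : (r - r') * (eval z q * eval z q') = 0 := by linear_combination h5
  rcases mul_eq_zero.1 h6 with h | h
  · linarith
  · exact absurd h (mul_ne_zero h1 h1')

lemma pow {y : CAField n} {r : ℚ} (h : Spec z y r) (m : ℕ) : Spec z (y ^ m) (r ^ m) := by
  induction m with
  | zero => simpa using one
  | succ m ih => rw [pow_succ, pow_succ]; exact ih.mul h

lemma zpow {y : CAField n} {r : ℚ} (h : Spec z y r) (hr : r ≠ 0) (m : ℤ) :
    Spec z (y ^ m) (r ^ m) := by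
  cases m with
  | ofNat m => simpa using h.pow m
  | negSucc m =>
    rw [zpow_negSucc, zpow_negSucc]
    exact (h.pow _).inv (pow_ne_zero _ hr)

lemma prod {ι : Type} (s : Finset ι) (y : ι → CAField n) (r : ι → ℚ)
    (h : ∀ i, Spec z (y i) (r i)) : Spec z (∏ i ∈ s, y i) (∏ i ∈ s, r i) := by
  classical
  induction s using Finset.induction_on with
  | empty => simpa using one
  | insert a s ha ih => rw [Finset.prod_insert ha, Finset.prod_insert ha]; exact (h a).mul ih

/-- the key inequality -/
lemma exch {Z Y A B C D : CAField n} (e : Z * Y = A * B + C * D) {a b c d ζ : ℚ}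
    (hZ : Spec z Z ζ) (hA : Spec z A a) (hB : Spec z B b) (hC : Spec z C c) (hD : Spec z D d)
    (h0 : 0 < ζ) (h1 : ζ ≤ 1) (ha : 0 < a) (hb : 0 < b) (hc : 0 < c) (hd : 0 < d)
    (h : (1 ≤ a ∧ 1 ≤ b) ∨ (1 ≤ c ∧ 1 ≤ d)) : ∃ r, 1 ≤ r ∧ Spec z Y r := by
  have hZ0 := hZ.ne_zero h0.ne'
  refine ⟨(a * b + c * d) * ζ⁻¹, ?_, ?_⟩
  · rw [← div_eq_mul_inv, le_div_iff₀ h0]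
    have p1 := mul_pos ha hb
    have p2 := mul_pos hc hd
    rcases h with ⟨g1, g2⟩ | ⟨g1, g2⟩ <;> nlinarith
  · have : Y = (A * B + C * D) * Z⁻¹ := by rw [← e]; field_simp
    rw [this]
    exact ((hA.mul hB).add (hC.mul hD)).mul (hZ.inv h0.ne')

end Spec

namespace BT

variable {n : ℕ}

/-- if the label `i` occurs in `T` placed at `p`, its arc is `(α, β)` -/
def ArcIs (i : Fin n) (α β : ℕ) : BT n → ℕ → Prop
  | leaf, _ => True
  | node l k r, p => (k = i → p = α ∧ p + (l.size + r.size) = β) ∧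
      ArcIs i α β l p ∧ ArcIs i α β r (p + l.size)

lemma arcIs_notin {i : Fin n} {α β : ℕ} {T : BT n} {p : ℕ} (h : i ∉ T.labels) :
    ArcIs i α β T p := by
  induction T generalizing p with
  | leaf => trivial
  | node l k r hl hr =>
    simp only [labels, List.mem_append, List.mem_cons, not_or] at h
    exact ⟨fun e => absurd e.symm h.2.1, hl h.1, hr h.2.2⟩

lemma exists_arc {K : Type} (f : ℕ → ℕ → K) (x : Fin n → K) {i : Fin n} {T : BT n} {p : ℕ}
    (h : i ∈ T.labels) (hd : T.labels.Nodup) (hx : Rlz f x T p) :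
    ∃ α β, f α β = x i ∧ ArcIs i α β T p := by
  induction T generalizing p with
  | leaf => simp [labels] at h
  | node l k r hl hr =>
    simp only [labels, List.mem_append, List.mem_cons, List.nodup_append, List.nodup_cons] at h hd
    rcases h with h | h | h
    · obtain ⟨α, β, h1, h2⟩ := hl h hd.1 hx.2.1
      exact ⟨α, β, h1, fun e => absurd e.symm (hd.2.2 i h k (Or.inl rfl)), h2,
        arcIs_notin (fun hh => hd.2.2 i h i (Or.inr hh) rfl)⟩
    · subst h
      exact ⟨_, _, hx.1.symm, fun _ => ⟨rfl, rfl⟩,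
        arcIs_notin (fun hh => hd.2.2 i hh i (Or.inl rfl) rfl), arcIs_notin hd.2.1.1⟩
    · obtain ⟨α, β, h1, h2⟩ := hr h hd.2.1.2 hx.2.2
      refine ⟨α, β, h1, fun e => ?_, arcIs_notin (fun hh => hd.2.2 i hh i (Or.inr h) rfl), h2⟩
      subst e; exact absurd h hd.2.1.1

/-- `f a b` specializes to something positive, and at least `1` unless `(a,b) = (α,β)` -/
def EE (z : Fin n → ℚ) (f : ℕ → ℕ → CAField n) (α β a b : ℕ) : Prop :=
  ∃ r, 0 < r ∧ Spec z (f a b) r ∧ (¬ (a = α ∧ b = β) → 1 ≤ r)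

def EU (z : Fin n → ℚ) (f : ℕ → ℕ → CAField n) (α β a b : ℕ) : Prop :=
  ∃ r, 0 < r ∧ Spec z (f a b) r ∧ (¬ (a = α ∧ b = β) → 1 ≤ r) ∧ r ≤ 1

lemma EU.toEE {z : Fin n → ℚ} {f : ℕ → ℕ → CAField n} {α β a b : ℕ} (h : EU z f α β a b) :
    EE z f α β a b := by
  obtain ⟨r, h1, h2, h3, _⟩ := h
  exact ⟨r, h1, h2, h3⟩

lemma EE.exch {z : Fin n → ℚ} {f : ℕ → ℕ → CAField n} {α β : ℕ}
    {a1 b1 a2 b2 a3 b3 a4 b4 a5 b5 a6 b6 : ℕ} (h5 : EU z f α β a5 b5)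
    (h1 : EE z f α β a1 b1) (h2 : EE z f α β a2 b2) (h3 : EE z f α β a3 b3)
    (h4 : EE z f α β a4 b4)
    (e : f a5 b5 * f a6 b6 = f a1 b1 * f a2 b2 + f a3 b3 * f a4 b4)
    (hne : ¬ (a1 = a3 ∧ b1 = b3) ∧ ¬ (a1 = a4 ∧ b1 = b4) ∧
      ¬ (a2 = a3 ∧ b2 = b3) ∧ ¬ (a2 = a4 ∧ b2 = b4)) :
    ∃ r, 1 ≤ r ∧ Spec z (f a6 b6) r := by
  obtain ⟨r1, p1, s1, t1⟩ := h1
  obtain ⟨r2, p2, s2, t2⟩ := h2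
  obtain ⟨r3, p3, s3, t3⟩ := h3
  obtain ⟨r4, p4, s4, t4⟩ := h4
  obtain ⟨r5, p5, s5, t5, q5⟩ := h5
  refine Spec.exch e s5 s1 s2 s3 s4 p5 q5 p1 p2 p3 p4 ?_
  by_cases g1 : a1 = α ∧ b1 = β
  · exact Or.inr ⟨t3 (by omega), t4 (by omega)⟩
  · by_cases g2 : a2 = α ∧ b2 = β
    · exact Or.inr ⟨t3 (by omega), t4 (by omega)⟩
    · exact Or.inl ⟨t1 g1, t2 g2⟩

lemma toEE {z : Fin n → ℚ} {f : ℕ → ℕ → CAField n} {α β a b : ℕ}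
    (h : ∃ r, 1 ≤ r ∧ Spec z (f a b) r) : EE z f α β a b := by
  obtain ⟨r, h1, h2⟩ := h
  exact ⟨r, by linarith, h2, fun _ => h1⟩

lemma edge {N : ℕ} (z : Fin n → ℚ) (Λ : Lam (CAField n) N) (α β : ℕ) (T : BT n) (p : ℕ)
    (i : Fin n) (x : Fin n → CAField n)
    (hx : ∀ j, ∃ r, 0 < r ∧ r ≤ 1 ∧ Spec z (x j) r ∧ (j ≠ i → 1 ≤ r))
    (hR : Rlz Λ.f x T p) (hA : ArcIs i α β T p) : EU z Λ.f α β p (p + T.size) := by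
  cases T with
  | leaf => simp only [size]; exact ⟨1, by norm_num, by rw [Λ.one]; exact Spec.one, by simp, le_rfl⟩
  | node l k r =>
    simp only [size]
    obtain ⟨r, h1, h2, h3, h4⟩ := hx k
    refine ⟨r, h1, by rw [← hR.1]; exact h3, fun h => h4 (fun e => h (hA.1 e)), h2⟩

lemma inner {N : ℕ} (z : Fin n → ℚ) (Λ : Lam (CAField n) N) (α β : ℕ) (T : BT n) (p : ℕ)
    (i : Fin n) (x : Fin n → CAField n)
    (hx : ∀ j, ∃ r, 0 < r ∧ r ≤ 1 ∧ Spec z (x j) r ∧ (j ≠ i → 1 ≤ r))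
    (hR : Rlz Λ.f x T p) (hA : ArcIs i α β T p) (a b : ℕ) (h1 : p ≤ a) (h2 : a < b)
    (h3 : b ≤ p + T.size) : EE z Λ.f α β a b := by
  induction T generalizing p a b with
  | leaf =>
    simp only [size] at h3
    have e1 : a = p := by omega
    have e2 : b = p + 1 := by omega
    subst e1; subst e2
    exact (edge z Λ α β leaf a i x hx hR hA).toEE
  | node l k r hl hr =>
    have e0 := edge z Λ α β _ p i x hx hR hA
    have e1 := edge z Λ α β _ _ i x hx hR.2.1 hA.2.1
    have e2 := edge z Λ α β _ _ i x hx hR.2.2 hA.2.2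
    simp only [size] at e0 h3
    rw [← add_assoc] at e0 h3
    have hl' := fun a b => hl p hR.2.1 hA.2.1 a b
    have hr' := fun a b => hr (p + l.size) hR.2.2 hA.2.2 a b
    have sl := l.size_pos
    have sr := r.size_pos
    set m := p + l.size
    set q := m + r.size
    by_cases c1 : b ≤ m
    · exact hl' a b h1 h2 c1
    by_cases c2 : m ≤ a
    · exact hr' a b c2 h2 h3
    have H1 : EE z Λ.f α β p b := by
      rcases eq_or_lt_of_le h3 with h | h
      · rw [h]; exact e0.toEE
      · refine toEE (EE.exch (a6 := p) (b6 := b) e2 e1.toEE (hr' b q (by omega) h le_rfl)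
          (hr' m b le_rfl (by omega) h3) e0.toEE ?_ (by omega))
        rw [mul_comm]; exact Λ.pl p m b q
    rcases eq_or_lt_of_le h1 with h | h
    · rw [← h]; exact H1
    · exact toEE (EE.exch (a6 := a) (b6 := b) e1 (hl' p a le_rfl h (by omega))
          (hr' m b le_rfl (by omega) h3) (hl' a m h1 (by omega) le_rfl) H1 (Λ.pl p a m b) (by omega))

lemma per_mul {K : Type} [Field K] {N : ℕ} (Λ : Lam K N) (a b q : ℕ) :
    Λ.f (a + N * q) (b + N * q) = Λ.f a b := by
  induction q with
  | zero => simp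
  | succ q ih => rw [Nat.mul_succ, ← add_assoc, ← add_assoc, Λ.per, ih]

lemma dichotomy (z : Fin n → ℚ) (T : BT n) (Λ : Lam (CAField n) T.size)
    (i : Fin n) (x : Fin n → CAField n)
    (hx : ∀ j, ∃ r, 0 < r ∧ r ≤ 1 ∧ Spec z (x j) r ∧ (j ≠ i → 1 ≤ r))
    (hR : Rlz Λ.f x T 0) (hd : T.labels.Nodup) (hi : i ∈ T.labels) (a b : ℕ) (h2 : a < b)
    (h3 : b ≤ a + T.size) : Λ.f a b = x i ∨ ∃ r, 1 ≤ r ∧ Spec z (Λ.f a b) r := by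
  obtain ⟨α, β, hαβ, hA⟩ := exists_arc Λ.f x hi hd hR
  have hin := inner z Λ α β T 0 i x hx hR hA
  have hed := edge z Λ α β T 0 i x hx hR hA
  simp only [zero_add] at hin hed
  have hN := T.size_pos
  have fin : ∀ a b, EE z Λ.f α β a b → Λ.f a b = x i ∨ ∃ r, 1 ≤ r ∧ Spec z (Λ.f a b) r := by
    rintro a b ⟨r, r1, r2, r3⟩
    by_cases h : a = α ∧ b = β
    · left; rw [h.1, h.2]; exact hαβ
    · right; exact ⟨r, r3 h, r2⟩
  have red : ∀ a b, a < T.size → a < b → b ≤ a + T.size →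
      Λ.f a b = x i ∨ ∃ r, 1 ≤ r ∧ Spec z (Λ.f a b) r := by
    intro a b ha hab hb
    by_cases hbN : b ≤ T.size
    · exact fin a b (hin a b (Nat.zero_le _) hab hbN)
    · obtain ⟨c, rfl⟩ := Nat.exists_eq_add_of_le' (not_le.1 hbN).le
      have hc : 0 < c := by omega
      right
      refine EE.exch (a6 := a) (b6 := c + T.size) hed (hin 0 a le_rfl (by omega) (by omega))
        (hin 0 c le_rfl hc (by omega)) (hin a T.size (Nat.zero_le _) ha le_rfl)
        (hin c T.size (Nat.zero_le _) (by omega) le_rfl) ?_ (by omega)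
      have e1 := Λ.pl 0 a T.size (c + T.size)
      have e2 := Λ.per 0 c
      have e3 := Λ.sw 0 c
      rw [zero_add] at e2 e3
      rw [e2, e3] at e1
      exact e1
  have := red (a % T.size) (b - T.size * (a / T.size)) (Nat.mod_lt _ hN)
    (by have := Nat.mod_add_div a T.size; omega) (by have := Nat.mod_add_div a T.size; omega)
  rw [← per_mul Λ _ _ (a / T.size), Nat.mod_add_div, Nat.sub_add_cancel] at this
  · exact this
  · have := Nat.mod_add_div a T.size; omega

lemma Rlz.exists_arc {K : Type} {f : ℕ → ℕ → K} {x : Fin n → K} {i : Fin n} {T : BT n} {p : ℕ}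
    (h : i ∈ T.labels) (hx : Rlz f x T p) :
    ∃ a b, a < b ∧ b ≤ a + T.size ∧ x i = f a b := by
  induction T generalizing p with
  | leaf => simp [labels] at h
  | node l k r hl hr =>
    have sl := l.size_pos
    have sr := r.size_pos
    simp only [labels, List.mem_append, List.mem_cons] at h
    simp only [size]
    rcases h with h | h | h
    · obtain ⟨a, b, h1, h2, h3⟩ := hl h hx.2.1
      exact ⟨a, b, h1, by omega, h3⟩
    · subst h; exact ⟨_, _, by omega, le_rfl, hx.1⟩
    · obtain ⟨a, b, h1, h2, h3⟩ := hr h hx.2.2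
      exact ⟨a, b, h1, by omega, h3⟩

end BT

namespace BT

variable {n : ℕ}

lemma mutMat_mutMat (k : Fin n) (B : Matrix (Fin n) (Fin n) ℤ) : mutMat k (mutMat k B) = B := by
  funext i j
  by_cases hi : i = k
  · simp [mutMat, hi]
  · by_cases hj : j = k
    · simp [mutMat, hj]
    · simp [mutMat, hi, hj, Int.sign_neg]

def SkD (d : Fin n → ℤ) (B : Matrix (Fin n) (Fin n) ℤ) : Prop :=
  ∀ i j, d i * B i j = -(d j * B j i)

lemma SkD.sign {d : Fin n → ℤ} (hd : ∀ i, 0 < d i) {B : Matrix (Fin n) (Fin n) ℤ}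
    (h : SkD d B) (i j : Fin n) : (B i j).sign = -(B j i).sign := by
  have := congrArg Int.sign (h i j)
  rwa [Int.sign_neg, Int.sign_mul, Int.sign_mul, Int.sign_eq_one_of_pos (hd i),
    Int.sign_eq_one_of_pos (hd j), one_mul, one_mul] at this

lemma SkD.mut {d : Fin n → ℤ} (hd : ∀ i, 0 < d i) {B : Matrix (Fin n) (Fin n) ℤ}
    (h : SkD d B) (k : Fin n) : SkD d (mutMat k B) := by
  intro i j
  by_cases hi : i = k
  · simp only [mutMat, hi, true_or, or_true, if_true]
    linear_combination -(h k j)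
  · by_cases hj : j = k
    · simp only [mutMat, hj, true_or, or_true, if_true]
      linear_combination -(h i k)
    · simp only [mutMat, hi, hj, or_self, if_false]
      have e0 := h i j
      have e1 := h i k
      have e2 := h j k
      have e3 : d i * (B i k * B k j) = d j * (B j k * B k i) := by
        linear_combination B k j * e1 - B k i * e2
      have e4 : d i * max (B i k * B k j) 0 = d j * max (B j k * B k i) 0 := by
        rw [mul_max_of_nonneg _ _ (hd i).le, mul_max_of_nonneg _ _ (hd j).le, e3, mul_zero,
          mul_zero]
      have s2 := h.sign hd j k
      by_cases hpos : 0 < B i k * B k j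
      · have hs : (B i k).sign = -(B j k).sign := by
          rw [s2, neg_neg]
          rcases pos_and_pos_or_neg_and_neg_of_mul_pos hpos with ⟨a, b⟩ | ⟨a, b⟩
          · rw [Int.sign_eq_one_of_pos a, Int.sign_eq_one_of_pos b]
          · rw [Int.sign_eq_neg_one_of_neg a, Int.sign_eq_neg_one_of_neg b]
        rw [hs]
        linear_combination e0 - (B j k).sign * e4
      · have z1 : max (B i k * B k j) 0 = 0 := max_eq_right (not_lt.1 hpos)
        have z2 : max (B j k * B k i) 0 = 0 := by
          rw [z1, mul_zero] at e4
          rcases mul_eq_zero.1 e4.symm with h' | h'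
          · exact absurd h' (hd j).ne'
          · exact h'
        rw [z1, z2]
        linear_combination e0

lemma path_back {d : Fin n → ℤ} (hd : ∀ i, 0 < d i) {B : Matrix (Fin n) (Fin n) ℤ}
    (h : SkD d B) {s : Matrix (Fin n) (Fin n) ℤ × (Fin n → CAField n)} (hs : IsSeed B s) :
    SkD d s.1 ∧ ((∃ k T, Good k T s.1) → ∃ k T, Good k T B) := by
  unfold IsSeed at hs
  induction hs with
  | refl => exact ⟨h, id⟩
  | tail _ hstep ih =>
    obtain ⟨k, rfl⟩ := hstep
    refine ⟨ih.1.mut hd k, ?_⟩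
    rintro ⟨m, T, hT⟩
    obtain ⟨T', hT', -⟩ := step hT k
    simp only [mutSeed, mutMat_mutMat] at hT'
    exact ih.2 ⟨m, T', hT'⟩

lemma ind_leaf (i : Fin n) : (leaf : BT n).ind i = 0 := rfl

/-- caterpillar trees -/
lemma cater (σ : Equiv.Perm (Fin n)) (A : Fin n → Fin n → ℤ)
    (hA : ∀ i j : Fin n, i.val + 1 = j.val → A i j ≠ 0) (m : ℕ) (hm : m < n) :
    ∃ T : BT n, T.RootIs (σ ⟨m, hm⟩) ∧ T.labels.Nodup ∧ (∀ i : Fin n, σ i ∈ T.labels ↔ i.val ≤ m) ∧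
      ∀ i j : Fin n, T.form (σ i) (σ j) =
        if i.val + 1 = j.val ∧ j.val ≤ m then (A i j).sign
        else if j.val + 1 = i.val ∧ i.val ≤ m then -(A j i).sign else 0 := by
  induction m with
  | zero =>
    refine ⟨node leaf (σ ⟨0, hm⟩) leaf, rfl, by simp [labels], ?_, ?_⟩
    · intro i
      simp [labels, Fin.ext_iff]
    · intro i j
      rw [if_neg (by omega), if_neg (by omega)]
      simp [form, ind]
  | succ m ih =>
    obtain ⟨T, h1, h2, h3, h4⟩ := ih (by omega)
    have hm' : m < n := by omega
    have hind : ∀ i, T.ind (σ i) = if i.val = m then 1 else 0 := by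
      intro i
      cases T with
      | leaf => exact h1.elim
      | node l t r =>
        have : t = σ ⟨m, hm'⟩ := h1
        simp [ind, this, Fin.ext_iff]
    have hnot : σ ⟨m + 1, hm⟩ ∉ T.labels := by
      rw [h3]; simp
    have hee : ∀ i, ee (σ ⟨m+1, hm⟩) (σ i) = if i.val = m + 1 then 1 else 0 := by
      intro i; simp [ee, Fin.ext_iff]
    have hne := hA ⟨m, hm'⟩ ⟨m+1, hm⟩ rfl
    have hsucc : ∀ i j : Fin n, (if i.val + 1 = j.val ∧ j.val ≤ m + 1 then (A i j).sign
        else if j.val + 1 = i.val ∧ i.val ≤ m + 1 then -(A j i).sign else 0) =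
        (if i.val + 1 = j.val ∧ j.val ≤ m then (A i j).sign
        else if j.val + 1 = i.val ∧ i.val ≤ m then -(A j i).sign else 0) +
        (A ⟨m, hm'⟩ ⟨m+1, hm⟩).sign * ((if i.val = m then 1 else 0) * (if j.val = m + 1 then 1 else 0)
          - (if j.val = m then 1 else 0) * (if i.val = m + 1 then 1 else 0)) := by
      intro i j
      by_cases c1 : i.val = m ∧ j.val = m + 1
      · have e1 : i = ⟨m, hm'⟩ := Fin.ext c1.1
        have e2 : j = ⟨m+1, hm⟩ := Fin.ext c1.2
        subst e1; subst e2
        simp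
        omega
      · by_cases c2 : j.val = m ∧ i.val = m + 1
        · have e1 : j = ⟨m, hm'⟩ := Fin.ext c2.1
          have e2 : i = ⟨m+1, hm⟩ := Fin.ext c2.2
          subst e1; subst e2
          have hmm : ¬ (m + 1 + 1 = m) := by omega
          simp [hmm]
        · have z1 : (if i.val = m then (1:ℤ) else 0) * (if j.val = m + 1 then 1 else 0) = 0 := by
            rw [ite_mul, one_mul, zero_mul, ← ite_and, if_neg c1]
          have z2 : (if j.val = m then (1:ℤ) else 0) * (if i.val = m + 1 then 1 else 0) = 0 := by
            rw [ite_mul, one_mul, zero_mul, ← ite_and, if_neg c2]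
          rw [z1, z2, sub_zero, mul_zero, add_zero]
          congr 1
          · simp only [eq_iff_iff]; omega
          · congr 1
            simp only [eq_iff_iff]; omega
    rcases lt_or_gt_of_ne hne with hneg | hpos
    · refine ⟨node leaf (σ ⟨m+1, hm⟩) T, rfl, by simp [labels, h2, hnot], ?_, ?_⟩
      · intro i
        simp only [labels, List.nil_append, List.mem_cons, h3, EmbeddingLike.apply_eq_iff_eq,
          Fin.ext_iff]
        omega
      · intro i j
        rw [hsucc, Int.sign_eq_neg_one_of_neg hneg]
        simp only [form, h4, hind, hee, ind_leaf]
        push_cast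
        ring
    · refine ⟨node T (σ ⟨m+1, hm⟩) leaf, rfl, ?_, ?_, ?_⟩
      · simp only [labels]
        rw [List.nodup_append]
        refine ⟨h2, by simp, ?_⟩
        intro a ha b hb
        simp only [List.mem_singleton] at hb
        rintro rfl
        subst hb; exact hnot ha
      · intro i
        simp only [labels, List.mem_append, List.mem_singleton, h3, EmbeddingLike.apply_eq_iff_eq,
          Fin.ext_iff]
        omega
      · intro i j
        rw [hsucc, Int.sign_eq_one_of_pos hpos]
        simp only [form, h4, hind, hee, ind_leaf]
        push_cast
        ring

lemma good_of_cartan (hn : 2 ≤ n) {d : Fin n → ℤ} (hd : ∀ i, 0 < d i)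
    {B : Matrix (Fin n) (Fin n) ℤ} (h : SkD d B) (σ : Equiv.Perm (Fin n))
    (hC : ∀ i j, cartanCounterpart B (σ i) (σ j) = cartanC n i j) : ∃ k T, Good k T B := by
  have hC' : ∀ i j : Fin n, i ≠ j → |B (σ i) (σ j)| = if i.val + 2 = n ∧ j.val + 1 = n then 2
      else if i.val + 1 = j.val ∨ j.val + 1 = i.val then 1 else 0 := by
    intro i j hij
    have := hC i j
    simp only [cartanCounterpart, cartanC, EmbeddingLike.apply_eq_iff_eq, hij, if_false] at this
    split_ifs at this ⊢ <;> linarith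
  obtain ⟨T, h1, h2, h3, h4⟩ := cater σ (fun i j => B (σ i) (σ j)) (by
    intro i j hij h0
    have := hC' i j (by intro e; subst e; omega)
    change B (σ i) (σ j) = 0 at h0
    rw [h0, abs_zero] at this
    split_ifs at this
    · simp at this
    · simp at this
    · omega) (n - 1) (by omega)
  refine ⟨_, T, h1, h2, ?_, ?_⟩
  · intro i
    obtain ⟨j, rfl⟩ := σ.surjective i
    rw [h3]; omega
  · intro i j
    obtain ⟨i, rfl⟩ := σ.surjective i
    obtain ⟨j, rfl⟩ := σ.surjective j
    rw [h4]
    have hcc : cc (σ ⟨n - 1, by omega⟩) (σ j) = if j.val + 1 = n then 2 else 1 := by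
      simp only [cc, EmbeddingLike.apply_eq_iff_eq, Fin.ext_iff]
      congr 1
      simp only [eq_iff_iff]; omega
    rw [hcc]
    by_cases hij : i = j
    · subst hij
      rw [if_neg (by omega), if_neg (by omega), zero_mul]
      have := h (σ i) (σ i)
      have h5 : d (σ i) * B (σ i) (σ i) = 0 := by linarith
      exact (mul_eq_zero.1 h5).resolve_left (hd _).ne'
    · have hab := hC' i j hij
      have hs := Int.sign_mul_abs (B (σ i) (σ j))
      rw [hab] at hs
      have hv : i.val ≠ j.val := fun e => hij (Fin.ext e)
      by_cases c1 : i.val + 1 = j.val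
      · rw [if_pos ⟨c1, by omega⟩]
        by_cases c2 : j.val + 1 = n
        · rw [if_pos (by omega)] at hs
          rw [if_pos c2]; exact hs.symm
        · rw [if_neg (by omega), if_pos (by omega)] at hs
          rw [if_neg c2]; exact hs.symm
      · rw [if_neg (by omega)]
        by_cases c2 : j.val + 1 = i.val
        · rw [if_pos (by omega), if_neg (by omega), mul_one, ← h.sign hd]
          rw [if_neg (by omega), if_pos (by omega), mul_one] at hs
          exact hs.symm
        · rw [if_neg (by omega), zero_mul]
          rw [if_neg (by omega), if_neg (by omega), mul_zero] at hs
          exact hs.symm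

lemma uVar_ne (i : Fin n) : uVar n i ≠ 0 := by
  unfold uVar
  intro h
  have := (map_eq_zero_iff _ (IsFractionRing.injective (MvPolynomial (Fin n) ℚ)
      (CAField n))).1 h
  exact X_ne_zero i this

lemma uVar_spec (i : Fin n) (t : ℚ) (h0 : 0 < t) (h1 : t ≤ 1) (j : Fin n) :
    ∃ r, 0 < r ∧ r ≤ 1 ∧ Spec (fun j => if j = i then t else 1) (uVar n j) r ∧
      (j ≠ i → 1 ≤ r) := by
  refine ⟨if j = i then t else 1, ?_, ?_, ?_, ?_⟩
  · split_ifs <;> linarith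
  · split_ifs <;> linarith
  · have := Spec.alg (z := fun j => if j = i then t else 1) (X j : MvPolynomial (Fin n) ℚ)
    rwa [eval_X] at this
  · intro h; simp [h]

lemma all_seeds (i₀ : Fin n) {k : Fin n} {T : BT n} {B : Matrix (Fin n) (Fin n) ℤ}
    (hG : Good k T B)
    (Λ : Lam (CAField n) T.size) (hR : Rlz Λ.f (uVar n) T 0)
    {s : Matrix (Fin n) (Fin n) ℤ × (Fin n → CAField n)} (hs : IsSeed B s) :
    ∃ T' p, T'.size = T.size ∧ Good k T' s.1 ∧ Rlz Λ.f s.2 T' p := by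
  have hnz : ∀ a b, a < b → b ≤ a + T.size → Λ.f a b ≠ 0 := by
    intro a b h1 h2
    rcases dichotomy (fun j => if j = i₀ then 1 else 1) T Λ i₀ (uVar n)
      (uVar_spec i₀ 1 one_pos le_rfl) hR hG.2.1 (hG.2.2.1 _) a b h1 h2 with h | ⟨r, h, h'⟩
    · rw [h]; exact uVar_ne _
    · exact h'.ne_zero (by linarith)
  unfold IsSeed at hs
  induction hs with
  | refl => exact ⟨T, 0, rfl, hG, hR⟩
  | @tail b c _ hstep ih =>
    obtain ⟨m, rfl⟩ := hstep
    obtain ⟨T', p, h1, h2, h3⟩ := ih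
    obtain ⟨T'', g1, g2, g3⟩ := step h2 m
    rw [h1] at g2 g3
    have hx : b.2 m ≠ 0 := by
      obtain ⟨u, v, e1, e2, e3⟩ := h3.exists_arc (h2.2.2.1 m)
      rw [e3]; exact hnz u v e1 (by omega)
    obtain ⟨p', hp'⟩ := g3 Λ p b.2 h3 hx
    exact ⟨T'', p', g2, g1, hp'⟩

lemma eval_bound (f : MvPolynomial (Fin n) ℚ) : ∃ C : ℚ, 0 ≤ C ∧ ∀ z : Fin n → ℚ,
    (∀ j, |z j| ≤ 1) → eval z f ≤ C := by
  refine ⟨∑ m ∈ f.support, |coeff m f|, Finset.sum_nonneg (fun _ _ => abs_nonneg _), ?_⟩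
  intro z hz
  rw [eval_eq']
  refine Finset.sum_le_sum (fun m _ => ?_)
  refine (le_abs_self _).trans ?_
  rw [abs_mul, Finset.abs_prod]
  refine mul_le_of_le_one_right (abs_nonneg _) ?_
  refine Finset.prod_le_one (fun _ _ => abs_nonneg _) (fun j _ => ?_)
  rw [abs_pow]
  exact pow_le_one₀ (abs_nonneg _) (hz j)

lemma aeval_uVar (f : MvPolynomial (Fin n) ℤ) :
    MvPolynomial.aeval (uVar n) f = algebraMap (MvPolynomial (Fin n) ℚ) (CAField n)
      (MvPolynomial.map (Int.castRingHom ℚ) f) := by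
  induction f using MvPolynomial.induction_on with
  | C c => simp
  | add p q hp hq => simp only [map_add, hp, hq]
  | mul_X p m hp => simp only [map_mul, hp, aeval_X, map_X, uVar]

end BT

/-- In a cluster pattern of type `C_n` (`n ≥ 2`), the denominator vector of a
non-initial cluster variable has nonnegative components. -/
theorem denominator_nonneg_type_C {n : ℕ} (hn : 2 ≤ n)
    (B : Matrix (Fin n) (Fin n) ℤ) (hB : SkewSymmetrizable B)
    (htype : PatternOfType (cartanC n) B) (y : CAField n)
    (hy : IsClusterVar B y) (hy0 : ∀ i, y ≠ uVar n i) (d : Fin n → ℤ)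
    (hd : IsDenomVec (uVar n) y d) :
    ∀ i, 0 ≤ d i := by
  obtain ⟨d', hd', hsk⟩ := hB
  have hS : BT.SkD d' B := by
    intro i j
    have := congrFun (congrFun hsk j) i
    simpa [Matrix.transpose_apply, Matrix.diagonal_mul] using this
  obtain ⟨s', hs', σ, hσ⟩ := htype
  have hback := BT.path_back hd' hS hs'
  obtain ⟨k, T, hG⟩ := hback.2 (BT.good_of_cartan hn hd' hback.1 σ hσ)
  obtain ⟨Λ, hR⟩ := BT.exists_lam (uVar n) BT.uVar_ne T k hG.1
  intro i
  by_contra hneg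
  push Not at hneg
  obtain ⟨s, hs, j, rfl⟩ := hy
  obtain ⟨T', p, h1, h2, h3⟩ := BT.all_seeds i hG Λ hR hs
  obtain ⟨a, b, e1, e2, e3⟩ := h3.exists_arc (h2.2.2.1 j)
  obtain ⟨f, -, hf⟩ := hd
  obtain ⟨C, hC0, hC⟩ := BT.eval_bound (MvPolynomial.map (Int.castRingHom ℚ) f)
  have hC1 : 0 < C + 1 := by linarith
  set t : ℚ := (C + 1)⁻¹ with ht
  have ht0 : 0 < t := inv_pos.2 hC1
  have ht1 : t ≤ 1 := inv_le_one_of_one_le₀ (by linarith)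
  rcases BT.dichotomy (fun j => if j = i then t else 1) T Λ i (uVar n)
    (BT.uVar_spec i t ht0 ht1) hR hG.2.1 (hG.2.2.1 _) a b e1 (by omega) with h | ⟨r, hr, hr'⟩
  · exact hy0 i (e3.trans h)
  · rw [← e3, hf] at hr'
    set z : Fin n → ℚ := fun j => if j = i then t else 1 with hz
    have hz0 : ∀ j, z j ≠ 0 := by
      intro j; simp only [hz]; split_ifs
      · exact ht0.ne'
      · exact one_ne_zero
    have hz1 : ∀ j, |z j| ≤ 1 := by
      intro j; simp only [hz]; split_ifs
      · rw [abs_of_pos ht0]; exact ht1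
      · simp
    have hnum := BT.aeval_uVar f
    have hden : Spec z (∏ j, uVar n j ^ d j) (∏ j, z j ^ d j) := by
      refine Spec.prod _ _ _ (fun j => ?_)
      have := Spec.alg (z := z) (X j : MvPolynomial (Fin n) ℚ)
      rw [eval_X] at this
      exact this.zpow (hz0 j) _
    have hprod : ∏ j, z j ^ d j = t ^ d i := by
      rw [Finset.prod_eq_single i]
      · simp [hz]
      · intro j _ hj; simp [hz, hj]
      · simp
    rw [hprod] at hden
    have htd : 0 < t ^ d i := zpow_pos ht0 _
    have hsp := (Spec.alg (z := z) (MvPolynomial.map (Int.castRingHom ℚ) f)).mul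
      (hden.inv htd.ne')
    rw [← hnum, ← div_eq_mul_inv] at hsp
    have hre := hr'.uniq hsp
    have hle := hC z hz1
    have hbig : C + 1 ≤ t ^ d i := by
      have : t ^ (-1 : ℤ) ≤ t ^ d i := zpow_le_zpow_right_of_le_one₀ ht0 ht1 (by omega)
      rwa [_root_.zpow_neg_one, ht, inv_inv] at this
    rw [hre, ← div_eq_mul_inv, le_div_iff₀ htd] at hr
    linarith
end
end
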